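/- Let 𝒟 be a finite family of m convex pseudo-disks in the plane. Then the union U(𝒟) can be partitioned into O(m) pairwise openly disjoint regions, each of which is either a triangle or a cap (an intersection of one member of 𝒟 with a halfplane), such that each region is fully contained in a single member of 𝒟. -/

import Mathlib

open scoped Classical

/-- A closed halfplane in `ℝ²`. -/
def IsClosedHalfplane (h : Set (Fin 2 → ℝ)) : Prop :=
  ∃ v : Fin 2 → ℝ, v ≠ 0 ∧ ∃ c : ℝ, h = {x | v 0 * x 0 + v 1 * x 1 ≤ c}

/-- A (possibly unbounded or degenerate) triangle: an intersection of three
closed halfplanes.  Unbounded triangles are bounded by one segment and two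
rays (wedges are a degenerate case). -/
def IsTriangleLike (Δ : Set (Fin 2 → ℝ)) : Prop :=
  ∃ h₁ h₂ h₃ : Set (Fin 2 → ℝ),
    IsClosedHalfplane h₁ ∧ IsClosedHalfplane h₂ ∧ IsClosedHalfplane h₃ ∧
    Δ = h₁ ∩ h₂ ∩ h₃

/-- A cap of a convex set `D`: its intersection with a closed halfplane. -/
def IsCapOf (D R : Set (Fin 2 → ℝ)) : Prop :=
  ∃ h : Set (Fin 2 → ℝ), IsClosedHalfplane h ∧ R = D ∩ h

/-- A family of convex pseudo-disks: closed convex sets such that for any two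
members `C, D`, both `C \ D` and `D \ C` are connected. -/
def IsPseudoDiskFamily (𝒟 : Finset (Set (Fin 2 → ℝ))) : Prop :=
  (∀ D ∈ 𝒟, Convex ℝ D ∧ IsClosed D) ∧
  (∀ C ∈ 𝒟, ∀ D ∈ 𝒟, IsPreconnected (C \ D))

/-- A closed halfplane of `ℝ × ℝ`. -/
def HalfPl (h : Set (ℝ × ℝ)) : Prop :=
  ∃ a b c : ℝ, (a ≠ 0 ∨ b ≠ 0) ∧ h = {p | a * p.1 + b * p.2 ≤ c}

/-- An intersection of three closed halfplanes of `ℝ × ℝ`. -/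
def Tri (Δ : Set (ℝ × ℝ)) : Prop :=
  ∃ h₁ h₂ h₃ : Set (ℝ × ℝ), HalfPl h₁ ∧ HalfPl h₂ ∧ HalfPl h₃ ∧ Δ = h₁ ∩ h₂ ∩ h₃

/-- A triangle contained in `D`, or a cap of `D`. -/
def IsPiece (D R : Set (ℝ × ℝ)) : Prop :=
  R ⊆ D ∧ (Tri R ∨ ∃ h, HalfPl h ∧ R = D ∩ h)

/-- `Dec N 𝒟 n X Y`: there are at most `n` openly disjoint pieces of members of `𝒟` which cover `X`
and whose interiors lie in `Y`, where points with first coordinate in `N` are disregarded. -/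
def Dec (N : Finset ℝ) (𝒟 : Set (Set (ℝ × ℝ))) (n : ℕ) (X Y : Set (ℝ × ℝ)) : Prop :=
  ∃ F : Finset (Set (ℝ × ℝ)), F.card ≤ n ∧ (∀ R ∈ F, ∃ D ∈ 𝒟, IsPiece D R) ∧
    (∀ R ∈ F, ∀ R' ∈ F, R ≠ R' → interior R ∩ interior R' = ∅) ∧
    (∀ p ∈ X, p.1 ∉ N → ∃ R ∈ F, p ∈ R) ∧
    (∀ R ∈ F, ∀ p ∈ interior R, p.1 ∉ N → p ∈ Y)

lemma exists_fst_notMem {O : Set (ℝ × ℝ)} (hO : IsOpen O) (hne : O.Nonempty) (N : Finset ℝ) :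
    ∃ p ∈ O, p.1 ∉ N := by
  have h1 : Dense ((N : Set ℝ)ᶜ) := N.finite_toSet.countable.dense_compl ℝ
  have h2 : Dense (Prod.fst ⁻¹' ((N : Set ℝ)ᶜ) : Set (ℝ × ℝ)) := h1.preimage isOpenMap_fst
  obtain ⟨p, hp, hp'⟩ := h2.inter_open_nonempty O hO hne
  exact ⟨p, hp, by simpa using hp'⟩

section Dec
variable {N : Finset ℝ} {𝒟 : Set (Set (ℝ × ℝ))} {n n' : ℕ} {X X' Y Y' : Set (ℝ × ℝ)}

lemma Dec.mono (h : Dec N 𝒟 n X Y) (hn : n ≤ n') (hX : ∀ p ∈ X', p.1 ∉ N → p ∈ X)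
    (hY : ∀ p ∈ Y, p.1 ∉ N → p ∈ Y') : Dec N 𝒟 n' X' Y' := by
  obtain ⟨F, h1, h2, h3, h4, h5⟩ := h
  exact ⟨F, h1.trans hn, h2, h3, fun p hp hN => h4 p (hX p hp hN) hN,
    fun R hR p hp hN => hY p (h5 R hR p hp hN) hN⟩

lemma Dec.empty (hX : ∀ p ∈ X, p.1 ∉ N → False) : Dec N 𝒟 n X Y :=
  ⟨∅, by simp, by simp, by simp, fun p hp hN => (hX p hp hN).elim, by simp⟩

lemma Dec.union (h : Dec N 𝒟 n X Y) (h' : Dec N 𝒟 n' X' Y') (hd : ∀ p ∈ Y, p ∈ Y' → False) :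
    Dec N 𝒟 (n + n') (X ∪ X') (Y ∪ Y') := by
  obtain ⟨F, h1, h2, h3, h4, h5⟩ := h
  obtain ⟨F', h1', h2', h3', h4', h5'⟩ := h'
  have key : ∀ R ∈ F, ∀ R' ∈ F', interior R ∩ interior R' = ∅ := by
    intro R hR R' hR'
    by_contra hne
    obtain ⟨p, hp, hN⟩ := exists_fst_notMem (isOpen_interior.inter isOpen_interior)
      (Set.nonempty_iff_ne_empty.2 hne) N
    exact hd p (h5 R hR p hp.1 hN) (h5' R' hR' p hp.2 hN)
  refine ⟨F ∪ F', (Finset.card_union_le _ _).trans (by omega), ?_, ?_, ?_, ?_⟩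
  · intro R hR
    rcases Finset.mem_union.1 hR with hR | hR
    exacts [h2 R hR, h2' R hR]
  · intro R hR R' hR' hne
    rcases Finset.mem_union.1 hR with hR | hR <;> rcases Finset.mem_union.1 hR' with hR' | hR'
    · exact h3 R hR R' hR' hne
    · exact key R hR R' hR'
    · rw [Set.inter_comm]; exact key R' hR' R hR
    · exact h3' R hR R' hR' hne
  · rintro p (hp | hp) hN
    · obtain ⟨R, hR, hpR⟩ := h4 p hp hN
      exact ⟨R, Finset.mem_union_left _ hR, hpR⟩
    · obtain ⟨R, hR, hpR⟩ := h4' p hp hN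
      exact ⟨R, Finset.mem_union_right _ hR, hpR⟩
  · intro R hR p hp hN
    rcases Finset.mem_union.1 hR with hR | hR
    exacts [Or.inl (h5 R hR p hp hN), Or.inr (h5' R hR p hp hN)]

lemma Dec.single {D R : Set (ℝ × ℝ)} (hD : D ∈ 𝒟) (hR : IsPiece D R)
    (hY : ∀ p ∈ interior R, p ∈ Y) : Dec N 𝒟 1 R Y := by
  refine ⟨{R}, by simp, by simpa using ⟨D, hD, hR⟩, ?_, ?_, ?_⟩
  · intro A hA B hB hne
    simp only [Finset.mem_singleton] at hA hB
    exact (hne (hA.trans hB.symm)).elim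
  · intro p hp _
    exact ⟨R, by simp, hp⟩
  · intro A hA p hp _
    simp only [Finset.mem_singleton] at hA
    subst hA; exact hY p hp

lemma Dec.biUnion {ι : Type*} (I : Finset ι) (X Y : ι → Set (ℝ × ℝ))
    (h : ∀ i ∈ I, Dec N 𝒟 n (X i) (Y i))
    (hd : ∀ i ∈ I, ∀ j ∈ I, i ≠ j → ∀ p ∈ Y i, p ∈ Y j → False) :
    Dec N 𝒟 (n * I.card) (⋃ i ∈ I, X i) (⋃ i ∈ I, Y i) := by
  classical
  induction I using Finset.induction_on with
  | empty => exact Dec.empty (by simp)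
  | insert a I ha ih =>
    have h1 := h a (Finset.mem_insert_self _ _)
    have h2 := ih (fun i hi => h i (Finset.mem_insert_of_mem hi))
      (fun i hi j hj => hd i (Finset.mem_insert_of_mem hi) j (Finset.mem_insert_of_mem hj))
    have h3 := h1.union h2 (by
      intro p hp hp'
      simp only [Set.mem_iUnion] at hp'
      obtain ⟨j, hj, hpj⟩ := hp'
      exact hd a (Finset.mem_insert_self _ _) j (Finset.mem_insert_of_mem hj)
        (by rintro rfl; exact ha hj) p hp hpj)
    refine h3.mono ?_ ?_ ?_
    · rw [Finset.card_insert_of_notMem ha, Nat.mul_add, Nat.mul_one, Nat.add_comm]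
    · intro p hp _
      rw [Finset.set_biUnion_insert] at hp
      exact hp
    · intro p hp _
      rw [Finset.set_biUnion_insert]
      exact hp

end Dec

lemma mem_seg {D : Set (ℝ × ℝ)} (hD : Convex ℝ D) {p q α β t : ℝ} (hp : (p, α + β * p) ∈ D)
    (hq : (q, α + β * q) ∈ D) (h1 : p ≤ t) (h2 : t ≤ q) : (t, α + β * t) ∈ D := by
  rcases eq_or_lt_of_le (h1.trans h2) with h | h
  · have : t = p := le_antisymm (h2.trans h.ge) h1
    rwa [this]
  · have h3 : 0 < q - p := by linarith
    have := hD hp hq (a := (q - t) / (q - p)) (b := (t - p) / (q - p))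
      (div_nonneg (by linarith) h3.le) (div_nonneg (by linarith) h3.le) (by field_simp; ring)
    convert this using 1
    ext <;> simp <;> field_simp <;> ring

lemma mem_vert {D : Set (ℝ × ℝ)} (hD : Convex ℝ D) {t y₁ y₂ y : ℝ} (h₁ : (t, y₁) ∈ D)
    (h₂ : (t, y₂) ∈ D) (h1 : y₁ ≤ y) (h2 : y ≤ y₂) : (t, y) ∈ D := by
  rcases eq_or_lt_of_le (h1.trans h2) with h | h
  · have : y = y₁ := le_antisymm (h2.trans h.ge) h1
    rwa [this]
  · have h3 : 0 < y₂ - y₁ := by linarith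
    have := hD h₁ h₂ (a := (y₂ - y) / (y₂ - y₁)) (b := (y - y₁) / (y₂ - y₁))
      (div_nonneg (by linarith) h3.le) (div_nonneg (by linarith) h3.le) (by field_simp; ring)
    convert this using 1
    ext <;> simp <;> field_simp <;> ring

/-- The affine function through two points of the plane. -/
lemma exists_affine (p y q z : ℝ) (h : p < q) : ∃ α β : ℝ, α + β * p = y ∧ α + β * q = z := by
  have : q - p ≠ 0 := by linarith
  refine ⟨y - (z - y) / (q - p) * p, (z - y) / (q - p), by ring, ?_⟩
  field_simp
  ring

lemma affine_le {p q t a b c d : ℝ} (h1 : a + b * p ≤ c + d * p) (h2 : a + b * q ≤ c + d * q)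
    (hp : p ≤ t) (hq : t ≤ q) : a + b * t ≤ c + d * t := by
  rcases eq_or_lt_of_le (hp.trans hq) with h | h
  · have : t = p := le_antisymm (hq.trans h.ge) hp
    rwa [this]
  · nlinarith [mul_nonneg (sub_nonneg.2 hp) (sub_nonneg.2 h2),
      mul_nonneg (sub_nonneg.2 hq) (sub_nonneg.2 h1)]

lemma lt_of_mem_interior {R : Set (ℝ × ℝ)} {a b c : ℝ} (hab : a ≠ 0 ∨ b ≠ 0)
    (h : ∀ q ∈ R, a * q.1 + b * q.2 ≤ c) {p : ℝ × ℝ} (hp : p ∈ interior R) :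
    a * p.1 + b * p.2 < c := by
  have hcont : Filter.Tendsto (fun ε : ℝ => (p.1 + ε * a, p.2 + ε * b)) (nhds 0) (nhds p) := by
    have : Continuous (fun ε : ℝ => (p.1 + ε * a, p.2 + ε * b)) := by fun_prop
    simpa using this.tendsto 0
  have h1 : ∀ᶠ ε in nhdsWithin (0 : ℝ) (Set.Ioi 0), (p.1 + ε * a, p.2 + ε * b) ∈ R :=
    (hcont.eventually (mem_interior_iff_mem_nhds.1 hp)).filter_mono nhdsWithin_le_nhds
  obtain ⟨ε, hε, hpos⟩ := (h1.and self_mem_nhdsWithin).exists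
  have h2 := h _ hε
  have hpos : 0 < ε := hpos
  have h3 : 0 < a * a + b * b := by
    rcases hab with h | h
    · have := mul_self_pos.2 h; nlinarith [mul_self_nonneg b]
    · have := mul_self_pos.2 h; nlinarith [mul_self_nonneg a]
  nlinarith [mul_pos hpos h3]

section Pieces
variable {N : Finset ℝ} {𝒟 : Set (Set (ℝ × ℝ))} {D : Set (ℝ × ℝ)}

lemma Dec.tri (hD : D ∈ 𝒟) {a₁ b₁ c₁ a₂ b₂ c₂ a₃ b₃ c₃ : ℝ} (h₁ : a₁ ≠ 0 ∨ b₁ ≠ 0)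
    (h₂ : a₂ ≠ 0 ∨ b₂ ≠ 0) (h₃ : a₃ ≠ 0 ∨ b₃ ≠ 0)
    (hsub : ∀ p : ℝ × ℝ, a₁ * p.1 + b₁ * p.2 ≤ c₁ → a₂ * p.1 + b₂ * p.2 ≤ c₂ →
      a₃ * p.1 + b₃ * p.2 ≤ c₃ → p ∈ D) :
    Dec N 𝒟 1 {p | a₁ * p.1 + b₁ * p.2 ≤ c₁ ∧ a₂ * p.1 + b₂ * p.2 ≤ c₂ ∧ a₃ * p.1 + b₃ * p.2 ≤ c₃}
      {p | a₁ * p.1 + b₁ * p.2 < c₁ ∧ a₂ * p.1 + b₂ * p.2 < c₂ ∧ a₃ * p.1 + b₃ * p.2 < c₃} := by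
  refine Dec.single hD ⟨fun p hp => hsub p hp.1 hp.2.1 hp.2.2, Or.inl ⟨_, _, _,
    ⟨a₁, b₁, c₁, h₁, rfl⟩, ⟨a₂, b₂, c₂, h₂, rfl⟩, ⟨a₃, b₃, c₃, h₃, rfl⟩, ?_⟩⟩ ?_
  · ext p; simp [and_assoc]
  · intro p hp
    exact ⟨lt_of_mem_interior h₁ (fun q hq => hq.1) hp,
      lt_of_mem_interior h₂ (fun q hq => hq.2.1) hp, lt_of_mem_interior h₃ (fun q hq => hq.2.2) hp⟩

lemma Dec.cap (hD : D ∈ 𝒟) {a b c : ℝ} (h : a ≠ 0 ∨ b ≠ 0) :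
    Dec N 𝒟 1 {p | p ∈ D ∧ a * p.1 + b * p.2 ≤ c} {p | p ∈ D ∧ a * p.1 + b * p.2 < c} := by
  refine Dec.single hD ⟨fun p hp => hp.1, Or.inr ⟨_, ⟨a, b, c, h, rfl⟩, rfl⟩⟩ ?_
  intro p hp
  exact ⟨(interior_subset hp).1, lt_of_mem_interior h (fun q hq => hq.2) hp⟩

variable {p q a b c d : ℝ}

lemma Dec.tri_left (hD : D ∈ 𝒟) (hc : Convex ℝ D) (hpq : p < q) (h1 : (p, a + b * p) ∈ D)
    (h2 : (q, a + b * q) ∈ D) (h3 : (q, c + d * q) ∈ D) (e : a + b * p = c + d * p)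
    (l : a + b * q < c + d * q) :
    Dec N 𝒟 1 {x | p ≤ x.1 ∧ x.1 ≤ q ∧ a + b * x.1 ≤ x.2 ∧ x.2 ≤ c + d * x.1}
      {x | p < x.1 ∧ x.1 < q ∧ a + b * x.1 < x.2 ∧ x.2 < c + d * x.1} := by
  have hdb : 0 < d - b := by nlinarith
  have key : ∀ t, c + d * t - (a + b * t) = (d - b) * (t - p) := fun t => by linear_combination -e
  refine (Dec.tri (N := N) hD (a₁ := 1) (b₁ := 0) (c₁ := q) (a₂ := b) (b₂ := -1) (c₂ := -a)
    (a₃ := -d) (b₃ := 1) (c₃ := c) (by simp) (by simp) (by simp) ?_).mono le_rfl ?_ ?_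
  · rintro ⟨t, y⟩ e1 e2 e3
    simp only at e1 e2 e3
    have : p ≤ t := by
      have := key t
      by_contra hlt
      push Not at hlt
      nlinarith [mul_pos hdb (sub_pos.2 hlt)]
    exact mem_vert hc (mem_seg hc h1 h2 this (by linarith))
      (mem_seg hc (e ▸ h1) h3 this (by linarith)) (by linarith) (by linarith)
  · rintro ⟨t, y⟩ ⟨e1, e2, e3, e4⟩ _
    simp only [Set.mem_ofPred_eq] at *
    exact ⟨by linarith, by linarith, by linarith⟩
  · rintro ⟨t, y⟩ ⟨e1, e2, e3⟩ _
    simp only [Set.mem_ofPred_eq] at *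
    refine ⟨?_, by linarith, by linarith, by linarith⟩
    have := key t
    by_contra hlt
    push Not at hlt
    nlinarith [mul_nonneg hdb.le (sub_nonneg.2 hlt)]

lemma Dec.tri_right (hD : D ∈ 𝒟) (hc : Convex ℝ D) (hpq : p < q) (h1 : (p, a + b * p) ∈ D)
    (h2 : (q, a + b * q) ∈ D) (h3 : (p, c + d * p) ∈ D) (e : a + b * q = c + d * q)
    (l : a + b * p < c + d * p) :
    Dec N 𝒟 1 {x | p ≤ x.1 ∧ x.1 ≤ q ∧ a + b * x.1 ≤ x.2 ∧ x.2 ≤ c + d * x.1}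
      {x | p < x.1 ∧ x.1 < q ∧ a + b * x.1 < x.2 ∧ x.2 < c + d * x.1} := by
  have hdb : 0 < b - d := by nlinarith
  have key : ∀ t, c + d * t - (a + b * t) = (b - d) * (q - t) := fun t => by linear_combination -e
  refine (Dec.tri (N := N) hD (a₁ := -1) (b₁ := 0) (c₁ := -p) (a₂ := b) (b₂ := -1) (c₂ := -a)
    (a₃ := -d) (b₃ := 1) (c₃ := c) (by simp) (by simp) (by simp) ?_).mono le_rfl ?_ ?_
  · rintro ⟨t, y⟩ e1 e2 e3
    simp only at e1 e2 e3
    have : t ≤ q := by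
      have := key t
      by_contra hlt
      push Not at hlt
      nlinarith [mul_pos hdb (sub_pos.2 hlt)]
    exact mem_vert hc (mem_seg hc h1 h2 (by linarith) this)
      (mem_seg hc h3 (e ▸ h2) (by linarith) this) (by linarith) (by linarith)
  · rintro ⟨t, y⟩ ⟨e1, e2, e3, e4⟩ _
    simp only [Set.mem_ofPred_eq] at *
    exact ⟨by linarith, by linarith, by linarith⟩
  · rintro ⟨t, y⟩ ⟨e1, e2, e3⟩ _
    simp only [Set.mem_ofPred_eq] at *
    refine ⟨by linarith, ?_, by linarith, by linarith⟩
    have := key t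
    by_contra hlt
    push Not at hlt
    nlinarith [mul_nonneg hdb.le (sub_nonneg.2 hlt)]

lemma Dec.trap (hD : D ∈ 𝒟) (hc : Convex ℝ D) (hpq : p < q) (h1 : (p, a + b * p) ∈ D)
    (h2 : (q, a + b * q) ∈ D) (h3 : (p, c + d * p) ∈ D) (h4 : (q, c + d * q) ∈ D)
    (l : a + b * p ≤ c + d * p) (l' : a + b * q ≤ c + d * q) :
    Dec N 𝒟 2 {x | p ≤ x.1 ∧ x.1 ≤ q ∧ a + b * x.1 ≤ x.2 ∧ x.2 < c + d * x.1}
      {x | p < x.1 ∧ x.1 < q ∧ a + b * x.1 < x.2 ∧ x.2 < c + d * x.1} := by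
  rcases eq_or_lt_of_le l with e | l <;> rcases eq_or_lt_of_le l' with e' | l'
  · refine Dec.empty ?_
    rintro ⟨t, y⟩ ⟨e1, e2, e3, e4⟩ _
    have := affine_le e.ge e'.ge e1 e2
    simp only at *
    linarith
  · exact (Dec.tri_left hD hc hpq h1 h2 h4 e l').mono (by norm_num)
      (fun x hx _ => ⟨hx.1, hx.2.1, hx.2.2.1, hx.2.2.2.le⟩) (fun x hx _ => hx)
  · exact (Dec.tri_right hD hc hpq h1 h2 h3 e' l).mono (by norm_num)
      (fun x hx _ => ⟨hx.1, hx.2.1, hx.2.2.1, hx.2.2.2.le⟩) (fun x hx _ => hx)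
  · obtain ⟨u, v, hu, hv⟩ := exists_affine p (a + b * p) q (c + d * q) hpq
    refine ((Dec.tri_left (N := N) hD hc hpq h1 h2 (hv ▸ h4) hu.symm (hv ▸ l')).union
      (Dec.tri_right (N := N) hD hc hpq (hu ▸ h1) (hv ▸ h4) h3 hv (hu ▸ l)) ?_).mono le_rfl ?_ ?_
    · rintro x ⟨-, -, -, h⟩ ⟨-, -, h', -⟩
      exact lt_asymm h h'
    · rintro x ⟨e1, e2, e3, e4⟩ _
      rcases le_total x.2 (u + v * x.1) with h | h
      · exact Or.inl ⟨e1, e2, e3, h⟩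
      · exact Or.inr ⟨e1, e2, h, e4.le⟩
    · rintro x (⟨e1, e2, e3, e4⟩ | ⟨e1, e2, e3, e4⟩) _
      · refine ⟨e1, e2, e3, e4.trans_le (affine_le (hu ▸ l.le) hv.le e1.le e2.le)⟩
      · refine ⟨e1, e2, lt_of_le_of_lt (affine_le hu.ge (hv ▸ l'.le) e1.le e2.le) e3, e4⟩

end Pieces

lemma up_closed_of_unbounded {D : Set (ℝ × ℝ)} (hc : Convex ℝ D) (hcl : IsClosed D) {A B : ℝ}
    (h : ∀ K, ∃ t y, A ≤ t ∧ t ≤ B ∧ K ≤ y ∧ (t, y) ∈ D) {t y y' : ℝ} (hty : (t, y) ∈ D)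
    (hy : y ≤ y') : (t, y') ∈ D := by
  rcases eq_or_lt_of_le hy with rfl | hy
  · exact hty
  have hs : 0 < y' - y := sub_pos.2 hy
  rw [← hcl.closure_eq, Metric.mem_closure_iff]
  intro δ hδ
  set M := |A| + |B| + |t| + 1 with hM
  have hMpos : 0 < M := by positivity
  obtain ⟨u, z, hu1, hu2, hz, huz⟩ := h (y' + (y' - y) * M / δ)
  have hzy : 0 < z - y := by
    have : 0 < (y' - y) * M / δ := by positivity
    linarith
  set ε := (y' - y) / (z - y) with hε
  have hε0 : 0 < ε := by positivity
  have hε1 : ε ≤ 1 := by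
    rw [hε, div_le_one hzy]
    have : 0 < (y' - y) * M / δ := by positivity
    linarith
  have hεM : ε * M < δ := by
    have h1 : (y' - y) * M / δ < z - y := by linarith
    rw [div_lt_iff₀ hδ] at h1
    rw [hε, div_mul_eq_mul_div, div_lt_iff₀ hzy]
    linarith
  refine ⟨(t + ε * (u - t), y'), ?_, ?_⟩
  · have := hc hty huz (a := 1 - ε) (b := ε) (by linarith) hε0.le (by ring)
    convert this using 1
    ext
    · simp; ring
    · have : ε * (z - y) = y' - y := by rw [hε]; field_simp
      simp
      linarith
  · rw [Prod.dist_eq, dist_self, max_lt_iff]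
    refine ⟨?_, hδ⟩
    rw [Real.dist_eq, show t - (t + ε * (u - t)) = ε * (t - u) by ring, abs_mul, abs_of_pos hε0]
    refine lt_of_le_of_lt (mul_le_mul_of_nonneg_left ?_ hε0.le) hεM
    have h2 : |t - u| ≤ |t| + |u| := abs_sub t u
    have h3 : |u| ≤ |A| + |B| := by
      rw [abs_le]
      constructor <;> linarith [neg_abs_le A, le_abs_self B, abs_nonneg A, abs_nonneg B]
    linarith

lemma exists_slice_max {D : Set (ℝ × ℝ)} (hcl : IsClosed D) {t y K : ℝ} (hty : (t, y) ∈ D)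
    (hK : ∀ y, (t, y) ∈ D → y ≤ K) : ∃ M, (t, M) ∈ D ∧ ∀ y, (t, y) ∈ D → y ≤ M := by
  have h1 : IsClosed {y : ℝ | (t, y) ∈ D} := hcl.preimage (by fun_prop)
  have h2 : BddAbove {y : ℝ | (t, y) ∈ D} := ⟨K, fun y hy => hK y hy⟩
  exact ⟨sSup {y : ℝ | (t, y) ∈ D}, h1.csSup_mem ⟨y, hty⟩ h2, fun y hy => le_csSup h2 hy⟩

lemma Dec.transport {N N' : Finset ℝ} {𝒟 : Set (Set (ℝ × ℝ))} {n : ℕ} {X Y : Set (ℝ × ℝ)}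
    (e : (ℝ × ℝ) ≃L[ℝ] (ℝ × ℝ)) (hN : ∀ p, (e p).1 ∈ N → p.1 ∈ N') (h : Dec N 𝒟 n X Y) :
    Dec N' ((fun D => e ⁻¹' D) '' 𝒟) n (e ⁻¹' X) (e ⁻¹' Y) := by
  have hhalf : ∀ h, HalfPl h → HalfPl (e ⁻¹' h) := by
    rintro h ⟨a, b, c, hab, rfl⟩
    have hlin : ∀ p : ℝ × ℝ, a * (e p).1 + b * (e p).2 =
        (a * (e (1, 0)).1 + b * (e (1, 0)).2) * p.1 +
          (a * (e (0, 1)).1 + b * (e (0, 1)).2) * p.2 := by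
      intro p
      have : p = p.1 • ((1, 0) : ℝ × ℝ) + p.2 • ((0, 1) : ℝ × ℝ) := by ext <;> simp
      conv_lhs => rw [this]
      rw [map_add, map_smul, map_smul]
      simp
      ring
    refine ⟨_, _, c, ?_, by ext p; simp only [Set.mem_preimage, Set.mem_ofPred_eq]; rw [hlin p]⟩
    by_contra hne
    push Not at hne
    have h0 := hlin (e.symm (a, b))
    rw [hne.1, hne.2] at h0
    simp only [ContinuousLinearEquiv.apply_symm_apply, zero_mul, add_zero] at h0
    rcases hab with h | h
    · have := mul_self_pos.2 h; nlinarith [mul_self_nonneg b]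
    · have := mul_self_pos.2 h; nlinarith [mul_self_nonneg a]
  obtain ⟨F, h1, h2, h3, h4, h5⟩ := h
  have h_interior : ∀ R : Set (ℝ × ℝ), interior (e ⁻¹' R) = e ⁻¹' interior R := fun R =>
    (e.toHomeomorph.preimage_interior R).symm
  refine ⟨F.image (fun R => e ⁻¹' R), Finset.card_image_le.trans h1, ?_, ?_, ?_, ?_⟩
  · intro R hR
    obtain ⟨R₀, hR₀, rfl⟩ := Finset.mem_image.1 hR
    obtain ⟨D, hD, hsub, hcase⟩ := h2 R₀ hR₀
    refine ⟨_, ⟨D, hD, rfl⟩, Set.preimage_mono hsub, ?_⟩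
    rcases hcase with ⟨k₁, k₂, k₃, e₁, e₂, e₃, rfl⟩ | ⟨k, hk, rfl⟩
    · exact Or.inl ⟨_, _, _, hhalf _ e₁, hhalf _ e₂, hhalf _ e₃, rfl⟩
    · exact Or.inr ⟨_, hhalf _ hk, rfl⟩
  · intro R hR R' hR' hne
    obtain ⟨R₀, hR₀, rfl⟩ := Finset.mem_image.1 hR
    obtain ⟨R₁, hR₁, rfl⟩ := Finset.mem_image.1 hR'
    rw [h_interior, h_interior, ← Set.preimage_inter, h3 R₀ hR₀ R₁ hR₁ (by rintro rfl; exact hne rfl),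
      Set.preimage_empty]
  · intro p hp hpN
    obtain ⟨R, hR, hpR⟩ := h4 (e p) hp (fun h => hpN (hN p h))
    exact ⟨_, Finset.mem_image_of_mem _ hR, hpR⟩
  · intro R hR p hp hpN
    obtain ⟨R₀, hR₀, rfl⟩ := Finset.mem_image.1 hR
    rw [h_interior] at hp
    exact h5 R₀ hR₀ (e p) hp (fun h => hpN (hN p h))

section Above
variable {N : Finset ℝ} {𝒟 : Set (Set (ℝ × ℝ))} {D : Set (ℝ × ℝ)} {p q a b : ℝ}

lemma Dec.above (hD : D ∈ 𝒟) (hc : Convex ℝ D) (hcl : IsClosed D) (hpq : p < q)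
    (h1 : (p, a + b * p) ∈ D) (h2 : (q, a + b * q) ∈ D) :
    Dec N 𝒟 3 {x | x ∈ D ∧ p ≤ x.1 ∧ x.1 ≤ q ∧ a + b * x.1 ≤ x.2}
      {x | x ∈ D ∧ p < x.1 ∧ x.1 < q ∧ a + b * x.1 < x.2} := by
  by_cases hup : ∀ t y y', (t, y) ∈ D → y ≤ y' → (t, y') ∈ D
  · refine (Dec.tri (N := N) hD (a₁ := -1) (b₁ := 0) (c₁ := -p) (a₂ := b) (b₂ := -1) (c₂ := -a)
      (a₃ := 1) (b₃ := 0) (c₃ := q) (by simp) (by simp) (by simp) ?_).mono (by norm_num) ?_ ?_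
    · rintro ⟨t, y⟩ e1 e2 e3
      simp only at e1 e2 e3
      exact hup t _ y (mem_seg hc h1 h2 (by linarith) (by linarith)) (by linarith)
    · rintro ⟨t, y⟩ ⟨e0, e1, e2, e3⟩ _
      simp only [Set.mem_ofPred_eq] at *
      exact ⟨by linarith, by linarith, by linarith⟩
    · rintro ⟨t, y⟩ ⟨e1, e2, e3⟩ _
      simp only [Set.mem_ofPred_eq] at *
      exact ⟨hup t _ y (mem_seg hc h1 h2 (by linarith) (by linarith)) (by linarith),
        by linarith, by linarith, by linarith⟩
  · have hbdd : ∀ t, ∃ K, ∀ y, (t, y) ∈ D → y ≤ K := by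
      intro t
      by_contra hK
      push Not at hK
      refine hup fun u y y' hy hyy => up_closed_of_unbounded hc hcl (A := t) (B := t) ?_ hy hyy
      intro K
      obtain ⟨y, hy, hKy⟩ := hK K
      exact ⟨t, y, le_rfl, le_rfl, hKy.le, hy⟩
    obtain ⟨K, hK⟩ := hbdd p
    obtain ⟨K', hK'⟩ := hbdd q
    obtain ⟨M, hM, hMmax⟩ := exists_slice_max hcl h1 hK
    obtain ⟨M', hM', hMmax'⟩ := exists_slice_max hcl h2 hK'
    obtain ⟨u, v, hu, hv⟩ := exists_affine p M q M' hpq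
    have key : ∀ x ∈ D, u + v * x.1 < x.2 → p < x.1 ∧ x.1 < q := by
      rintro ⟨t, y⟩ hx hlt
      simp only at hlt ⊢
      constructor
      · by_contra hle
        push Not at hle
        rcases eq_or_lt_of_le hle with rfl | hle
        · have := hMmax y hx; linarith
        · obtain ⟨r, s, hr, hs⟩ := exists_affine t y q M' (by linarith)
          have hm := hMmax _ (mem_seg hc (α := r) (β := s) (t := p) (hr.symm ▸ hx)
            (hs.symm ▸ hM') hle.le hpq.le)
          have e1 : r + s * p - (u + v * p) ≤ 0 := by linarith
          nlinarith
      · by_contra hle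
        push Not at hle
        rcases eq_or_lt_of_le hle with rfl | hle
        · have := hMmax' y hx; linarith
        · obtain ⟨r, s, hr, hs⟩ := exists_affine p M t y (by linarith)
          have hm := hMmax' _ (mem_seg hc (α := r) (β := s) (t := q) (hr.symm ▸ hM)
            (hs.symm ▸ hx) hpq.le hle.le)
          have e1 : r + s * q - (u + v * q) ≤ 0 := by linarith
          nlinarith
    refine ((Dec.trap (N := N) hD hc hpq h1 h2 (hu.symm ▸ hM) (hv.symm ▸ hM')
      (hu.symm ▸ hMmax _ h1) (hv.symm ▸ hMmax' _ h2)).union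
      (Dec.cap (N := N) hD (a := v) (b := -1) (c := -u) (by simp)) ?_).mono (by norm_num) ?_ ?_
    · rintro x ⟨-, -, -, h⟩ ⟨-, h'⟩
      linarith
    · rintro x ⟨e0, e1, e2, e3⟩ _
      rcases lt_or_ge x.2 (u + v * x.1) with h | h
      · exact Or.inl ⟨e1, e2, e3, h⟩
      · exact Or.inr ⟨e0, by linarith⟩
    · rintro x (⟨e1, e2, e3, e4⟩ | ⟨e1, e2⟩) _
      · exact ⟨mem_vert hc (mem_seg hc h1 h2 e1.le e2.le) (mem_seg hc (hu.symm ▸ hM)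
          (hv.symm ▸ hM') e1.le e2.le) e3.le e4.le, e1, e2, e3⟩
      · have hlt : u + v * x.1 < x.2 := by linarith
        obtain ⟨k1, k2⟩ := key x e1 hlt
        exact ⟨e1, k1, k2, lt_of_le_of_lt (affine_le (hu.symm ▸ hMmax _ h1)
          (hv.symm ▸ hMmax' _ h2) k1.le k2.le) hlt⟩

/-- Reflection in the horizontal axis. -/
noncomputable def flipY : (ℝ × ℝ) ≃L[ℝ] (ℝ × ℝ) :=
  (ContinuousLinearEquiv.refl ℝ ℝ).prodCongr (ContinuousLinearEquiv.neg ℝ)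

@[simp] lemma flipY_apply (x : ℝ × ℝ) : flipY x = (x.1, -x.2) := rfl

/-- Reflection in the vertical axis. -/
noncomputable def flipX : (ℝ × ℝ) ≃L[ℝ] (ℝ × ℝ) :=
  (ContinuousLinearEquiv.neg ℝ).prodCongr (ContinuousLinearEquiv.refl ℝ ℝ)

@[simp] lemma flipX_apply (x : ℝ × ℝ) : flipX x = (-x.1, x.2) := rfl

lemma Dec.of_flipY {n : ℕ} {X Y : Set (ℝ × ℝ)}
    (h : Dec N ((fun D => flipY ⁻¹' D) '' 𝒟) n (flipY ⁻¹' X) (flipY ⁻¹' Y)) : Dec N 𝒟 n X Y := by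
  have h' := h.transport (N' := N) flipY (by simp)
  have hinv : ∀ S : Set (ℝ × ℝ), flipY ⁻¹' (flipY ⁻¹' S) = S := by
    intro S; ext x; simp
  simpa only [Set.image_image, hinv, Set.image_id'] using h'

lemma Dec.of_flipX {n : ℕ} {X Y : Set (ℝ × ℝ)}
    (h : Dec ∅ ((fun D => flipX ⁻¹' D) '' 𝒟) n (flipX ⁻¹' X) (flipX ⁻¹' Y)) : Dec ∅ 𝒟 n X Y := by
  have h' := h.transport (N' := ∅) flipX (by simp)
  have hinv : ∀ S : Set (ℝ × ℝ), flipX ⁻¹' (flipX ⁻¹' S) = S := by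
    intro S; ext x; simp
  simpa only [Set.image_image, hinv, Set.image_id'] using h'

lemma Dec.below (hD : D ∈ 𝒟) (hc : Convex ℝ D) (hcl : IsClosed D) (hpq : p < q)
    (h1 : (p, a + b * p) ∈ D) (h2 : (q, a + b * q) ∈ D) :
    Dec N 𝒟 3 {x | x ∈ D ∧ p ≤ x.1 ∧ x.1 ≤ q ∧ x.2 < a + b * x.1}
      {x | x ∈ D ∧ p < x.1 ∧ x.1 < q ∧ x.2 < a + b * x.1} := by
  apply Dec.of_flipY
  have h := Dec.above (N := N) (𝒟 := (fun D => flipY ⁻¹' D) '' 𝒟) (D := flipY ⁻¹' D) (p := p)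
    (q := q) (a := -a) (b := -b) ⟨D, hD, rfl⟩ (hc.linear_preimage (flipY : (ℝ × ℝ) →ₗ[ℝ] (ℝ × ℝ)))
    (hcl.preimage flipY.continuous) hpq
    (by simpa [add_comm] using h1) (by simpa [add_comm] using h2)
  refine h.mono le_rfl ?_ ?_
  · rintro x ⟨e0, e1, e2, e3⟩ _
    simp only [flipY_apply] at e1 e2 e3
    exact ⟨e0, e1, e2, by linarith⟩
  · rintro x ⟨e0, e1, e2, e3⟩ _
    exact ⟨e0, e1, e2, by simp only [flipY_apply]; linarith⟩

end Above

section Edge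
variable {N : Finset ℝ} {𝒟 : Set (Set (ℝ × ℝ))} {D E : Set (ℝ × ℝ)} {p q a b c d : ℝ}

lemma Dec.gap (hD : D ∈ 𝒟) (hE : E ∈ 𝒟) (hDc : Convex ℝ D) (hEc : Convex ℝ E) (hDcl : IsClosed D)
    (hEcl : IsClosed E) (h1 : (p, a + b * p) ∈ D) (h2 : (q, a + b * q) ∈ D)
    (h3 : (p, c + d * p) ∈ E) (h4 : (q, c + d * q) ∈ E)
    (hlt : ∀ t y y', p < t → t < q → (t, y) ∈ D → (t, y') ∈ E → y < y') :
    Dec N 𝒟 6 {x | p < q ∧ (x ∈ D ∨ x ∈ E) ∧ p ≤ x.1 ∧ x.1 ≤ q ∧ a + b * x.1 ≤ x.2 ∧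
        x.2 < c + d * x.1}
      {x | p < x.1 ∧ x.1 < q ∧ a + b * x.1 < x.2 ∧ x.2 < c + d * x.1} := by
  by_cases hpq : p < q
  swap
  · exact Dec.empty fun x hx _ => hpq hx.1
  refine ((Dec.above (N := N) hD hDc hDcl hpq h1 h2).union
    (Dec.below (N := N) hE hEc hEcl hpq h3 h4) ?_).mono le_rfl ?_ ?_
  · rintro x ⟨e0, e1, e2, e3⟩ ⟨e4, -⟩
    exact lt_irrefl _ (hlt x.1 x.2 x.2 e1 e2 e0 e4)
  · rintro x ⟨-, hx | hx, e1, e2, e3, e4⟩ _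
    · exact Or.inl ⟨hx, e1, e2, e3⟩
    · exact Or.inr ⟨hx, e1, e2, e4⟩
  · rintro x (⟨e0, e1, e2, e3⟩ | ⟨e0, e1, e2, e3⟩) _
    · exact ⟨e1, e2, e3, hlt x.1 _ _ e1 e2 e0 (mem_seg hEc h3 h4 e1.le e2.le)⟩
    · exact ⟨e1, e2, hlt x.1 _ _ e1 e2 (mem_seg hDc h1 h2 e1.le e2.le) e0, e3⟩

lemma Dec.edge (hD : D ∈ 𝒟) (hE : E ∈ 𝒟) (hDc : Convex ℝ D) (hEc : Convex ℝ E) (hDcl : IsClosed D)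
    (hEcl : IsClosed E) (hpq : p < q) (h1 : (p, a + b * p) ∈ D) (h2 : (q, a + b * q) ∈ D)
    (h3 : (p, c + d * p) ∈ E) (h4 : (q, c + d * q) ∈ E) (l : a + b * p ≤ c + d * p)
    (l' : a + b * q ≤ c + d * q)
    (hW : ∀ t y y', p < t → t < q → (t, y) ∈ D → (t, y') ∈ E →
      (t, max y y') ∈ E ∧ (t, min y y') ∈ D) :
    Dec N 𝒟 16 {x | (x ∈ D ∨ x ∈ E) ∧ p ≤ x.1 ∧ x.1 ≤ q ∧ a + b * x.1 ≤ x.2 ∧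
        x.2 < c + d * x.1}
      {x | p < x.1 ∧ x.1 < q ∧ a + b * x.1 < x.2 ∧ x.2 < c + d * x.1} := by
  have hle : ∀ t, p ≤ t → t ≤ q → a + b * t ≤ c + d * t := fun t h h' => affine_le l l' h h'
  set C : Set (ℝ × ℝ) := {x | x ∈ D ∧ x ∈ E ∧ p ≤ x.1 ∧ x.1 ≤ q ∧ a + b * x.1 ≤ x.2 ∧
    x.2 ≤ c + d * x.1} with hC
  have hclip : ∀ t y y', p < t → t < q → (∀ z, (t, z) ∉ C) → (t, y) ∈ D → (t, y') ∈ E →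
      y < y' := by
    intro t y y' e1 e2 hno hy hy'
    by_contra hge
    push Not at hge
    have k1 := hW t y y' e1 e2 hy hy'
    rw [max_eq_left hge] at k1
    have hφ := mem_seg hDc h1 h2 e1.le e2.le
    have hψ := mem_seg hEc h3 h4 e1.le e2.le
    have k2 : (t, max (a + b * t) y) ∈ D ∧ (t, max (a + b * t) y) ∈ E := by
      refine ⟨?_, (hW t _ _ e1 e2 hφ k1.1).1⟩
      rcases max_choice (a + b * t) y with h | h <;> rw [h] <;> assumption
    refine hno (min (max (a + b * t) y) (c + d * t)) ⟨(hW t _ _ e1 e2 k2.1 hψ).2, ?_, e1.le, e2.le,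
      le_min (le_max_left _ _) (hle t e1.le e2.le), min_le_right _ _⟩
    rcases min_choice (max (a + b * t) y) (c + d * t) with h | h <;> rw [h]
    exacts [k2.2, hψ]
  have hcomp : IsCompact C := by
    have hcl : IsClosed C := by
      have c1 : IsClosed {x : ℝ × ℝ | p ≤ x.1} := isClosed_le (by fun_prop) (by fun_prop)
      have c2 : IsClosed {x : ℝ × ℝ | x.1 ≤ q} := isClosed_le (by fun_prop) (by fun_prop)
      have c3 : IsClosed {x : ℝ × ℝ | a + b * x.1 ≤ x.2} :=
        isClosed_le (by fun_prop) (by fun_prop)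
      have c4 : IsClosed {x : ℝ × ℝ | x.2 ≤ c + d * x.1} :=
        isClosed_le (by fun_prop) (by fun_prop)
      exact hDcl.inter (hEcl.inter (c1.inter (c2.inter (c3.inter c4))))
    refine (isCompact_Icc (a := p) (b := q)).prod (isCompact_Icc
      (a := min (a + b * p) (a + b * q)) (b := max (c + d * p) (c + d * q))) |>.of_isClosed_subset
      hcl ?_
    rintro ⟨t, y⟩ ⟨-, -, e1, e2, e3, e4⟩
    refine ⟨⟨e1, e2⟩, ?_, ?_⟩
    · have := affine_le (p := p) (q := q) (t := t) (a := min (a + b * p) (a + b * q)) (b := 0)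
        (c := a) (d := b) (by simp) (by simp) e1 e2
      simp only at *
      linarith
    · have := affine_le (p := p) (q := q) (t := t) (c := max (c + d * p) (c + d * q)) (d := 0)
        (a := c) (b := d) (by simp) (by simp) e1 e2
      simp only at *
      linarith
  rcases C.eq_empty_or_nonempty with hemp | hne
  · refine (Dec.gap (N := N) hD hE hDc hEc hDcl hEcl h1 h2 h3 h4 fun t y y' e1 e2 =>
      hclip t y y' e1 e2 fun z hz => by rw [hemp] at hz; exact hz).mono (by norm_num) ?_ ?_
    · rintro x hx _; exact ⟨hpq, hx⟩
    · rintro x hx _; exact hx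
  obtain ⟨⟨o₁, y₁⟩, m₁, hmin⟩ := hcomp.exists_isMinOn hne continuous_fst.continuousOn
  obtain ⟨⟨o₂, y₂⟩, m₂, hmax⟩ := hcomp.exists_isMaxOn hne continuous_fst.continuousOn
  have hmin' : ∀ t z, (t, z) ∈ C → o₁ ≤ t := fun t z h => hmin h
  have hmax' : ∀ t z, (t, z) ∈ C → t ≤ o₂ := fun t z h => hmax h
  have h12 : o₁ ≤ o₂ := hmin' _ _ m₂
  obtain ⟨i1, i2, i3, i4, i5, i6⟩ := m₁
  obtain ⟨j1, j2, j3, j4, j5, j6⟩ := m₂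
  simp only at i3 i4 i5 i6 j3 j4 j5 j6
  have hL := Dec.gap (N := N) hD hE hDc hEc hDcl hEcl h1 (mem_seg hDc h1 h2 i3 i4) h3
    (mem_seg hEc h3 h4 i3 i4) fun t y y' e1 e2 =>
      hclip t y y' e1 (by linarith) fun z hz => by have := hmin' _ _ hz; linarith
  have hR := Dec.gap (N := N) hD hE hDc hEc hDcl hEcl (mem_seg hDc h1 h2 j3 j4) h2
    (mem_seg hEc h3 h4 j3 j4) h4 fun t y y' e1 e2 =>
      hclip t y y' (by linarith) e2 fun z hz => by have := hmax' _ _ hz; linarith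
  have hM : Dec N 𝒟 4 {x | o₁ < o₂ ∧ o₁ ≤ x.1 ∧ x.1 ≤ o₂ ∧ a + b * x.1 ≤ x.2 ∧ x.2 < c + d * x.1}
      {x | o₁ < x.1 ∧ x.1 < o₂ ∧ a + b * x.1 < x.2 ∧ x.2 < c + d * x.1} := by
    by_cases hlt : o₁ < o₂
    swap
    · exact Dec.empty fun x hx _ => hlt hx.1
    obtain ⟨u, v, hu, hv⟩ := exists_affine o₁ y₁ o₂ y₂ hlt
    refine ((Dec.trap (N := N) hD hDc hlt (mem_seg hDc h1 h2 i3 i4) (mem_seg hDc h1 h2 j3 j4)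
      (hu.symm ▸ i1) (hv.symm ▸ j1) (hu.symm ▸ i5) (hv.symm ▸ j5)).union
      (Dec.trap (N := N) hE hEc hlt (hu.symm ▸ i2) (hv.symm ▸ j2) (mem_seg hEc h3 h4 i3 i4)
      (mem_seg hEc h3 h4 j3 j4) (hu.symm ▸ i6) (hv.symm ▸ j6)) ?_).mono le_rfl ?_ ?_
    · rintro x ⟨-, -, -, h⟩ ⟨-, -, h', -⟩
      exact lt_asymm h h'
    · rintro x ⟨-, e1, e2, e3, e4⟩ _
      rcases lt_or_ge x.2 (u + v * x.1) with h | h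
      · exact Or.inl ⟨e1, e2, e3, h⟩
      · exact Or.inr ⟨e1, e2, h, e4⟩
    · rintro x (⟨e1, e2, e3, e4⟩ | ⟨e1, e2, e3, e4⟩) _
      · exact ⟨e1, e2, e3, e4.trans_le (affine_le (hu.symm ▸ i6) (hv.symm ▸ j6) e1.le e2.le)⟩
      · exact ⟨e1, e2, (affine_le (hu.symm ▸ i5) (hv.symm ▸ j5) e1.le e2.le).trans_lt e3, e4⟩
  refine ((hL.union hR ?_).union hM ?_).mono (by norm_num) ?_ ?_
  · rintro x ⟨e1, e2, -⟩ ⟨e3, e4, -⟩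
    linarith
  · rintro x (⟨e1, e2, -⟩ | ⟨e1, e2, -⟩) ⟨e3, e4, -⟩ <;> linarith
  · rintro x ⟨e0, e1, e2, e3, e4⟩ _
    rcases lt_trichotomy x.1 o₁ with h | h | h
    · exact Or.inl (Or.inl ⟨by linarith, e0, e1, h.le, e3, e4⟩)
    · by_cases hp : p < o₁
      · exact Or.inl (Or.inl ⟨hp, e0, e1, h.le, e3, e4⟩)
      · by_cases hlt : o₁ < o₂
        · exact Or.inr ⟨hlt, h.ge, h.le.trans h12, e3, e4⟩
        · exact Or.inl (Or.inr ⟨by linarith, e0, by linarith, e2, e3, e4⟩)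
    · rcases le_or_gt x.1 o₂ with h' | h'
      · exact Or.inr ⟨by linarith, h.le, h', e3, e4⟩
      · exact Or.inl (Or.inr ⟨by linarith, e0, h'.le, e2, e3, e4⟩)
  · rintro x ((⟨e1, e2, e3⟩ | ⟨e1, e2, e3⟩) | ⟨e1, e2, e3⟩) _
    · exact ⟨e1, by linarith, e3⟩
    · exact ⟨by linarith, e2, e3⟩
    · exact ⟨by linarith, by linarith, e3⟩

end Edge

lemma OrdConnected.of_connected_to {A S : Set ℝ} (hA : A.OrdConnected) (hAS : A ⊆ S)
    (h : ∀ y ∈ S, ∃ x ∈ A, Set.uIcc y x ⊆ S) : S.OrdConnected := by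
  rw [Set.ordConnected_iff_uIcc_subset]
  intro y hy z hz w hw
  obtain ⟨x, hx, hyx⟩ := h y hy
  obtain ⟨x', hx', hzx⟩ := h z hz
  by_cases h1 : w ∈ Set.uIcc y x
  · exact hyx h1
  by_cases h2 : w ∈ Set.uIcc z x'
  · exact hzx h2
  · refine hAS ((Set.ordConnected_iff_uIcc_subset.1 hA) hx hx' ?_)
    rw [Set.mem_uIcc] at *
    grind

/-- Time sets on which slices form an antichain and still dominate all the slices. -/
lemma exists_times {ι : Type*} (s : ι → ℝ → Set ℝ) (hI : ∀ i, {t | (s i t).Nonempty}.OrdConnected)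
    (hP : ∀ i j, {t | ¬ s i t ⊆ s j t}.OrdConnected) (J : Finset ι) :
    ∃ T : ι → Set ℝ, (∀ i, (T i).OrdConnected) ∧ (∀ i, ∀ t ∈ T i, (s i t).Nonempty) ∧
      (∀ i, ∀ t ∈ T i, i ∈ J) ∧
      (∀ i ∈ J, ∀ t, (s i t).Nonempty → ∃ j, t ∈ T j ∧ s i t ⊆ s j t) ∧
      (∀ i j t, i ≠ j → t ∈ T i → t ∈ T j → ¬ s i t ⊆ s j t) := by
  induction J using Finset.induction_on with
  | empty => exact ⟨fun _ => ∅, by simp [Set.ordConnected_empty], by simp, by simp, by simp, by simp⟩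
  | insert n J hn ih =>
    obtain ⟨T, h1, h2, h3, h4, h5⟩ := ih
    set A : Set ℝ := {t | (s n t).Nonempty ∧ ∀ j ∈ J, ¬ s n t ⊆ s j t} with hA
    have hAo : A.OrdConnected := by
      have : A = {t | (s n t).Nonempty} ∩ ⋂ j, ⋂ (_ : j ∈ J), {t | ¬ s n t ⊆ s j t} := by
        ext t; simp [hA]
      rw [this]
      exact (hI n).inter (Set.ordConnected_iInter fun j => Set.ordConnected_iInter fun _ => hP n j)
    set B : ι → Set ℝ := fun i => {t | t ∈ T i ∧ s i t ⊆ s n t} with hB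
    set C : ι → Set ℝ := fun i => {t | ∃ x ∈ A, Set.uIcc t x ⊆ B i} with hC
    have hCB : ∀ i, C i ⊆ B i := fun i t ⟨x, _, h⟩ => h Set.left_mem_uIcc
    set S : Set ℝ := {t | t ∈ A ∨ ∃ i, t ∈ C i} with hS
    have hTn : T n = ∅ := Set.eq_empty_of_forall_notMem fun t ht => hn (h3 n t ht)
    have hdom : ∀ t, (s n t).Nonempty → t ∉ A → ∃ l, t ∈ T l ∧ s n t ⊆ s l t := by
      intro t ht htA
      have : ∃ j ∈ J, s n t ⊆ s j t := by
        by_contra hne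
        push Not at hne
        exact htA ⟨ht, hne⟩
      obtain ⟨j, hj, hsub⟩ := this
      obtain ⟨l, hl, hsub'⟩ := h4 j hj t (ht.mono hsub)
      exact ⟨l, hl, hsub.trans hsub'⟩
    have hSne : ∀ t ∈ S, (s n t).Nonempty := by
      rintro t (h | ⟨i, hi⟩)
      · exact h.1
      · have := hCB i hi
        exact (h2 i t this.1).mono this.2
    have hanti : ∀ i t, t ∈ T i → t ∉ C i → t ∈ S → ¬ s i t ⊆ s n t ∧ ¬ s n t ⊆ s i t := by
      intro i t hti htC htS
      by_cases htA : t ∈ A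
      · refine ⟨fun hsub => htC ⟨t, htA, ?_⟩, htA.2 i (h3 i t hti)⟩
        rw [Set.uIcc_self]
        rintro _ rfl
        exact ⟨hti, hsub⟩
      · obtain h | ⟨j, hj⟩ := htS
        · exact (htA h).elim
        have hjB := hCB j hj
        have hij : i ≠ j := by rintro rfl; exact htC hj
        refine ⟨fun hsub => ?_, fun hsub => h5 j i t hij.symm hjB.1 hti (hjB.2.trans hsub)⟩
        obtain ⟨l, hl, hsub'⟩ := hdom t ((h2 j t hjB.1).mono hjB.2) htA
        by_cases hjl : j = l
        · subst hjl
          exact h5 i j t hij hti hjB.1 (hsub.trans hsub')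
        · exact h5 j l t hjl hjB.1 hl (hjB.2.trans hsub')
    refine ⟨fun i => if i = n then S else T i \ C i, ?_, ?_, ?_, ?_, ?_⟩
    · intro i
      by_cases hi : i = n
      · simp only [hi, if_true]
        refine OrdConnected.of_connected_to hAo (fun t ht => Or.inl ht) ?_
        rintro y (hy | ⟨i, x, hx, hyx⟩)
        · exact ⟨y, hy, by rw [Set.uIcc_self]; rintro _ rfl; exact Or.inl hy⟩
        · refine ⟨x, hx, fun w hw => Or.inr ⟨i, x, hx, (Set.uIcc_subset_uIcc hw
            Set.right_mem_uIcc).trans hyx⟩⟩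
      · simp only [hi, if_false]
        refine ⟨fun y hy z hz w hw => ⟨(h1 i).out hy.1 hz.1 hw, fun hwC => ?_⟩⟩
        obtain ⟨x, hx, hwx⟩ := hwC
        have hyx : y < x := by
          by_contra hle
          push Not at hle
          refine hy.2 ⟨x, hx, (Set.uIcc_subset_uIcc ?_ Set.right_mem_uIcc).trans hwx⟩
          rw [Set.mem_uIcc]; exact Or.inr ⟨hle, hw.1⟩
        have hxz : x < z := by
          by_contra hle
          push Not at hle
          refine hz.2 ⟨x, hx, (Set.uIcc_subset_uIcc ?_ Set.right_mem_uIcc).trans hwx⟩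
          rw [Set.mem_uIcc]; exact Or.inl ⟨hw.2, hle⟩
        have k1 : ∃ u ∈ Set.Icc y x, ¬ s i u ⊆ s n u := by
          by_contra hne
          push Not at hne
          refine hy.2 ⟨x, hx, fun u hu => ?_⟩
          rw [Set.uIcc_of_le hyx.le] at hu
          exact ⟨(h1 i).out hy.1 hz.1 ⟨hu.1, hu.2.trans hxz.le⟩, hne u hu⟩
        have k2 : ∃ u ∈ Set.Icc x z, ¬ s i u ⊆ s n u := by
          by_contra hne
          push Not at hne
          refine hz.2 ⟨x, hx, fun u hu => ?_⟩
          rw [Set.uIcc_of_ge hxz.le] at hu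
          exact ⟨(h1 i).out hy.1 hz.1 ⟨hyx.le.trans hu.1, hu.2⟩, hne u hu⟩
        obtain ⟨u, hu, hu'⟩ := k1
        obtain ⟨v, hv, hv'⟩ := k2
        exact (hP i n).out hu' hv' ⟨hu.2, hv.1⟩ (hwx Set.right_mem_uIcc).2
    · intro i t ht
      by_cases hi : i = n
      · simp only [hi, if_true] at ht ⊢
        exact hSne t ht
      · simp only [hi, if_false] at ht
        exact h2 i t ht.1
    · intro i t ht
      by_cases hi : i = n
      · simp [hi]
      · simp only [hi, if_false] at ht
        exact Finset.mem_insert_of_mem (h3 i t ht.1)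
    · have key : ∀ l t, t ∈ T l → ∃ j, t ∈ (if j = n then S else T j \ C j) ∧ s l t ⊆ s j t := by
        intro l t hl
        by_cases hC : t ∈ C l
        · refine ⟨n, ?_, (hCB l hC).2⟩
          simp only [if_true]
          exact Or.inr ⟨l, hC⟩
        · refine ⟨l, ?_, subset_rfl⟩
          have : l ≠ n := by rintro rfl; rw [hTn] at hl; exact hl
          simp only [this, if_false]
          exact ⟨hl, hC⟩
      intro i hi t ht
      rcases Finset.mem_insert.1 hi with rfl | hi
      · by_cases htA : t ∈ A
        · refine ⟨i, ?_, subset_rfl⟩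
          simp only [if_true]
          exact Or.inl htA
        · obtain ⟨l, hl, hsub⟩ := hdom t ht htA
          obtain ⟨j, hj, hsub'⟩ := key l t hl
          exact ⟨j, hj, hsub.trans hsub'⟩
      · obtain ⟨l, hl, hsub⟩ := h4 i hi t ht
        obtain ⟨j, hj, hsub'⟩ := key l t hl
        exact ⟨j, hj, hsub.trans hsub'⟩
    · intro i j t hij hi hj
      by_cases hi' : i = n <;> by_cases hj' : j = n
      · exact (hij (hi'.trans hj'.symm)).elim
      · simp only [hi', hj', if_true, if_false] at hi hj ⊢
        exact (hanti j t hj.1 hj.2 hi).2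
      · simp only [hi', hj', if_true, if_false] at hi hj ⊢
        exact (hanti i t hi.1 hi.2 hj).1
      · simp only [hi', hj', if_false] at hi hj
        exact h5 i j t hij hi.1 hj.1

section Order

/-- At time `t`, the slice of `D` lies below the slice of `E`. -/
def Below (D E : Set (ℝ × ℝ)) (t : ℝ) : Prop :=
  (∃ y', (t, y') ∈ E ∧ ∀ y, (t, y) ∈ D → y < y') ∧ (∃ y, (t, y) ∈ D ∧ ∀ y', (t, y') ∈ E → y < y')

/-- Weak version of `Below`. -/
def WBelow (D E : Set (ℝ × ℝ)) (t : ℝ) : Prop :=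
  ∀ y y', (t, y) ∈ D → (t, y') ∈ E → (t, max y y') ∈ E ∧ (t, min y y') ∈ D

variable {D E G : Set (ℝ × ℝ)} {t : ℝ}

lemma below_or_below (hD : Convex ℝ D) (hE : Convex ℝ E)
    (h : ¬ {y | (t, y) ∈ D} ⊆ {y | (t, y) ∈ E}) (h' : ¬ {y | (t, y) ∈ E} ⊆ {y | (t, y) ∈ D}) :
    Below D E t ∨ Below E D t := by
  obtain ⟨a, ha, ha'⟩ := Set.not_subset.1 h
  obtain ⟨b, hb, hb'⟩ := Set.not_subset.1 h'
  simp only [Set.mem_ofPred_eq] at ha ha' hb hb'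
  rcases lt_trichotomy a b with hab | rfl | hab
  · left
    refine ⟨⟨b, hb, fun y hy => ?_⟩, ⟨a, ha, fun y hy => ?_⟩⟩ <;> by_contra hle <;>
      push Not at hle
    · exact hb' (mem_vert hD ha hy hab.le hle)
    · exact ha' (mem_vert hE hy hb hle hab.le)
  · exact (ha' hb).elim
  · right
    refine ⟨⟨a, ha, fun y hy => ?_⟩, ⟨b, hb, fun y hy => ?_⟩⟩ <;> by_contra hle <;>
      push Not at hle
    · exact ha' (mem_vert hE hb hy hab.le hle)
    · exact hb' (mem_vert hD hy ha hle hab.le)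

lemma Below.wBelow (hD : Convex ℝ D) (hE : Convex ℝ E) (h : Below D E t) : WBelow D E t := by
  obtain ⟨⟨b, hb, hb'⟩, ⟨a, ha, ha'⟩⟩ := h
  intro y y' hy hy'
  rcases le_total y y' with hle | hle
  · rw [max_eq_right hle, min_eq_left hle]; exact ⟨hy', hy⟩
  · rw [max_eq_left hle, min_eq_right hle]
    exact ⟨mem_vert hE hy' hb hle (hb' y hy).le, mem_vert hD ha hy (ha' y' hy').le hle⟩

lemma Below.asymm (h : Below D E t) (h' : Below E D t) : False := by
  obtain ⟨⟨b, hb, hb'⟩, -⟩ := h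
  obtain ⟨⟨y, hy, hy'⟩, -⟩ := h'
  exact lt_asymm (hb' y hy) (hy' b hb)

lemma Below.trans (h : Below D E t) (h' : Below E G t) : Below D G t := by
  obtain ⟨⟨b, hb, hb'⟩, ⟨a, ha, ha'⟩⟩ := h
  obtain ⟨⟨c, hc, hc'⟩, ⟨d, hd, hd'⟩⟩ := h'
  exact ⟨⟨c, hc, fun y hy => (hb' y hy).trans (hc' b hb)⟩,
    ⟨a, ha, fun y hy => (ha' d hd).trans (hd' y hy)⟩⟩

lemma exists_selection (hD : Convex ℝ D) {t₀ t₁ z₀ z₁ y : ℝ} (h₀ : (t₀, z₀) ∈ D)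
    (h₁ : (t₁, z₁) ∈ D) (ht : t ∈ Set.Icc t₀ t₁) (hy : (t, y) ∈ D) :
    ∃ g : ℝ → ℝ, Continuous g ∧ g t = y ∧ ∀ u ∈ Set.Icc t₀ t₁, (u, g u) ∈ D := by
  have ha : ∃ a, ∀ u, t₀ ≤ u → u ≤ t → (u, y + a * (u - t)) ∈ D := by
    rcases eq_or_lt_of_le ht.1 with rfl | h
    · refine ⟨0, fun u h1 h2 => ?_⟩
      obtain rfl : u = t₀ := le_antisymm h2 h1
      simpa using hy
    · obtain ⟨r, s, hr, hs⟩ := exists_affine t₀ z₀ t y h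
      refine ⟨s, fun u h1 h2 => ?_⟩
      have := mem_seg hD (α := r) (β := s) (hr.symm ▸ h₀) (hs.symm ▸ hy) h1 h2
      rwa [show y + s * (u - t) = r + s * u by rw [← hs]; ring]
  have hb : ∃ b, ∀ u, t ≤ u → u ≤ t₁ → (u, y + b * (u - t)) ∈ D := by
    rcases eq_or_lt_of_le ht.2 with rfl | h
    · refine ⟨0, fun u h1 h2 => ?_⟩
      obtain rfl : u = t := le_antisymm h2 h1
      simpa using hy
    · obtain ⟨r, s, hr, hs⟩ := exists_affine t y t₁ z₁ h
      refine ⟨s, fun u h1 h2 => ?_⟩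
      have := mem_seg hD (α := r) (β := s) (hr.symm ▸ hy) (hs.symm ▸ h₁) h1 h2
      rwa [show y + s * (u - t) = r + s * u by rw [← hr]; ring]
  obtain ⟨a, ha⟩ := ha
  obtain ⟨b, hb⟩ := hb
  refine ⟨fun u => y + a * min (u - t) 0 + b * max (u - t) 0, by fun_prop, by simp, ?_⟩
  intro u hu
  rcases le_total u t with h | h
  · have := ha u hu.1 h
    simpa [min_eq_left (sub_nonpos.2 h), max_eq_right (sub_nonpos.2 h)] using this
  · have := hb u h hu.2
    simpa [min_eq_right (sub_nonneg.2 h), max_eq_left (sub_nonneg.2 h)] using this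

lemma WBelow.closure (hD : Convex ℝ D) (hE : Convex ℝ E) (hDcl : IsClosed D) (hEcl : IsClosed E)
    {p q z₀ z₁ w₀ w₁ : ℝ} (hpq : p < q) (h : ∀ t ∈ Set.Ioo p q, WBelow D E t) (h₀ : (p, z₀) ∈ D)
    (h₁ : (q, z₁) ∈ D) (k₀ : (p, w₀) ∈ E) (k₁ : (q, w₁) ∈ E) :
    ∀ t ∈ Set.Icc p q, WBelow D E t := by
  intro t ht y y' hy hy'
  obtain ⟨g, hg, rfl, hgD⟩ := exists_selection hD h₀ h₁ ht hy
  obtain ⟨g', hg', rfl, hgE⟩ := exists_selection hE k₀ k₁ ht hy'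
  have c1 : IsClosed {u | (u, max (g u) (g' u)) ∈ E} := hEcl.preimage (by fun_prop)
  have c2 : IsClosed {u | (u, min (g u) (g' u)) ∈ D} := hDcl.preimage (by fun_prop)
  have hsub : Set.Icc p q ⊆ {u | (u, max (g u) (g' u)) ∈ E} ∩ {u | (u, min (g u) (g' u)) ∈ D} := by
    rw [← closure_Ioo hpq.ne]
    refine closure_minimal (fun u hu => ?_) (c1.inter c2)
    have hu' := Set.Ioo_subset_Icc_self hu
    exact h u hu _ _ (hgD u hu') (hgE u hu')
  exact hsub ht

lemma Below.eventually (hD : Convex ℝ D) (hE : Convex ℝ E) (hDcl : IsClosed D)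
    {J : Set ℝ} (hJ : J.OrdConnected) {t₀ t₁ : ℝ}
    (hJD : ∀ t ∈ J, ∃ y, (t, y) ∈ D) (hJE : ∀ t ∈ J, ∃ y, (t, y) ∈ E)
    (hor : ∀ t ∈ J, Below D E t ∨ Below E D t) (h₀ : t₀ ∈ J) (h₁ : t₁ ∈ J)
    (ht : t ∈ Set.Icc t₀ t₁) (h : Below D E t) :
    ∀ᶠ u in nhdsWithin t (Set.Icc t₀ t₁), Below D E u := by
  obtain ⟨⟨b, hb, hb'⟩, ⟨a, ha, ha'⟩⟩ := h
  obtain ⟨z₀, hz₀⟩ := hJD _ h₀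
  obtain ⟨z₁, hz₁⟩ := hJD _ h₁
  obtain ⟨w₀, hw₀⟩ := hJE _ h₀
  obtain ⟨w₁, hw₁⟩ := hJE _ h₁
  obtain ⟨g, hg, rfl, hgD⟩ := exists_selection hD hz₀ hz₁ ht ha
  obtain ⟨g', hg', rfl, hgE⟩ := exists_selection hE hw₀ hw₁ ht hb
  have e1 : ∀ᶠ u in nhds t, g u < g' u :=
    (isOpen_lt hg hg').mem_nhds (hb' _ ha)
  have e2 : ∀ᶠ u in nhds t, (u, g' u) ∉ D := by
    have : IsOpen {u | (u, g' u) ∈ D}ᶜ := (hDcl.preimage (by fun_prop)).isOpen_compl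
    exact this.mem_nhds fun h => lt_irrefl _ (hb' _ h)
  filter_upwards [nhdsWithin_le_nhds e1, nhdsWithin_le_nhds e2, self_mem_nhdsWithin] with u k1 k2 hu
  rcases hor u (hJ.out h₀ h₁ hu) with h | h
  · exact h
  · obtain ⟨⟨d, hd, hd'⟩, -⟩ := h
    exact (k2 (mem_vert hD (hgD u hu) hd k1.le (hd' _ (hgE u hu)).le)).elim

lemma Below.constant (hD : Convex ℝ D) (hE : Convex ℝ E) (hDcl : IsClosed D) (hEcl : IsClosed E)
    {J : Set ℝ} (hJ : J.OrdConnected)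
    (hJD : ∀ t ∈ J, ∃ y, (t, y) ∈ D) (hJE : ∀ t ∈ J, ∃ y, (t, y) ∈ E)
    (hor : ∀ t ∈ J, Below D E t ∨ Below E D t) {u : ℝ} (ht : t ∈ J) (hu : u ∈ J)
    (h : Below D E t) : Below D E u := by
  wlog htu : t ≤ u generalizing D E t u with H
  · rcases hor u hu with h' | h'
    · exact h'
    · exact (h.asymm (H hE hD hEcl hDcl hJE hJD (fun t ht => (hor t ht).symm) hu ht h'
        (le_of_not_ge htu))).elim
  refine (isPreconnected_Icc (a := t) (b := u)).induction₂ (fun x y => Below D E x ↔ Below D E y)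
    ?_ ?_ ?_ (Set.left_mem_Icc.2 htu) (Set.right_mem_Icc.2 htu) |>.1 h
  · intro x hx
    rcases hor x (hJ.out ht hu hx) with h' | h'
    · filter_upwards [Below.eventually hD hE hDcl hJ hJD hJE hor ht hu hx h'] with y hy
      simp [h', hy]
    · filter_upwards [Below.eventually hE hD hEcl hJ hJE hJD (fun t ht => (hor t ht).symm) ht hu hx
        h'] with y hy
      simp [show ¬ Below D E x from fun k => k.asymm h', show ¬ Below D E y from fun k => k.asymm hy]
  · intro x y z _ _ _ h1 h2; exact h1.trans h2
  · intro x y _ _ h1; exact h1.symm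

/-- Among finitely many open intervals with an order on the slices there is a topmost one. -/
lemma exists_top {ι : Type*} (s e : ι → ℝ) (D : ι → Set (ℝ × ℝ)) (Q : Finset ι) (hQ : Q.Nonempty)
    (hse : ∀ i ∈ Q, s i < e i)
    (hconst : ∀ i ∈ Q, ∀ j ∈ Q, ∀ t ∈ Set.Ioo (s i) (e i), t ∈ Set.Ioo (s j) (e j) →
      ∀ u ∈ Set.Ioo (s i) (e i), u ∈ Set.Ioo (s j) (e j) → Below (D i) (D j) t → Below (D i) (D j) u) :
    ∃ k ∈ Q, ∀ j ∈ Q, ∀ t ∈ Set.Ioo (s k) (e k), t ∈ Set.Ioo (s j) (e j) →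
      ¬ Below (D k) (D j) t := by
  induction Q using Finset.strongInduction with
  | H Q ih =>
  obtain ⟨i, hi, hmin⟩ := Q.exists_min_image e hQ
  by_cases hQ' : (Q.erase i).Nonempty
  swap
  · refine ⟨i, hi, fun j hj t _ _ hB => ?_⟩
    have hji : j = i := by
      by_contra hne
      exact hQ' ⟨j, Finset.mem_erase.2 ⟨hne, hj⟩⟩
    subst hji
    exact hB.asymm hB
  have hsub : ∀ j ∈ Q.erase i, j ∈ Q := fun j hj => Finset.mem_of_mem_erase hj
  obtain ⟨k, hk, htop⟩ := ih _ (Finset.erase_ssubset hi) hQ' (fun j hj => hse j (hsub j hj))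
    (fun j hj l hl => hconst j (hsub j hj) l (hsub l hl))
  by_cases hrel : ∃ t ∈ Set.Ioo (s k) (e k), t ∈ Set.Ioo (s i) (e i) ∧ Below (D k) (D i) t
  swap
  · push Not at hrel
    refine ⟨k, hsub k hk, fun j hj t ht ht' => ?_⟩
    by_cases hji : j = i
    · subst hji; exact hrel t ht ht'
    · exact htop j (Finset.mem_erase.2 ⟨hji, hj⟩) t ht ht'
  obtain ⟨t, htk, hti, hB⟩ := hrel
  refine ⟨i, hi, fun q hq u hui huq hB' => ?_⟩
  by_cases hqi : q = i
  · subst hqi; exact hB'.asymm hB'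
  have hv : max t u ∈ Set.Ioo (s i) (e i) :=
    ⟨lt_max_of_lt_left hti.1, max_lt hti.2 hui.2⟩
  have hvk : max t u ∈ Set.Ioo (s k) (e k) :=
    ⟨lt_max_of_lt_left htk.1, hv.2.trans_le (hmin k (hsub k hk))⟩
  have hvq : max t u ∈ Set.Ioo (s q) (e q) :=
    ⟨lt_max_of_lt_right huq.1, hv.2.trans_le (hmin q hq)⟩
  refine htop q (Finset.mem_erase.2 ⟨hqi, hq⟩) _ hvk hvq
    ((hconst k (hsub k hk) i hi t htk hti _ hvk hv hB).trans
      (hconst i hi q hq u hui huq _ hv hvq hB'))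

end Order

lemma recession {D : Set (ℝ × ℝ)} (hc : Convex ℝ D) (hcl : IsClosed D) {p q v : ℝ × ℝ}
    (hp : ∀ s : ℝ, 0 ≤ s → p + s • v ∈ D) (hq : q ∈ D) {s : ℝ} (hs : 0 ≤ s) : q + s • v ∈ D := by
  have hlim : Filter.Tendsto (fun ε : ℝ => q + s • v + ε • (p - q)) (nhdsWithin 0 (Set.Ioo 0 1))
      (nhds (q + s • v)) := by
    have : Continuous (fun ε : ℝ => q + s • v + ε • (p - q)) := by fun_prop
    simpa using (this.tendsto 0).mono_left nhdsWithin_le_nhds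
  have hne : (nhdsWithin (0 : ℝ) (Set.Ioo 0 1)).NeBot := by
    rw [← mem_closure_iff_nhdsWithin_neBot, closure_Ioo (by norm_num)]
    simp
  refine hcl.mem_of_tendsto hlim ?_
  filter_upwards [self_mem_nhdsWithin] with ε hε
  have := hc hq (hp (s / ε) (div_nonneg hs hε.1.le)) (a := 1 - ε) (b := ε) (by linarith [hε.2])
    hε.1.le (by ring)
  convert this using 1
  have h1 : ε * (s / ε) = s := by field_simp [hε.1.ne']
  ext
  · simp only [Prod.fst_add, Prod.smul_fst, smul_eq_mul, Prod.fst_sub]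
    linear_combination (-v.1) * h1
  · simp only [Prod.snd_add, Prod.smul_snd, smul_eq_mul, Prod.snd_sub]
    linear_combination (-v.2) * h1

lemma exists_ray {C : Set (ℝ × ℝ)} (hc : Convex ℝ C) (hcl : IsClosed C) {R y₀ : ℝ}
    (h₀ : (R, y₀) ∈ C) (hne : ∀ t, R ≤ t → ∃ y, (t, y) ∈ C)
    (hb : ∀ t, R ≤ t → ∃ m M, ∀ y, (t, y) ∈ C → m ≤ y ∧ y ≤ M) :
    ∃ α β : ℝ, ∀ t, R ≤ t → (t, α + β * t) ∈ C := by
  set K : ℕ → Set ℝ := fun n => {m | (R + (n + 1), y₀ + m * (n + 1)) ∈ C} with hK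
  have hpos : ∀ n : ℕ, (0 : ℝ) < n + 1 := fun n => by positivity
  have hKcl : ∀ n, IsClosed (K n) := fun n => hcl.preimage (by fun_prop)
  have hmono : ∀ n, K (n + 1) ⊆ K n := by
    intro n m hm
    have hm : (R + ((n + 1 : ℕ) + 1), y₀ + m * ((n + 1 : ℕ) + 1)) ∈ C := hm
    have := mem_seg hc (α := y₀ - m * R) (β := m) (p := R) (q := R + ((n + 1 : ℕ) + 1))
      (t := R + (n + 1)) (by convert h₀ using 2; ring) (by convert hm using 2; ring)
      (by linarith [hpos n]) (by push_cast; linarith)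
    change (R + (n + 1), y₀ + m * (n + 1)) ∈ C
    convert this using 2
    ring
  have hKne : ∀ n, (K n).Nonempty := by
    intro n
    obtain ⟨y, hy⟩ := hne (R + (n + 1)) (by linarith [hpos n])
    refine ⟨(y - y₀) / (n + 1), ?_⟩
    change (R + ((n : ℝ) + 1), y₀ + (y - y₀) / (n + 1) * (n + 1)) ∈ C
    rwa [div_mul_cancel₀ _ (hpos n).ne', add_sub_cancel]
  have hK0 : IsCompact (K 0) := by
    obtain ⟨m, M, hmM⟩ := hb (R + ((0 : ℕ) + 1)) (by simp)
    refine (isCompact_Icc (a := m - y₀) (b := M - y₀)).of_isClosed_subset (hKcl 0) fun z hz => ?_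
    have := hmM _ hz
    simp only [Nat.cast_zero, zero_add, mul_one] at this
    exact ⟨by linarith [this.1], by linarith [this.2]⟩
  obtain ⟨m, hm⟩ := IsCompact.nonempty_iInter_of_sequence_nonempty_isCompact_isClosed K hmono hKne
    hK0 hKcl
  rw [Set.mem_iInter] at hm
  refine ⟨y₀ - m * R, m, fun t ht => ?_⟩
  obtain ⟨n, hn⟩ := exists_nat_ge (t - R)
  have hmn : (R + ((n : ℝ) + 1), y₀ + m * (n + 1)) ∈ C := hm n
  exact mem_seg hc (p := R) (q := R + (n + 1)) (by convert h₀ using 2; ring)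
    (by convert hmn using 2; ring) ht (by linarith)

section EndSlab
variable {𝒟 : Set (Set (ℝ × ℝ))} {D : Set (ℝ × ℝ)} {N : Finset ℝ} {R α β : ℝ}

lemma Dec.end_above (hD : D ∈ 𝒟) (hc : Convex ℝ D) (hcl : IsClosed D)
    (hray : ∀ t, R ≤ t → (t, α + β * t) ∈ D) :
    Dec N 𝒟 2 {x | x ∈ D ∧ R ≤ x.1 ∧ α + β * x.1 ≤ x.2}
      {x | x ∈ D ∧ R < x.1 ∧ α + β * x.1 < x.2} := by
  by_cases hup : ∀ t y y', (t, y) ∈ D → y ≤ y' → (t, y') ∈ D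
  · refine (Dec.tri (N := N) hD (a₁ := -1) (b₁ := 0) (c₁ := -R) (a₂ := β) (b₂ := -1) (c₂ := -α)
      (a₃ := β) (b₃ := -1) (c₃ := -α) (by simp) (by simp) (by simp) ?_).mono (by norm_num) ?_ ?_
    · rintro ⟨t, y⟩ e1 e2 -
      simp only at e1 e2
      exact hup t _ y (hray t (by linarith)) (by linarith)
    · rintro ⟨t, y⟩ ⟨e0, e1, e2⟩ _
      simp only [Set.mem_ofPred_eq] at *
      exact ⟨by linarith, by linarith, by linarith⟩
    · rintro ⟨t, y⟩ ⟨e1, e2, -⟩ _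
      simp only [Set.mem_ofPred_eq] at *
      exact ⟨hup t _ y (hray t (by linarith)) (by linarith), by linarith, by linarith⟩
  · have hK : ∃ K, ∀ y, (R, y) ∈ D → y ≤ K := by
      by_contra hK
      push Not at hK
      refine hup fun u y y' hy hyy => up_closed_of_unbounded hc hcl (A := R) (B := R) ?_ hy hyy
      intro K
      obtain ⟨y, hy, hKy⟩ := hK K
      exact ⟨R, y, le_rfl, le_rfl, hKy.le, hy⟩
    obtain ⟨K, hK⟩ := hK
    obtain ⟨M, hM, hMmax⟩ := exists_slice_max hcl (hray R le_rfl) hK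
    have hrec : ∀ t y s, (t, y) ∈ D → 0 ≤ s → (t + s, y + β * s) ∈ D := by
      intro t y s hty hs
      have := recession hc hcl (p := (R, α + β * R)) (v := (1, β)) (q := (t, y)) (fun s hs => by
        have := hray (R + s) (by linarith)
        convert this using 1
        ext <;> simp; ring) hty hs
      convert this using 1
      ext <;> simp; ring
    have hlam : ∀ t, R ≤ t → (t, M - β * R + β * t) ∈ D := by
      intro t ht
      have := hrec R M (t - R) hM (by linarith)
      convert this using 2 <;> ring
    have hMR := hMmax _ (hray R le_rfl)
    refine ((Dec.tri (N := N) hD (a₁ := -1) (b₁ := 0) (c₁ := -R) (a₂ := β) (b₂ := -1) (c₂ := -α)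
      (a₃ := -β) (b₃ := 1) (c₃ := M - β * R) (by simp) (by simp) (by simp) ?_).union
      (Dec.cap (N := N) hD (a := β) (b := -1) (c := β * R - M) (by simp)) ?_).mono
      (by norm_num) ?_ ?_
    · rintro ⟨t, y⟩ e1 e2 e3
      simp only at e1 e2 e3
      exact mem_vert hc (hray t (by linarith)) (hlam t (by linarith)) (by linarith) (by linarith)
    · rintro x ⟨-, -, h⟩ ⟨-, h'⟩
      linarith
    · rintro ⟨t, y⟩ ⟨e0, e1, e2⟩ _
      simp only at e0 e1 e2
      rcases le_total y (M - β * R + β * t) with h | h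
      · refine Or.inl ⟨?_, ?_, ?_⟩ <;> simp only <;> linarith
      · refine Or.inr ⟨e0, ?_⟩; simp only; linarith
    · rintro ⟨t, y⟩ (⟨e1, e2, e3⟩ | ⟨e0, e1⟩) _
      · simp only at e1 e2 e3
        exact ⟨mem_vert hc (hray t (by linarith)) (hlam t (by linarith)) (by linarith) (by linarith),
          by simp only; linarith, by simp only; linarith⟩
      · simp only at e0 e1
        refine ⟨e0, ?_, by simp only; linarith⟩
        simp only
        by_contra hle
        push Not at hle
        have := hrec t y (R - t) e0 (by linarith)
        rw [add_sub_cancel] at this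
        have := hMmax _ this
        linarith

lemma Dec.end_below (hD : D ∈ 𝒟) (hc : Convex ℝ D) (hcl : IsClosed D)
    (hray : ∀ t, R ≤ t → (t, α + β * t) ∈ D) :
    Dec N 𝒟 2 {x | x ∈ D ∧ R ≤ x.1 ∧ x.2 ≤ α + β * x.1}
      {x | x ∈ D ∧ R < x.1 ∧ x.2 < α + β * x.1} := by
  apply Dec.of_flipY
  have h := Dec.end_above (N := N) (𝒟 := (fun D => flipY ⁻¹' D) '' 𝒟) (D := flipY ⁻¹' D) (R := R)
    (α := -α) (β := -β) ⟨D, hD, rfl⟩ (hc.linear_preimage (flipY : (ℝ × ℝ) →ₗ[ℝ] (ℝ × ℝ)))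
    (hcl.preimage flipY.continuous) (fun t ht => by simpa [add_comm] using hray t ht)
  refine h.mono le_rfl ?_ ?_
  · rintro x ⟨e0, e1, e2⟩ _
    simp only [flipY_apply] at e1 e2
    exact ⟨e0, e1, by linarith⟩
  · rintro x ⟨e0, e1, e2⟩ _
    exact ⟨e0, e1, by simp only [flipY_apply]; linarith⟩

/-- The part of `D` to the right of `R`, possibly cut from below by a ray inside `D`. -/
def IsPend (R : ℝ) (D P : Set (ℝ × ℝ)) : Prop :=
  P = {x | x ∈ D ∧ R ≤ x.1} ∨ ∃ α β : ℝ, (∀ t, R ≤ t → (t, α + β * t) ∈ D) ∧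
    P = {x | x ∈ D ∧ R ≤ x.1 ∧ α + β * x.1 ≤ x.2}

lemma exists_lt_of_mem_interior {P : Set (ℝ × ℝ)} {x : ℝ × ℝ} (hx : x ∈ interior P) :
    ∃ y < x.2, (x.1, y) ∈ P := by
  have hcont : Filter.Tendsto (fun ε : ℝ => (x.1, x.2 - ε)) (nhds 0) (nhds x) := by
    have : Continuous (fun ε : ℝ => (x.1, x.2 - ε)) := by fun_prop
    simpa using this.tendsto 0
  have h1 : ∀ᶠ ε in nhdsWithin (0 : ℝ) (Set.Ioi 0), (x.1, x.2 - ε) ∈ P :=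
    (hcont.eventually (mem_interior_iff_mem_nhds.1 hx)).filter_mono nhdsWithin_le_nhds
  obtain ⟨ε, hε, hpos⟩ := (h1.and self_mem_nhdsWithin).exists
  have hpos : 0 < ε := hpos
  exact ⟨x.2 - ε, by linarith, hε⟩

lemma IsPend.dec {P : Set (ℝ × ℝ)} (hD : D ∈ 𝒟) (hc : Convex ℝ D) (hcl : IsClosed D)
    (hP : IsPend R D P) :
    Dec N 𝒟 2 P {x | x ∈ P ∧ R < x.1 ∧ ∃ y < x.2, (x.1, y) ∈ P} := by
  rcases hP with rfl | ⟨α, β, hray, rfl⟩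
  · refine (Dec.single (N := N) hD (R := {x | x ∈ D ∧ R ≤ x.1}) ⟨fun x hx => hx.1, Or.inr ⟨_,
      ⟨-1, 0, -R, by simp, rfl⟩, ?_⟩⟩ (fun x hx => ?_)).mono (by norm_num) (fun x hx _ => hx)
      (fun x hx _ => hx)
    · ext x; simp
    · refine ⟨interior_subset hx, ?_, exists_lt_of_mem_interior hx⟩
      have := lt_of_mem_interior (a := -1) (b := 0) (c := -R) (by simp)
        (fun q hq => by linarith [hq.2]) hx
      linarith
  · refine (Dec.end_above (N := N) hD hc hcl hray).mono le_rfl (fun x hx _ => hx) ?_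
    rintro x ⟨e0, e1, e2⟩ _
    exact ⟨⟨e0, e1.le, e2.le⟩, e1, _, e2, hray _ e1.le, e1.le, le_rfl⟩

lemma IsPend.dec_below {P : Set (ℝ × ℝ)} (hD : D ∈ 𝒟) (hc : Convex ℝ D) (hcl : IsClosed D)
    (hP : IsPend R D P) {γ δ : ℝ} (hray' : ∀ t, R ≤ t → (t, γ + δ * t) ∈ P) :
    Dec N 𝒟 2 {x | x ∈ P ∧ x.2 ≤ γ + δ * x.1}
      {x | R < x.1 ∧ x.2 < γ + δ * x.1 ∧ ∃ y < x.2, (x.1, y) ∈ P} := by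
  rcases hP with rfl | ⟨α, β, hray, rfl⟩
  · have h1 := Dec.end_below (N := N) hD hc hcl (fun t ht => (hray' t ht).1)
    obtain ⟨F, f1, f2, f3, f4, f5⟩ := h1
    refine ⟨F, f1, f2, f3, fun p hp hN => f4 p ⟨hp.1.1, hp.1.2, hp.2⟩ hN, fun S hS p hp hN => ?_⟩
    have h2 := f5 S hS p hp hN
    refine ⟨h2.2.1, h2.2.2, ?_⟩
    obtain ⟨y, hy, hyS⟩ := exists_lt_of_mem_interior
      (x := p) (P := {x | x ∈ D ∧ R ≤ x.1}) (by
        rw [mem_interior] at hp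
        obtain ⟨O, hO, hOo, hpO⟩ := hp
        rw [mem_interior]
        refine ⟨O ∩ {x | R < x.1} ∩ {x | x.1 ∉ N}, ?_, ?_, ⟨⟨hpO, h2.2.1⟩, hN⟩⟩
        · rintro x ⟨⟨hx1, hx2⟩, hx3⟩
          exact ⟨(f5 S hS x (mem_interior.2 ⟨O, hO, hOo, hx1⟩) hx3).1, hx2.le⟩
        · exact (hOo.inter (isOpen_lt continuous_const continuous_fst)).inter
            (N.finite_toSet.isClosed.isOpen_compl.preimage continuous_fst))
    exact ⟨y, hy, hyS⟩
  · refine (Dec.tri (N := N) hD (a₁ := -1) (b₁ := 0) (c₁ := -R) (a₂ := β) (b₂ := -1) (c₂ := -α)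
      (a₃ := -δ) (b₃ := 1) (c₃ := γ) (by simp) (by simp) (by simp) ?_).mono
      (by norm_num) ?_ ?_
    · rintro ⟨t, y⟩ e1 e2 e3
      simp only at e1 e2 e3
      exact mem_vert hc (hray t (by linarith)) (hray' t (by linarith)).1 (by linarith)
        (by linarith)
    · rintro ⟨t, y⟩ ⟨⟨e0, e1, e2⟩, e3⟩ _
      simp only at e1 e2 e3
      refine ⟨?_, ?_, ?_⟩ <;> simp only <;> linarith
    · rintro ⟨t, y⟩ ⟨e1, e2, e3⟩ _
      simp only at e1 e2 e3
      exact ⟨by simp only; linarith, by simp only; linarith, α + β * t, by simp only; linarith,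
        hray _ (by simp only; linarith), by simp only; linarith, le_rfl⟩

end EndSlab

section RightSlab
variable {ι : Type*} {𝒟 : Set (Set (ℝ × ℝ))} {N : Finset ℝ} {R : ℝ} {D : ι → Set (ℝ × ℝ)}

lemma IsPend.subset {D P : Set (ℝ × ℝ)} (hP : IsPend R D P) : ∀ x ∈ P, x ∈ D ∧ R ≤ x.1 := by
  rcases hP with rfl | ⟨α, β, -, rfl⟩
  · exact fun x hx => hx
  · exact fun x hx => ⟨hx.1, hx.2.1⟩

lemma IsPend.upper {D P : Set (ℝ × ℝ)} (hP : IsPend R D P) {t y y' : ℝ} (h : (t, y) ∈ P)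
    (hy : y ≤ y') (h' : (t, y') ∈ D) : (t, y') ∈ P := by
  rcases hP with rfl | ⟨α, β, -, rfl⟩
  · exact ⟨h', h.2⟩
  · exact ⟨h', h.2.1, h.2.2.trans hy⟩

lemma IsPend.nonempty {D P : Set (ℝ × ℝ)} (hP : IsPend R D P)
    (hne : ∀ t, R ≤ t → ∃ y, (t, y) ∈ D) : ∀ t, R ≤ t → ∃ y, (t, y) ∈ P := by
  rcases hP with rfl | ⟨α, β, hray, rfl⟩
  · exact fun t ht => (hne t ht).imp fun y hy => ⟨hy, ht⟩
  · exact fun t ht => ⟨_, hray t ht, ht, le_rfl⟩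

lemma IsPend.convex {D P : Set (ℝ × ℝ)} (hP : IsPend R D P) (hD : Convex ℝ D) : Convex ℝ P := by
  have h1 : Convex ℝ {x : ℝ × ℝ | R ≤ x.1} :=
    convex_halfSpace_ge (f := fun x : ℝ × ℝ => x.1) (LinearMap.fst ℝ ℝ ℝ).isLinear R
  rcases hP with rfl | ⟨α, β, hray, rfl⟩
  · exact hD.inter h1
  · refine hD.inter (h1.inter ?_)
    have : {x : ℝ × ℝ | α + β * x.1 ≤ x.2} = {x | α ≤ x.2 - β * x.1} := by
      ext x; simp only [Set.mem_ofPred_eq]; constructor <;> intro h <;> linarith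
    change Convex ℝ {x : ℝ × ℝ | α + β * x.1 ≤ x.2}
    rw [this]
    exact convex_halfSpace_ge (f := fun x : ℝ × ℝ => x.2 - β * x.1)
      (LinearMap.snd ℝ ℝ ℝ - β • LinearMap.fst ℝ ℝ ℝ).isLinear α

lemma IsPend.isClosed {D P : Set (ℝ × ℝ)} (hP : IsPend R D P) (hD : IsClosed D) : IsClosed P := by
  have h1 : IsClosed {x : ℝ × ℝ | R ≤ x.1} := isClosed_le (by fun_prop) (by fun_prop)
  rcases hP with rfl | ⟨α, β, hray, rfl⟩
  · exact hD.inter h1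
  · have h2 : IsClosed {x : ℝ × ℝ | α + β * x.1 ≤ x.2} := isClosed_le (by fun_prop) (by fun_prop)
    exact hD.inter (h1.inter h2)

lemma exists_pend (Q : Finset ι) (hQ : Q.Nonempty) (hc : ∀ i, Convex ℝ (D i))
    (hcl : ∀ i, IsClosed (D i)) (hmem : ∀ i, D i ∈ 𝒟)
    (hne : ∀ i ∈ Q, ∀ t, R ≤ t → ∃ y, (t, y) ∈ D i)
    (hor : ∀ i ∈ Q, ∀ j ∈ Q, i ≠ j → ∀ t, R ≤ t → Below (D i) (D j) t ∨ Below (D j) (D i) t)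
    (hov : ∀ i ∈ Q, ∀ j ∈ Q, (∃ t y, R ≤ t ∧ (t, y) ∈ D i ∧ (t, y) ∈ D j) →
      ∀ t, R ≤ t → ∃ y, (t, y) ∈ D i ∧ (t, y) ∈ D j) :
    ∃ a ∈ Q, ∃ P, IsPend R (D a) P ∧
      Dec N 𝒟 (2 * Q.card) {x | R ≤ x.1 ∧ (∃ i ∈ Q, x ∈ D i) ∧ x ∉ P}
        {x | R < x.1 ∧ ∀ y, (x.1, y) ∈ P → x.2 ≤ y} := by
  induction Q using Finset.strongInduction with
  | H Q ih =>
  have hconst : ∀ i ∈ Q, ∀ j ∈ Q, i ≠ j → ∀ t, R ≤ t → ∀ u, R ≤ u → Below (D i) (D j) t →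
      Below (D i) (D j) u := fun i hi j hj hij t ht u hu =>
    Below.constant (hc i) (hc j) (hcl i) (hcl j) (J := Set.Ici R) Set.ordConnected_Ici
      (hne i hi) (hne j hj) (hor i hi j hj hij) ht hu
  obtain ⟨k, hk, htop⟩ := exists_top (fun _ => R) (fun _ => R + 1) D Q hQ (by simp) (by
    intro i hi j hj t ht _ u hu _ hB
    rcases eq_or_ne i j with rfl | hij
    · exact (hB.asymm hB).elim
    · exact hconst i hi j hj hij t ht.1.le u hu.1.le hB)
  have hbelow : ∀ j ∈ Q, j ≠ k → ∀ t, R ≤ t → Below (D j) (D k) t := by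
    intro j hj hjk t ht
    rcases hor j hj k hk hjk t ht with h | h
    · exact h
    · have h2 := hconst k hk j hj hjk.symm t ht (R + 1 / 2) (by linarith) h
      exact (htop j hj (R + 1 / 2) ⟨by linarith, by linarith⟩ ⟨by linarith, by linarith⟩ h2).elim
  by_cases hQ' : (Q.erase k).Nonempty
  swap
  · refine ⟨k, hk, _, Or.inl rfl, Dec.empty ?_⟩
    rintro x ⟨h1, ⟨i, hi, hxi⟩, h3⟩ _
    have : i = k := by
      by_contra hne
      exact hQ' ⟨i, Finset.mem_erase.2 ⟨hne, hi⟩⟩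
    subst this
    exact h3 ⟨hxi, h1⟩
  have hsub : ∀ j ∈ Q.erase k, j ∈ Q := fun j hj => Finset.mem_of_mem_erase hj
  obtain ⟨a, ha, P, hP, hdec⟩ := ih _ (Finset.erase_ssubset hk) hQ' (fun i hi => hne i (hsub i hi))
    (fun i hi j hj => hor i (hsub i hi) j (hsub j hj))
    (fun i hi j hj => hov i (hsub i hi) j (hsub j hj))
  have haQ := hsub a ha
  have hak : a ≠ k := Finset.ne_of_mem_erase ha
  have hB := hbelow a haQ hak
  have hcard : 2 * (Q.erase k).card + 2 = 2 * Q.card := by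
    rw [← Finset.card_erase_add_one hk]; ring
  have hPne := hP.nonempty (hne a haQ)
  by_cases hover : ∃ t y, R ≤ t ∧ (t, y) ∈ D a ∧ (t, y) ∈ D k
  · have hC := hov a haQ k hk hover
    have hCne : ∀ t, R ≤ t → ∃ y, (t, y) ∈ P ∩ D k := by
      intro t ht
      obtain ⟨y, hya, hyk⟩ := hC t ht
      obtain ⟨q, hq⟩ := hPne t ht
      have hqa := (hP.subset _ hq).1
      have h1 := ((hB t ht).wBelow (hc a) (hc k) q y hqa hyk).1
      refine ⟨max q y, hP.upper hq (le_max_left _ _) ?_, h1⟩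
      rcases max_choice q y with h | h <;> rw [h] <;> assumption
    obtain ⟨y₀, hy₀⟩ := hCne R le_rfl
    obtain ⟨γ, δ, hray⟩ := exists_ray ((hP.convex (hc a)).inter (hc k))
      ((hP.isClosed (hcl a)).inter (hcl k)) hy₀ hCne (by
        intro t ht
        obtain ⟨⟨M, hM, hM'⟩, ⟨m, hm, hm'⟩⟩ := hB t ht
        exact ⟨m, M, fun y hy => ⟨(hm' y hy.2).le, (hM' y (hP.subset _ hy.1).1).le⟩⟩)
    refine ⟨k, hk, {x | x ∈ D k ∧ R ≤ x.1 ∧ γ + δ * x.1 ≤ x.2},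
      Or.inr ⟨γ, δ, fun t ht => (hray t ht).2, rfl⟩, ?_⟩
    have h2 := hP.dec_below (N := N) (hmem a) (hc a) (hcl a) (fun t ht => (hray t ht).1)
    refine (hdec.union h2 ?_).mono hcard.le ?_ ?_
    · rintro x ⟨-, h1⟩ ⟨-, -, y, hy, hyP⟩
      exact absurd (h1 y hyP) (not_le.2 hy)
    · rintro ⟨t, y⟩ ⟨h1, ⟨i, hi, hxi⟩, h3⟩ _
      simp only at h1 h3
      by_cases hxP : (t, y) ∈ P
      · refine Or.inr ⟨hxP, ?_⟩
        by_contra hlt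
        push Not at hlt
        have h4 := ((hB t h1).wBelow (hc a) (hc k) _ _ (hP.subset _ hxP).1 (hray t h1).2).1
        rw [max_eq_left hlt.le] at h4
        exact h3 ⟨h4, h1, hlt.le⟩
      · by_cases hik : i = k
        · subst hik
          have hlt : y < γ + δ * t := by
            by_contra hle
            push Not at hle
            exact h3 ⟨hxi, h1, hle⟩
          have h4 := ((hB t h1).wBelow (hc a) (hc i) _ _ (hP.subset _ (hray t h1).1).1 hxi).2
          rw [min_eq_right hlt.le] at h4
          exact Or.inl ⟨h1, ⟨a, ha, h4⟩, hxP⟩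
        · exact Or.inl ⟨h1, ⟨i, Finset.mem_erase.2 ⟨hik, hi⟩, hxi⟩, hxP⟩
    · rintro ⟨t, y⟩ (⟨h1, h2⟩ | ⟨h1, h2, -⟩) _
      · exact ⟨h1, fun z hz => (h2 _ (hray t h1.le).1).trans hz.2.2⟩
      · exact ⟨h1, fun z hz => h2.le.trans hz.2.2⟩
  · refine ⟨k, hk, _, Or.inl rfl, ?_⟩
    have hgap : ∀ t y z, R ≤ t → (t, y) ∈ P → (t, z) ∈ D k → y < z := by
      intro t y z ht hy hz
      have hya := (hP.subset _ hy).1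
      by_contra hle
      push Not at hle
      have h4 := ((hB t ht).wBelow (hc a) (hc k) _ _ hya hz).1
      rw [max_eq_left hle] at h4
      exact hover ⟨t, y, ht, hya, h4⟩
    refine (hdec.union (hP.dec (N := N) (hmem a) (hc a) (hcl a)) ?_).mono hcard.le ?_ ?_
    · rintro x ⟨-, h1⟩ ⟨-, -, y, hy, hyP⟩
      exact absurd (h1 y hyP) (not_le.2 hy)
    · rintro ⟨t, y⟩ ⟨h1, ⟨i, hi, hxi⟩, h3⟩ _
      by_cases hxP : (t, y) ∈ P
      · exact Or.inr hxP
      · have hik : i ≠ k := by rintro rfl; exact h3 ⟨hxi, h1⟩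
        exact Or.inl ⟨h1, ⟨i, Finset.mem_erase.2 ⟨hik, hi⟩, hxi⟩, hxP⟩
    · rintro ⟨t, y⟩ (⟨h1, h2⟩ | ⟨h1, h2, -⟩) _
      · obtain ⟨q, hq⟩ := hPne t h1.le
        exact ⟨h1, fun z hz => (h2 q hq).trans (hgap t q z h1.le hq hz.1).le⟩
      · exact ⟨h2, fun z hz => (hgap t y z h2.le h1 hz.1).le⟩

lemma Dec.right_slab (Q : Finset ι) (hc : ∀ i, Convex ℝ (D i))
    (hcl : ∀ i, IsClosed (D i)) (hmem : ∀ i, D i ∈ 𝒟)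
    (hne : ∀ i ∈ Q, ∀ t, R ≤ t → ∃ y, (t, y) ∈ D i)
    (hor : ∀ i ∈ Q, ∀ j ∈ Q, i ≠ j → ∀ t, R ≤ t → Below (D i) (D j) t ∨ Below (D j) (D i) t)
    (hov : ∀ i ∈ Q, ∀ j ∈ Q, (∃ t y, R ≤ t ∧ (t, y) ∈ D i ∧ (t, y) ∈ D j) →
      ∀ t, R ≤ t → ∃ y, (t, y) ∈ D i ∧ (t, y) ∈ D j) :
    Dec N 𝒟 (4 * Q.card) {x | R ≤ x.1 ∧ ∃ i ∈ Q, x ∈ D i} {x | R < x.1} := by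
  rcases Q.eq_empty_or_nonempty with rfl | hQ
  · exact Dec.empty (by simp)
  obtain ⟨a, ha, P, hP, hdec⟩ := exists_pend (N := N) Q hQ hc hcl hmem hne hor hov
  refine (hdec.union (hP.dec (N := N) (hmem a) (hc a) (hcl a)) ?_).mono ?_ ?_ ?_
  · rintro x ⟨-, h1⟩ ⟨-, -, y, hy, hyP⟩
    exact absurd (h1 y hyP) (not_le.2 hy)
  · have := hQ.card_pos; omega
  · rintro x ⟨h1, h2⟩ _
    by_cases hxP : x ∈ P
    · exact Or.inr hxP
    · exact Or.inl ⟨h1, h2, hxP⟩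
  · rintro x (⟨h1, -⟩ | ⟨-, h1, -⟩) _ <;> exact h1

end RightSlab

section Middle
variable {ι : Type*} {N : Finset ℝ} {𝒟 : Set (Set (ℝ × ℝ))} {D : ι → Set (ℝ × ℝ)} {s e : ι → ℝ}
  {L : ℝ} {I : Finset ι} {f f' : ℝ → ℝ} {v w : ℝ × ℝ} {k : ι}

/-- Convex sets with finite time intervals on which their slices are pairwise ordered, and a level
`L` below everything that is bounded from below. -/
structure SlabFamily (N : Finset ℝ) (D : ι → Set (ℝ × ℝ)) (s e : ι → ℝ) (L : ℝ) : Prop where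
  conv : ∀ i, Convex ℝ (D i)
  closed : ∀ i, IsClosed (D i)
  lt : ∀ i, s i < e i
  memN : ∀ i, s i ∈ N ∧ e i ∈ N
  left : ∀ i, ∃ y, (s i, y) ∈ D i
  right : ∀ i, ∃ y, (e i, y) ∈ D i
  or : ∀ i j, i ≠ j → ∀ t, s i < t → t < e i → s j < t → t < e j →
    Below (D i) (D j) t ∨ Below (D j) (D i) t
  low : ∀ i, ((s i, L) ∈ D i ∧ (e i, L) ∈ D i ∧ ∀ t y y', (t, y) ∈ D i → y' ≤ y → (t, y') ∈ D i) ∨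
    ∀ t y, (t, y) ∈ D i → s i ≤ t → t ≤ e i → L < y

/-- `k` is above all the members of `I`. -/
def IsHighest (D : ι → Set (ℝ × ℝ)) (s e : ι → ℝ) (I : Finset ι) (k : ι) : Prop :=
  ∀ j ∈ I, ∀ t, s j < t → t < e j → s k < t → t < e k → Below (D j) (D k) t

lemma SlabFamily.slice (h : SlabFamily N D s e L) (i : ι) {t : ℝ} (h1 : s i ≤ t) (h2 : t ≤ e i) :
    ∃ y, (t, y) ∈ D i := by
  obtain ⟨y, hy⟩ := h.left i
  obtain ⟨z, hz⟩ := h.right i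
  obtain ⟨α, β, rfl, rfl⟩ := exists_affine (s i) y (e i) z (h.lt i)
  exact ⟨_, mem_seg (h.conv i) hy hz h1 h2⟩

lemma SlabFamily.wBelow (h : SlabFamily N D s e L) (hk : IsHighest D s e I k) {j : ι} (hj : j ∈ I)
    (hlt : max (s j) (s k) < min (e j) (e k)) {t : ℝ} (h1 : s j ≤ t) (h2 : t ≤ e j) (h3 : s k ≤ t)
    (h4 : t ≤ e k) : WBelow (D j) (D k) t := by
  have hlt' := hlt
  rw [max_lt_iff, lt_min_iff, lt_min_iff] at hlt
  obtain ⟨z₀, hz₀⟩ := h.slice j (t := max (s j) (s k)) (le_max_left _ _)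
    (max_le hlt.1.1.le hlt.2.1.le)
  obtain ⟨z₁, hz₁⟩ := h.slice j (t := min (e j) (e k)) (le_min hlt.1.1.le hlt.1.2.le)
    (min_le_left _ _)
  obtain ⟨w₀, hw₀⟩ := h.slice k (t := max (s j) (s k)) (le_max_right _ _)
    (max_le hlt.1.2.le hlt.2.2.le)
  obtain ⟨w₁, hw₁⟩ := h.slice k (t := min (e j) (e k)) (le_min hlt.2.1.le hlt.2.2.le)
    (min_le_right _ _)
  refine WBelow.closure (h.conv j) (h.conv k) (h.closed j) (h.closed k) hlt' ?_ hz₀ hz₁ hw₀ hw₁ t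
    ⟨max_le h1 h3, le_min h2 h4⟩
  rintro u ⟨hu1, hu2⟩
  rw [max_lt_iff] at hu1
  rw [lt_min_iff] at hu2
  exact (hk j hj u hu1.1 hu2.1 hu1.2 hu2.2).wBelow (h.conv j) (h.conv k)

/-- `v` and `w` are consecutive vertices of the floor `f`, lying in the member of `I` which is
topmost between them. -/
structure FloorEdge (D : ι → Set (ℝ × ℝ)) (s e : ι → ℝ) (L : ℝ) (I : Finset ι) (f : ℝ → ℝ)
    (v w : ℝ × ℝ) : Prop where
  mono : v.1 ≤ w.1
  lin : v.1 < w.1 → ∃ α β : ℝ, α + β * v.1 = v.2 ∧ α + β * w.1 = w.2 ∧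
    ∀ t, v.1 < t → t < w.1 → f t = α + β * t
  lab : v.1 < w.1 → (v.2 = L ∧ w.2 = L ∧
      ∀ j ∈ I, ∀ t, v.1 < t → t < w.1 → s j < t → t < e j → False) ∨
    ∃ a ∈ I, s a ≤ v.1 ∧ w.1 ≤ e a ∧ v ∈ D a ∧ w ∈ D a ∧
      ∀ j ∈ I, j ≠ a → ∀ t, v.1 < t → t < w.1 → s j < t → t < e j → WBelow (D j) (D a) t

lemma SlabFamily.dec_edge (h : SlabFamily N D s e L) (hmem : ∀ i, D i ∈ 𝒟)
    (hk : IsHighest D s e I k) (hE : FloorEdge D s e L I f v w) (hvw : v.1 < w.1)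
    (hs : s k ≤ v.1) (he : w.1 ≤ e k) {γ δ : ℝ} (h1 : (v.1, γ + δ * v.1) ∈ D k)
    (h2 : (w.1, γ + δ * w.1) ∈ D k) (l : v.2 ≤ γ + δ * v.1) (l' : w.2 ≤ γ + δ * w.1) :
    Dec N 𝒟 16 {x | v.1 < x.1 ∧ x.1 < w.1 ∧ f x.1 ≤ x.2 ∧ x.2 < γ + δ * x.1 ∧
        (x ∈ D k ∨ ∃ i ∈ I, s i < x.1 ∧ x.1 < e i ∧ x ∈ D i)}
      {x | v.1 < x.1 ∧ x.1 < w.1 ∧ f x.1 < x.2 ∧ x.2 < γ + δ * x.1} := by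
  obtain ⟨α, β, hv, hw, hf⟩ := hE.lin hvw
  obtain ⟨hv2, hw2, hno⟩ | ⟨a, ha, hsa, hea, hva, hwa, htop⟩ := hE.lab hvw
  · have hβ : β = 0 := by
      have : β * (w.1 - v.1) = 0 := by linarith
      rcases mul_eq_zero.1 this with h | h
      · exact h
      · linarith
    subst hβ
    have hα : α = L := by linarith
    subst hα
    obtain ⟨k1, k2, hdown⟩ | hlow := h.low k
    · have hseg : ∀ t, s k ≤ t → t ≤ e k → (t, α + 0 * t) ∈ D k := fun t => mem_seg (h.conv k)
        (by simpa using k1) (by simpa using k2)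
      refine (Dec.trap (N := N) (hmem k) (h.conv k) hvw (hseg _ hs (by linarith))
        (hseg _ (by linarith) he) h1 h2 (by linarith) (by linarith)).mono (by norm_num) ?_ ?_
      · rintro x ⟨e1, e2, e3, e4, -⟩ _
        rw [hf _ e1 e2] at e3
        exact ⟨e1.le, e2.le, e3, e4⟩
      · rintro x ⟨e1, e2, e3, e4⟩ _
        refine ⟨e1, e2, ?_, e4⟩
        rwa [hf _ e1 e2]
    · refine (Dec.below (N := N) (hmem k) (h.conv k) (h.closed k) hvw h1 h2).mono
        (by norm_num) ?_ ?_
      · rintro x ⟨e1, e2, e3, e4, hx | ⟨i, hi, e5, e6, -⟩⟩ _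
        · exact ⟨hx, e1.le, e2.le, e4⟩
        · exact (hno i hi _ e1 e2 e5 e6).elim
      · rintro x ⟨e1, e2, e3, e4⟩ _
        refine ⟨e2, e3, ?_, e4⟩
        rw [hf _ e2 e3]
        have := hlow x.1 x.2 e1 (by linarith) (by linarith)
        linarith
  · refine (Dec.edge (N := N) (hmem a) (hmem k) (h.conv a) (h.conv k) (h.closed a) (h.closed k) hvw
      (a := α) (b := β) (by rw [hv]; exact hva) (by rw [hw]; exact hwa) h1 h2 (by linarith)
      (by linarith) ?_).mono le_rfl ?_ ?_
    · intro t y y' e1 e2 hy hy'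
      exact (hk a ha t (by linarith) (by linarith) (by linarith) (by linarith)).wBelow (h.conv a)
        (h.conv k) y y' hy hy'
    · rintro x ⟨e1, e2, e3, e4, hx⟩ _
      rw [hf _ e1 e2] at e3
      refine ⟨?_, e1.le, e2.le, e3, e4⟩
      rcases hx with hx | ⟨i, hi, e5, e6, hx⟩
      · exact Or.inr hx
      · left
        by_cases hia : i = a
        · rwa [← hia]
        · have hfa := mem_seg (h.conv a) (α := α) (β := β) (by rw [hv]; exact hva)
            (by rw [hw]; exact hwa) e1.le e2.le
          have := (htop i hi hia x.1 e1 e2 e5 e6 x.2 _ hx hfa).1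
          rwa [max_eq_left e3] at this
    · rintro x ⟨e1, e2, e3, e4⟩ _
      refine ⟨e1, e2, ?_, e4⟩
      rwa [hf _ e1 e2]

lemma SlabFamily.dec_chord (h : SlabFamily N D s e L) (hmem : ∀ i, D i ∈ 𝒟)
    (hk : IsHighest D s e I k) {γ δ : ℝ} (l : List (ℝ × ℝ)) (v w : ℝ × ℝ)
    (hE : List.IsChain (FloorEdge D s e L I f) (v :: (l ++ [w])))
    (hl : ∀ u ∈ v :: (l ++ [w]), u.1 ∈ N ∧ s k ≤ u.1 ∧ u.1 ≤ e k ∧ (u.1, γ + δ * u.1) ∈ D k ∧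
      u.2 ≤ γ + δ * u.1) :
    Dec N 𝒟 (16 * (l.length + 1)) {x | v.1 < x.1 ∧ x.1 < w.1 ∧ f x.1 ≤ x.2 ∧ x.2 < γ + δ * x.1 ∧
        (x ∈ D k ∨ ∃ i ∈ I, s i < x.1 ∧ x.1 < e i ∧ x ∈ D i)}
      {x | v.1 < x.1 ∧ x.1 < w.1 ∧ f x.1 < x.2 ∧ x.2 < γ + δ * x.1} ∧
      v.1 ≤ w.1 ∧ ∀ t ∉ N, v.1 < t → t < w.1 → f t ≤ γ + δ * t := by
  have key : ∀ u z, u ∈ v :: (l ++ [w]) → z ∈ v :: (l ++ [w]) → FloorEdge D s e L I f u z →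
      Dec N 𝒟 16 {x | u.1 < x.1 ∧ x.1 < z.1 ∧ f x.1 ≤ x.2 ∧ x.2 < γ + δ * x.1 ∧
        (x ∈ D k ∨ ∃ i ∈ I, s i < x.1 ∧ x.1 < e i ∧ x ∈ D i)}
      {x | u.1 < x.1 ∧ x.1 < z.1 ∧ f x.1 < x.2 ∧ x.2 < γ + δ * x.1} ∧
      u.1 ≤ z.1 ∧ ∀ t ∉ N, u.1 < t → t < z.1 → f t ≤ γ + δ * t := by
    intro u z hu hz hE
    obtain ⟨-, u1, u2, u3, u4⟩ := hl u hu
    obtain ⟨-, z1, z2, z3, z4⟩ := hl z hz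
    rcases eq_or_lt_of_le hE.mono with heq | hlt
    · refine ⟨Dec.empty fun x hx _ => ?_, hE.mono, fun t _ h1 h2 => by linarith⟩
      have := hx.1; have := hx.2.1
      linarith
    · refine ⟨h.dec_edge hmem hk hE hlt u1 z2 u3 z3 u4 z4, hE.mono, fun t _ h1 h2 => ?_⟩
      obtain ⟨α, β, e1, e2, e3⟩ := hE.lin hlt
      rw [e3 t h1 h2]
      exact affine_le (by linarith) (by linarith) h1.le h2.le
  induction l generalizing v with
  | nil =>
    simp only [List.nil_append, List.isChain_cons_cons] at hE
    simpa using key v w (by simp) (by simp) hE.1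
  | cons m l ih =>
    simp only [List.cons_append, List.isChain_cons_cons] at hE
    obtain ⟨i1, i2, i3⟩ := key v m (by simp) (by simp) hE.1
    obtain ⟨j1, j2, j3⟩ := ih m hE.2 (fun u hu => hl u (by simp at hu ⊢; tauto))
      (fun u z hu hz => key u z (by simp at hu ⊢; tauto) (by simp at hz ⊢; tauto))
    have hmN := (hl m (by simp)).1
    refine ⟨(i1.union j1 ?_).mono ?_ ?_ ?_, i2.trans j2, ?_⟩
    · rintro x ⟨-, e1, -⟩ ⟨e2, -⟩
      linarith
    · simp only [List.length_cons]; omega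
    · rintro x ⟨e1, e2, e3⟩ hxN
      rcases lt_trichotomy x.1 m.1 with hlt | heq | hlt
      · exact Or.inl ⟨e1, hlt, e3⟩
      · rw [heq] at hxN; exact (hxN hmN).elim
      · exact Or.inr ⟨hlt, e2, e3⟩
    · rintro x (⟨e1, e2, e3⟩ | ⟨e1, e2, e3⟩) hxN
      · exact ⟨e1, by linarith, e3⟩
      · exact ⟨by linarith, e2, e3⟩
    · intro t ht e1 e2
      rcases lt_trichotomy t m.1 with hlt | heq | hlt
      · exact i3 t ht e1 hlt
      · rw [heq] at ht; exact (ht hmN).elim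
      · exact j3 t ht hlt e2

end Middle

section Trans
variable {ι : Type*} {N : Finset ℝ} {𝒟 : Set (Set (ℝ × ℝ))} {D : ι → Set (ℝ × ℝ)} {s e : ι → ℝ}
  {L : ℝ} {I : Finset ι} {f f' : ℝ → ℝ} {v w : ℝ × ℝ} {k : ι}

lemma fst_le_of_isChain {l : List (ℝ × ℝ)} (hE : List.IsChain (FloorEdge D s e L I f) (v :: l)) :
    ∀ u ∈ l, v.1 ≤ u.1 := by
  induction l generalizing v with
  | nil => simp
  | cons m l ih =>
    rw [List.isChain_cons_cons] at hE
    intro u hu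
    rcases List.mem_cons.1 hu with rfl | hu
    · exact hE.1.mono
    · exact hE.1.mono.trans (ih hE.2 u hu)

lemma le_fst_of_isChain {l : List (ℝ × ℝ)} (hE : List.IsChain (FloorEdge D s e L I f) (l ++ [w])) :
    ∀ u ∈ l, u.1 ≤ w.1 := by
  induction l with
  | nil => simp
  | cons m l ih =>
    rw [List.cons_append] at hE
    intro u hu
    rcases List.mem_cons.1 hu with rfl | hu
    · exact fst_le_of_isChain hE w (by simp)
    · exact ih hE.tail u hu

lemma FloorEdge.congr (h : FloorEdge D s e L I f v w) (hf : ∀ t, v.1 < t → t < w.1 → f' t = f t) :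
    FloorEdge D s e L I f' v w := by
  refine ⟨h.mono, fun hlt => ?_, h.lab⟩
  obtain ⟨α, β, h1, h2, h3⟩ := h.lin hlt
  exact ⟨α, β, h1, h2, fun t e1 e2 => (hf t e1 e2).trans (h3 t e1 e2)⟩

lemma FloorEdge.insert (h : FloorEdge D s e L I f v w) (hk : w.1 ≤ s k ∨ e k ≤ v.1) :
    FloorEdge D s e L (insert k I) f v w := by
  refine ⟨h.mono, h.lin, fun hlt => ?_⟩
  have key : ∀ t, v.1 < t → t < w.1 → s k < t → t < e k → False := by
    intro t _ _ _ _
    rcases hk with hk | hk <;> linarith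
  rcases h.lab hlt with ⟨h1, h2, h3⟩ | ⟨a, ha, h1, h2, h3, h4, h5⟩
  · refine Or.inl ⟨h1, h2, fun j hj => ?_⟩
    rcases Finset.mem_insert.1 hj with rfl | hj
    exacts [key, h3 j hj]
  · refine Or.inr ⟨a, Finset.mem_insert_of_mem ha, h1, h2, h3, h4, fun j hj hja t e1 e2 e3 e4 => ?_⟩
    rcases Finset.mem_insert.1 hj with rfl | hj
    exacts [(key t e1 e2 e3 e4).elim, h5 j hj hja t e1 e2 e3 e4]

lemma SlabFamily.floorEdge_insert (h : SlabFamily N D s e L) (hk : IsHighest D s e I k)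
    (hvw : v.1 ≤ w.1) (hs : s k ≤ v.1) (he : w.1 ≤ e k) (hv : v ∈ D k) (hw : w ∈ D k)
    (hlin : v.1 < w.1 → ∃ α β : ℝ, α + β * v.1 = v.2 ∧ α + β * w.1 = w.2 ∧
      ∀ t, v.1 < t → t < w.1 → f t = α + β * t) : FloorEdge D s e L (insert k I) f v w := by
  refine ⟨hvw, hlin, fun _ => Or.inr ⟨k, Finset.mem_insert_self _ _, hs, he, hv, hw, ?_⟩⟩
  intro j hj hjk t e1 e2 e3 e4
  exact (hk j ((Finset.mem_insert.1 hj).resolve_left hjk) t e3 e4 (by linarith) (by linarith)).wBelow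
    (h.conv j) (h.conv k)

/-- Raising the floor to a chord of `D k` jumping over vertices below `D k`. -/
lemma SlabFamily.exists_chord (h : SlabFamily N D s e L) (hmem : ∀ i, D i ∈ 𝒟)
    (hk : IsHighest D s e I k) (K : List (ℝ × ℝ)) (x z : ℝ × ℝ) (g g' : ℝ) (r : ℕ)
    (hE : List.IsChain (FloorEdge D s e L I f) (x :: (K ++ [z])))
    (ht : ∀ u ∈ x :: (K ++ [z]), u.1 ∈ N ∧ s k ≤ u.1 ∧ u.1 ≤ e k)
    (hK : ∀ u ∈ K, ∀ y, (u.1, y) ∈ D k → u.2 < y)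
    (hg : (x.1, g) ∈ D k) (hxg : x.2 ≤ g) (hg' : (z.1, g') ∈ D k) (hzg : z.2 ≤ g')
    (hr : (g = x.2 ∧ g' = z.2) ∨ 1 ≤ r) :
    ∃ f' : ℝ → ℝ, FloorEdge D s e L (insert k I) f' (x.1, g) (z.1, g') ∧
      (∀ t ∉ N, x.1 < t → t < z.1 → f t ≤ f' t) ∧
      Dec N 𝒟 (16 * r + 32 * K.length) {p | x.1 < p.1 ∧ p.1 < z.1 ∧ f p.1 ≤ p.2 ∧ p.2 < f' p.1 ∧
        (p ∈ D k ∨ ∃ i ∈ I, s i < p.1 ∧ p.1 < e i ∧ p ∈ D i)}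
        {p | x.1 < p.1 ∧ p.1 < z.1 ∧ f p.1 < p.2 ∧ p.2 < f' p.1} := by
  have hsx := (ht x (by simp)).2.1
  have hez := (ht z (by simp)).2.2
  have hxz : x.1 ≤ z.1 := fst_le_of_isChain hE z (by simp)
  rcases eq_or_lt_of_le hxz with heq | hlt
  · refine ⟨f, h.floorEdge_insert hk hxz hsx hez hg hg' fun hlt => ?_, fun t _ _ _ => le_rfl,
      Dec.empty fun p hp _ => ?_⟩
    · exact absurd heq hlt.ne
    · have := hp.1; have := hp.2.1; linarith
  by_cases hfree : K = [] ∧ g = x.2 ∧ g' = z.2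
  · obtain ⟨rfl, rfl, rfl⟩ := hfree
    rw [List.nil_append, List.isChain_pair] at hE
    refine ⟨f, h.floorEdge_insert hk hxz hsx hez hg hg' hE.lin, fun t _ _ _ => le_rfl,
      Dec.empty fun p hp _ => ?_⟩
    have := hp.2.2.1; have := hp.2.2.2.1; linarith
  obtain ⟨γ, δ, rfl, rfl⟩ := exists_affine x.1 g z.1 g' hlt
  have hseg : ∀ t, x.1 ≤ t → t ≤ z.1 → (t, γ + δ * t) ∈ D k := fun t => mem_seg (h.conv k) hg hg'
  have hl : ∀ u ∈ x :: (K ++ [z]), u.1 ∈ N ∧ s k ≤ u.1 ∧ u.1 ≤ e k ∧ (u.1, γ + δ * u.1) ∈ D k ∧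
      u.2 ≤ γ + δ * u.1 := by
    intro u hu
    obtain ⟨h1, h2, h3⟩ := ht u hu
    refine ⟨h1, h2, h3, ?_⟩
    simp only [List.mem_cons, List.mem_append, List.not_mem_nil, or_false] at hu
    rcases hu with rfl | hu | rfl
    · exact ⟨hg, hxg⟩
    · have h4 := hseg u.1 (fst_le_of_isChain hE u (by simp [hu]))
        (le_fst_of_isChain (l := x :: K) hE u (by simp [hu]))
      exact ⟨h4, (hK u hu _ h4).le⟩
    · exact ⟨hg', hzg⟩
  obtain ⟨h1, -, h3⟩ := h.dec_chord hmem hk K x z hE hl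
  refine ⟨fun t => γ + δ * t, h.floorEdge_insert hk hxz hsx hez hg hg' fun _ =>
    ⟨γ, δ, rfl, rfl, fun _ _ _ => rfl⟩, h3, h1.mono ?_ (fun _ hp _ => hp) (fun _ hp _ => hp)⟩
  have : 1 ≤ K.length ∨ 1 ≤ r := by
    rcases hr with hr | hr
    · left
      rw [Nat.one_le_iff_ne_zero]
      intro h0
      exact hfree ⟨List.length_eq_zero_iff.1 h0, hr⟩
    · exact Or.inr hr
  omega

/-- The part of the floor below `D k` is raised to a polygonal curve inscribed in `D k`. -/
lemma SlabFamily.exists_raise (h : SlabFamily N D s e L) (hmem : ∀ i, D i ∈ 𝒟)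
    (hk : IsHighest D s e I k) (M K : List (ℝ × ℝ)) (x z : ℝ × ℝ) (g g' : ℝ) (r : ℕ)
    (hE : List.IsChain (FloorEdge D s e L I f) (x :: (K ++ (M ++ [z]))))
    (ht : ∀ u ∈ x :: (K ++ (M ++ [z])), u.1 ∈ N ∧ s k ≤ u.1 ∧ u.1 ≤ e k)
    (hK : ∀ u ∈ K, ∀ y, (u.1, y) ∈ D k → u.2 < y)
    (hM : ∀ u ∈ M, u ∈ D k ∨ ∀ y, (u.1, y) ∈ D k → u.2 < y)
    (hg : (x.1, g) ∈ D k) (hxg : x.2 ≤ g) (hg' : (z.1, g') ∈ D k) (hzg : z.2 ≤ g')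
    (hr : g = x.2 ∨ 1 ≤ r) :
    ∃ (f' : ℝ → ℝ) (M' : List (ℝ × ℝ)) (n : ℕ),
      List.IsChain (FloorEdge D s e L (insert k I) f') ((x.1, g) :: (M' ++ [(z.1, g')])) ∧
      (∀ u ∈ M', u ∈ M ∧ u ∈ D k) ∧ n + 32 * M'.length ≤ 16 * r + 32 * (K.length + M.length) + 16 ∧
      (∀ t ∉ N, x.1 < t → t < z.1 → f t ≤ f' t) ∧
      Dec N 𝒟 n {p | x.1 < p.1 ∧ p.1 < z.1 ∧ f p.1 ≤ p.2 ∧ p.2 < f' p.1 ∧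
        (p ∈ D k ∨ ∃ i ∈ I, s i < p.1 ∧ p.1 < e i ∧ p ∈ D i)}
        {p | x.1 < p.1 ∧ p.1 < z.1 ∧ f p.1 < p.2 ∧ p.2 < f' p.1} := by
  induction M generalizing K x g r with
  | nil =>
    obtain ⟨f', h1, h2, h3⟩ := h.exists_chord hmem hk K x z g g' (r + 1) hE ht hK hg hxg hg' hzg
      (Or.inr (by omega))
    exact ⟨f', [], _, by simpa using h1, by simp, by simp; omega, h2, h3⟩
  | cons m M ih =>
    rcases hM m (by simp) with hm | hm
    · have hE' : List.IsChain (FloorEdge D s e L I f) ((x :: K) ++ m :: (M ++ [z])) := by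
        simpa using hE
      rw [List.isChain_split] at hE'
      obtain ⟨f₁, a1, a2, a3⟩ := h.exists_chord hmem hk K x m g m.2 r hE'.1
        (fun u hu => ht u (by simp at hu ⊢; tauto)) hK hg hxg hm le_rfl
        (hr.imp_left fun hr => ⟨hr, rfl⟩)
      obtain ⟨f₂, M', n, b1, b2, b3, b4, b5⟩ := ih [] m m.2 0 hE'.2
        (fun u hu => ht u (by simp at hu ⊢; tauto)) (by simp) (fun u hu => hM u (by simp [hu]))
        hm le_rfl (Or.inl rfl)
      have hmN : m.1 ∈ N := (ht m (by simp)).1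
      have hmz : m.1 ≤ z.1 := fst_le_of_isChain hE'.2 z (by simp)
      have hxm : x.1 ≤ m.1 := a1.mono
      refine ⟨fun t => if t < m.1 then f₁ t else f₂ t, m :: M', 16 * r + 32 * K.length + n, ?_, ?_,
        ?_, ?_, (a3.union b5 ?_).mono le_rfl ?_ ?_⟩
      · rw [List.cons_append, List.isChain_cons_cons]
        refine ⟨a1.congr fun t _ h2 => if_pos h2, b1.imp_of_mem_imp fun {u u'} hu _ huu => ?_⟩
        refine huu.congr fun t h1 _ => if_neg ?_
        rcases List.mem_cons.1 hu with rfl | hu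
        · exact h1.not_gt
        · exact ((fst_le_of_isChain b1 u hu).trans_lt h1).not_gt
      · intro u hu
        rcases List.mem_cons.1 hu with rfl | hu
        · exact ⟨by simp, hm⟩
        · exact ⟨by simp [(b2 u hu).1], (b2 u hu).2⟩
      · simp only [List.length_cons, List.length_nil] at b3 ⊢
        omega
      · intro t htN h1 h2
        dsimp only
        split_ifs with hlt
        · exact a2 t htN h1 hlt
        · exact b4 t htN (lt_of_le_of_ne (not_lt.1 hlt) (by rintro rfl; exact htN hmN)) h2
      · rintro p ⟨-, h1, -⟩ ⟨h2, -⟩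
        exact lt_asymm h1 h2
      · rintro p ⟨h1, h2, h3, h4, h5⟩ hpN
        dsimp only at h4
        split_ifs at h4 with hlt
        · exact Or.inl ⟨h1, hlt, h3, h4, h5⟩
        · exact Or.inr ⟨lt_of_le_of_ne (not_lt.1 hlt) (fun h => hpN (h ▸ hmN)), h2, h3, h4, h5⟩
      · rintro p (⟨h1, h2, h3, h4⟩ | ⟨h1, h2, h3, h4⟩) _
        · refine ⟨h1, by linarith, h3, ?_⟩
          dsimp only
          rwa [if_pos h2]
        · refine ⟨by linarith, h2, h3, ?_⟩
          dsimp only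
          rwa [if_neg h1.not_gt]
    · obtain ⟨f', M', n, b1, b2, b3, b4, b5⟩ := ih (K ++ [m]) x g r (by simpa using hE)
        (by simpa using ht) (by
          intro u hu
          rcases List.mem_append.1 hu with hu | hu
          · exact hK u hu
          · rw [List.mem_singleton.1 hu]; exact hm)
        (fun u hu => hM u (by simp [hu])) hg hxg hr
      refine ⟨f', M', n, b1, fun u hu => ⟨by simp [(b2 u hu).1], (b2 u hu).2⟩, ?_, b4, b5⟩
      simp only [List.length_append, List.length_cons, List.length_nil] at b3 ⊢
      omega

end Trans

section State
variable {ι : Type*} {N : Finset ℝ} {𝒟 : Set (Set (ℝ × ℝ))} {D : ι → Set (ℝ × ℝ)} {s e : ι → ℝ}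
  {L A B τ : ℝ} {I : Finset ι} {f f' : ℝ → ℝ} {v w : ℝ × ℝ} {k : ι} {m : ℕ}

lemma FloorEdge.split (hD : ∀ i, Convex ℝ (D i)) (h : FloorEdge D s e L I f v w) (hvw : v.1 < w.1)
    (h1 : v.1 ≤ τ) (h2 : τ ≤ w.1) :
    ∃ g, FloorEdge D s e L I f v (τ, g) ∧ FloorEdge D s e L I f (τ, g) w := by
  obtain ⟨α, β, e1, e2, e3⟩ := h.lin hvw
  have key : ((v.2 = L ∧ α + β * τ = L ∧ w.2 = L ∧
      ∀ j ∈ I, ∀ t, v.1 < t → t < w.1 → s j < t → t < e j → False) ∨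
    ∃ a ∈ I, s a ≤ v.1 ∧ w.1 ≤ e a ∧ v ∈ D a ∧ (τ, α + β * τ) ∈ D a ∧ w ∈ D a ∧
      ∀ j ∈ I, j ≠ a → ∀ t, v.1 < t → t < w.1 → s j < t → t < e j → WBelow (D j) (D a) t) := by
    rcases h.lab hvw with ⟨i1, i2, i3⟩ | ⟨a, ha, i1, i2, i3, i4, i5⟩
    · refine Or.inl ⟨i1, ?_, i2, i3⟩
      have : β * (w.1 - v.1) = 0 := by linarith
      rcases mul_eq_zero.1 this with h | h
      · subst h; linarith
      · linarith
    · exact Or.inr ⟨a, ha, i1, i2, i3, mem_seg (hD a) (by rwa [e1]) (by rwa [e2]) h1 h2, i4, i5⟩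
  refine ⟨α + β * τ, ⟨h1, fun _ => ⟨α, β, e1, rfl, fun t t1 t2 => e3 t t1 (t2.trans_le h2)⟩,
    fun _ => ?_⟩, ⟨h2, fun _ => ⟨α, β, rfl, e2, fun t t1 t2 => e3 t (h1.trans_lt t1) t2⟩,
    fun _ => ?_⟩⟩
  · rcases key with ⟨i1, i2, i3, i4⟩ | ⟨a, ha, i1, i2, i3, i4, i5, i6⟩
    · exact Or.inl ⟨i1, i2, fun j hj t t1 t2 => i4 j hj t t1 (t2.trans_le h2)⟩
    · exact Or.inr ⟨a, ha, i1, h2.trans i2, i3, i4,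
        fun j hj hja t t1 t2 => i6 j hj hja t t1 (t2.trans_le h2)⟩
  · rcases key with ⟨i1, i2, i3, i4⟩ | ⟨a, ha, i1, i2, i3, i4, i5, i6⟩
    · exact Or.inl ⟨i2, i3, fun j hj t t1 t2 => i4 j hj t (h1.trans_lt t1) t2⟩
    · exact Or.inr ⟨a, ha, i1.trans h1, i2, i4, i5,
        fun j hj hja t t1 t2 => i6 j hj hja t (h1.trans_lt t1) t2⟩

/-- Splitting a floor at time `τ`; the predicate `p` tells whether vertices at time `τ` belong to
the left or to the right part. -/
lemma exists_split (hD : ∀ i, Convex ℝ (D i)) (p : ℝ → Prop) (hp1 : ∀ t, t < τ → ¬ p t)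
    (hp2 : ∀ t, τ < t → p t) (c : List (ℝ × ℝ)) (x : ℝ × ℝ)
    (hE : List.IsChain (FloorEdge D s e L I f) (x :: c)) (hx : ¬ p x.1) (hw : ∃ w ∈ c, p w.1) :
    ∃ (g : ℝ) (C R : List (ℝ × ℝ)), c = C ++ R ∧
      List.IsChain (FloorEdge D s e L I f) (x :: (C ++ [(τ, g)])) ∧
      List.IsChain (FloorEdge D s e L I f) ((τ, g) :: R) ∧ (∀ u ∈ C, ¬ p u.1) ∧ (∀ u ∈ R, p u.1) ∧
      ∃ v w, v ∈ x :: C ∧ w ∈ R ∧ FloorEdge D s e L I f v w ∧ FloorEdge D s e L I f v (τ, g) ∧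
        FloorEdge D s e L I f (τ, g) w := by
  induction c generalizing x with
  | nil => simp at hw
  | cons y c ih =>
    rw [List.isChain_cons_cons] at hE
    by_cases hy : p y.1
    · have hxτ : x.1 ≤ τ := le_of_not_gt fun h => hx (hp2 _ h)
      have hyτ : τ ≤ y.1 := le_of_not_gt fun h => hp1 _ h hy
      have hxy : x.1 < y.1 := lt_of_le_of_ne hE.1.mono (fun h => hx (h ▸ hy))
      obtain ⟨g, h1, h2⟩ := hE.1.split hD hxy hxτ hyτ
      refine ⟨g, [], y :: c, rfl, by simpa using h1, by
        rw [List.isChain_cons_cons]; exact ⟨h2, hE.2⟩, by simp, ?_, x, y, by simp, by simp, hE.1,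
        h1, h2⟩
      intro u hu
      rcases List.mem_cons.1 hu with rfl | hu
      · exact hy
      · rcases eq_or_lt_of_le (fst_le_of_isChain hE.2 u hu) with h | h
        · rwa [← h]
        · exact hp2 _ (hyτ.trans_lt h)
    · obtain ⟨g, C, R, h1, h2, h3, h4, h5, v, w, hv, hw, h6⟩ := ih y hE.2 hy (by
        obtain ⟨w, hw, hpw⟩ := hw
        rcases List.mem_cons.1 hw with rfl | hw
        exacts [(hy hpw).elim, ⟨w, hw, hpw⟩])
      refine ⟨g, y :: C, R, by simp [h1], ?_, h3, ?_, h5, v, w, by simp at hv ⊢; tauto, hw, h6⟩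
      · rw [List.cons_append, List.isChain_cons_cons]
        exact ⟨hE.1, h2⟩
      · intro u hu
        rcases List.mem_cons.1 hu with rfl | hu
        exacts [hy, h4 u hu]

/-- `u` is on the ground or in a member of `I` alive at that time. -/
def VertexOK (D : ι → Set (ℝ × ℝ)) (s e : ι → ℝ) (L : ℝ) (I : Finset ι) (u : ℝ × ℝ) : Prop :=
  u.2 = L ∨ ∃ j ∈ I, s j ≤ u.1 ∧ u.1 ≤ e j ∧ u ∈ D j

lemma VertexOK.mono {I' : Finset ι} {u : ℝ × ℝ} (h : VertexOK D s e L I u) (hI : I ⊆ I') :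
    VertexOK D s e L I' u := by
  rcases h with h | ⟨j, hj, h⟩
  exacts [Or.inl h, Or.inr ⟨j, hI hj, h⟩]

lemma FloorEdge.cases (h : FloorEdge D s e L I f v w) (hvw : v.1 < w.1) : (v.2 = L ∧ w.2 = L) ∨
    ∃ a ∈ I, s a ≤ v.1 ∧ w.1 ≤ e a ∧ v ∈ D a ∧ w ∈ D a := by
  rcases h.lab hvw with ⟨i1, i2, -⟩ | ⟨a, ha, i1, i2, i3, i4, -⟩
  exacts [Or.inl ⟨i1, i2⟩, Or.inr ⟨a, ha, i1, i2, i3, i4⟩]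

lemma SlabFamily.kept_or_killed (h : SlabFamily N D s e L) (hk : IsHighest D s e I k) {u : ℝ × ℝ}
    (h1 : s k ≤ u.1) (h2 : u.1 ≤ e k)
    (hu : u.2 = L ∨ ∃ j ∈ I, s j ≤ u.1 ∧ u.1 ≤ e j ∧ u ∈ D j ∧ s j < e k ∧ s k < e j) :
    u ∈ D k ∨ ∀ y, (u.1, y) ∈ D k → u.2 < y := by
  rcases hu with hu | ⟨j, hj, e1, e2, e3, e4, e5⟩
  · rcases h.low k with ⟨k1, k2, -⟩ | hlow
    · left
      have := mem_seg (h.conv k) (α := L) (β := 0) (by simpa using k1) (by simpa using k2) h1 h2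
      simp only [zero_mul, add_zero] at this
      rwa [← hu] at this
    · right
      intro y hy
      rw [hu]
      exact hlow _ _ hy h1 h2
  · by_cases hkill : ∀ y, (u.1, y) ∈ D k → u.2 < y
    · exact Or.inr hkill
    left
    push Not at hkill
    obtain ⟨y, hy, hyu⟩ := hkill
    have := (h.wBelow hk hj (max_lt (lt_min (h.lt j) e4) (lt_min e5 (h.lt k))) e1 e2 h1 h2 _ _ e3
      hy).1
    rwa [max_eq_left hyu] at this

/-- The region below the floor `f` over `(A, B)` has been decomposed. -/
structure FloorState (N : Finset ℝ) (𝒟 : Set (Set (ℝ × ℝ))) (D : ι → Set (ℝ × ℝ)) (s e : ι → ℝ)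
    (L A B : ℝ) (I : Finset ι) (m : ℕ) (c : List (ℝ × ℝ)) (f : ℝ → ℝ) : Prop where
  chain : List.IsChain (FloorEdge D s e L I f) c
  memN : ∀ u ∈ c, u.1 ∈ N ∧ A ≤ u.1 ∧ u.1 ≤ B
  ok : ∀ u ∈ c, VertexOK D s e L I u
  first : ∃ u ∈ c, u.1 = A
  last : ∃ u ∈ c, u.1 = B
  dec : Dec N 𝒟 m {x | A < x.1 ∧ x.1 < B ∧ ((x.2 < f x.1 ∧ ∃ i ∈ I, s i < x.1 ∧ x.1 < e i ∧ x ∈ D i) ∨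
      (x.2 < L ∧ ∃ i, s i < x.1 ∧ x.1 < e i ∧ x ∈ D i))} {x | A < x.1 ∧ x.1 < B ∧ x.2 ≤ f x.1}

lemma isChain_cons_of_mem {c : List (ℝ × ℝ)} (hE : List.IsChain (FloorEdge D s e L I f) c)
    {u : ℝ × ℝ} (hu : u ∈ c) : ∃ x c', c = x :: c' ∧ x.1 ≤ u.1 := by
  match c, hu with
  | x :: c', hu =>
    refine ⟨x, c', rfl, ?_⟩
    rcases List.mem_cons.1 hu with rfl | hu
    · exact le_rfl
    · exact fst_le_of_isChain hE u hu

lemma FloorState.exists_edge (hD : ∀ i, Convex ℝ (D i)) {c : List (ℝ × ℝ)}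
    (h : FloorState N 𝒟 D s e L A B I m c f) {t : ℝ} (hA : A ≤ t) (hB : t < B) (htN : t ∉ N) :
    ∃ v w, v ∈ c ∧ w ∈ c ∧ FloorEdge D s e L I f v w ∧ v.1 < t ∧ t < w.1 := by
  obtain ⟨u, hu, rfl⟩ := h.first
  obtain ⟨u', hu', rfl⟩ := h.last
  obtain ⟨x, c', rfl, hx⟩ := isChain_cons_of_mem h.chain hu
  obtain ⟨g, C, R, h1, h2, h3, h4, h5, v, w, hv, hw, h6, h7, h8⟩ := exists_split hD (t < ·)
    (fun _ h => h.not_gt) (fun _ h => h) c' x h.chain (hx.trans hA).not_gt ⟨u', by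
      rcases List.mem_cons.1 hu' with rfl | hu'
      · linarith
      · exact hu', hB⟩
  have hv' : v ∈ x :: c' := by
    rw [h1]; simp at hv ⊢; tauto
  refine ⟨v, w, hv', by simp [h1, hw], h6, lt_of_le_of_ne h7.mono ?_, h5 w hw⟩
  rintro rfl
  exact htN (h.memN v hv').1

lemma SlabFamily.step (h : SlabFamily N D s e L) (hmem : ∀ i, D i ∈ 𝒟)
    (hk : IsHighest D s e I k) (hA : A ≤ s k) (hB : e k ≤ B) {c : List (ℝ × ℝ)}
    (hS : FloorState N 𝒟 D s e L A B I m c f) :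
    ∃ m' c' f', FloorState N 𝒟 D s e L A B (insert k I) m' c' f' ∧
      m' + 32 * c'.length ≤ m + 32 * c.length + 160 := by
  have hse := h.lt k
  have hI : I ⊆ insert k I := Finset.subset_insert _ _
  obtain ⟨u, hu, hu1⟩ := hS.first
  obtain ⟨u', hu', hu'1⟩ := hS.last
  obtain ⟨x, c₁, rfl, hx⟩ := isChain_cons_of_mem hS.chain hu
  have hxs : x.1 ≤ s k := by linarith
  have hu'c : u' ∈ c₁ := by
    rcases List.mem_cons.1 hu' with rfl | hu'
    · linarith
    · exact hu'
  obtain ⟨g, C₁, R, rfl, a2, a3, a4, a5, v₁, w₁, -, hw₁, -, -, a6⟩ := exists_split h.conv (s k < ·)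
    (fun _ h => h.not_gt) (fun _ h => h) c₁ x hS.chain hxs.not_gt ⟨u', hu'c, by linarith⟩
  have hu'R : u' ∈ R := by
    rcases List.mem_append.1 hu'c with hu'' | hu''
    · exact absurd (show s k < u'.1 by linarith) (a4 u' hu'')
    · exact hu''
  obtain ⟨g', M, C₃, rfl, b2, b3, b4, b5, v₂, w₂, hv₂, -, -, b6, -⟩ := exists_split h.conv (e k ≤ ·)
    (fun _ h => h.not_ge) (fun _ h => h.le) R (s k, g) a3 hse.not_ge ⟨u', hu'R, by linarith⟩
  have hw₁s : s k < w₁.1 := a5 w₁ hw₁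
  have hv₂e : v₂.1 < e k := by
    rcases List.mem_cons.1 hv₂ with rfl | hv
    · exact hse
    · exact not_le.1 (b4 v₂ hv)
  have hok₁ : g = L ∨ ∃ j ∈ I, s j ≤ s k ∧ s k ≤ e j ∧ (s k, g) ∈ D j ∧ s j < e k ∧ s k < e j := by
    rcases a6.cases hw₁s with h1 | ⟨a, ha, h1, h2, h3, -⟩
    · exact Or.inl h1.1
    · exact Or.inr ⟨a, ha, h1, by linarith, h3, lt_of_le_of_lt h1 hse, by linarith⟩
  have hok₂ : g' = L ∨ ∃ j ∈ I, s j ≤ e k ∧ e k ≤ e j ∧ (e k, g') ∈ D j ∧ s j < e k ∧ s k < e j := by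
    rcases b6.cases hv₂e with h1 | ⟨a, ha, h1, h2, -, h3⟩
    · exact Or.inl h1.2
    · exact Or.inr ⟨a, ha, by linarith, h2, h3, by linarith, lt_of_lt_of_le hse h2⟩
  have hlift : ∀ t y, (∃ z, (t, z) ∈ D k) → ((t, y) ∈ D k ∨ ∀ z, (t, z) ∈ D k → y < z) →
      ∃ z, (t, z) ∈ D k ∧ y ≤ z := by
    rintro t y ⟨z, hz⟩ (hy | hy)
    exacts [⟨y, hy, le_rfl⟩, ⟨z, hz, (hy z hz).le⟩]
  obtain ⟨q, hq, hgq⟩ := hlift (s k) g (h.left k)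
    (h.kept_or_killed hk (u := (s k, g)) le_rfl hse.le hok₁)
  obtain ⟨q', hq', hgq'⟩ := hlift (e k) g' (h.right k)
    (h.kept_or_killed hk (u := (e k, g')) hse.le le_rfl hok₂)
  have hMk : ∀ u ∈ M, s k < u.1 ∧ u.1 < e k := fun u hu =>
    ⟨a5 u (by simp [hu]), not_le.1 (b4 u hu)⟩
  obtain ⟨f₁, M', n, d1, d2, d3, d4, d5⟩ := h.exists_raise hmem hk M [] (s k, g) (e k, g') q q' 1 b2
    (by
      intro u hu
      simp only [List.nil_append, List.mem_cons, List.mem_append, List.not_mem_nil, or_false] at hu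
      rcases hu with rfl | hu | rfl
      · exact ⟨(h.memN k).1, le_rfl, hse.le⟩
      · exact ⟨(hS.memN u (by simp [hu])).1, (hMk u hu).1.le, (hMk u hu).2.le⟩
      · exact ⟨(h.memN k).2, hse.le, le_rfl⟩)
    (by simp)
    (by
      intro u hu
      obtain ⟨h1, h2⟩ := hMk u hu
      refine h.kept_or_killed hk h1.le h2.le ?_
      rcases hS.ok u (by simp [hu]) with h3 | ⟨j, hj, h3, h4, h5⟩
      · exact Or.inl h3
      · exact Or.inr ⟨j, hj, h3, h4, h5, by linarith, by linarith⟩)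
    hq hgq hq' hgq' (Or.inr le_rfl)
  set f₂ : ℝ → ℝ := fun t => if s k < t ∧ t < e k then f₁ t else f t with hf₂
  have hout : ∀ v w, FloorEdge D s e L I f v w → (w.1 ≤ s k ∨ e k ≤ v.1) →
      FloorEdge D s e L (insert k I) f₂ v w := by
    intro v w hvw ho
    refine (hvw.insert ho).congr fun t h1 h2 => if_neg fun h3 => ?_
    rcases ho with ho | ho <;> linarith
  refine ⟨m + n, x :: (C₁ ++ (s k, g) :: (s k, q) :: (M' ++ (e k, q') :: (e k, g') :: C₃)), f₂,
    ⟨?_, ?_, ?_, ?_, ?_, ?_⟩, ?_⟩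
  · rw [← List.cons_append, List.isChain_split]
    refine ⟨?_, ?_⟩
    · refine List.IsChain.imp_of_mem_imp (fun {v w} _ hw hvw => hout v w hvw (Or.inl ?_)) a2
      simp only [List.mem_cons, List.mem_append, List.not_mem_nil, or_false] at hw
      rcases hw with (rfl | hw) | rfl
      exacts [hxs, not_lt.1 (a4 w hw), le_rfl]
    rw [List.isChain_cons_cons]
    refine ⟨⟨le_rfl, fun h => absurd h (lt_irrefl _), fun h => absurd h (lt_irrefl _)⟩, ?_⟩
    rw [← List.cons_append, List.isChain_split]
    refine ⟨?_, ?_⟩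
    · refine List.IsChain.imp_of_mem_imp (fun {v w} hv hw hvw => ?_) d1
      refine hvw.congr fun t h1 h2 => if_pos ⟨?_, ?_⟩
      · refine lt_of_le_of_lt ?_ h1
        rcases List.mem_cons.1 hv with rfl | hv
        exacts [le_rfl, fst_le_of_isChain d1 v hv]
      · refine lt_of_lt_of_le h2 ?_
        rw [← List.cons_append] at d1
        rcases List.mem_append.1 hw with hw | hw
        · exact le_fst_of_isChain d1 w hw
        · rw [List.mem_singleton.1 hw]
    rw [List.isChain_cons_cons]
    refine ⟨⟨le_rfl, fun h => absurd h (lt_irrefl _), fun h => absurd h (lt_irrefl _)⟩, ?_⟩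
    refine List.IsChain.imp_of_mem_imp (fun {v w} hv _ hvw => hout v w hvw (Or.inr ?_)) b3
    rcases List.mem_cons.1 hv with rfl | hv
    exacts [le_rfl, b5 v hv]
  · intro u hu
    simp only [List.mem_cons, List.mem_append] at hu
    rcases hu with rfl | hu | rfl | rfl | hu | rfl | rfl | hu
    · exact hS.memN _ (by simp)
    · exact hS.memN _ (by simp [hu])
    · exact ⟨(h.memN k).1, hA, hse.le.trans hB⟩
    · exact ⟨(h.memN k).1, hA, hse.le.trans hB⟩
    · exact hS.memN _ (by simp [(d2 u hu).1])
    · exact ⟨(h.memN k).2, hA.trans hse.le, hB⟩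
    · exact ⟨(h.memN k).2, hA.trans hse.le, hB⟩
    · exact hS.memN _ (by simp [hu])
  · intro u hu
    simp only [List.mem_cons, List.mem_append] at hu
    have hknew : ∀ u : ℝ × ℝ, s k ≤ u.1 → u.1 ≤ e k → u ∈ D k → VertexOK D s e L (insert k I) u :=
      fun u h1 h2 h3 => Or.inr ⟨k, Finset.mem_insert_self _ _, h1, h2, h3⟩
    rcases hu with rfl | hu | rfl | rfl | hu | rfl | rfl | hu
    · exact (hS.ok _ (by simp)).mono hI
    · exact (hS.ok _ (by simp [hu])).mono hI
    · rcases hok₁ with h1 | ⟨j, hj, h1, h2, h3, -⟩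
      exacts [Or.inl h1, Or.inr ⟨j, hI hj, h1, h2, h3⟩]
    · exact hknew _ le_rfl hse.le hq
    · exact (hS.ok _ (by simp [(d2 u hu).1])).mono hI
    · exact hknew _ hse.le le_rfl hq'
    · rcases hok₂ with h1 | ⟨j, hj, h1, h2, h3, -⟩
      exacts [Or.inl h1, Or.inr ⟨j, hI hj, h1, h2, h3⟩]
    · exact (hS.ok _ (by simp [hu])).mono hI
  · refine ⟨u, ?_, hu1⟩
    have hu2 : u ∉ M ++ C₃ := fun hu2 => absurd (a5 u hu2) (by linarith)
    simp only [List.mem_cons, List.mem_append] at hu hu2 ⊢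
    tauto
  · refine ⟨u', ?_, hu'1⟩
    rcases List.mem_append.1 hu'R with hu'' | hu''
    · exact absurd (show e k ≤ u'.1 by linarith) (b4 u' hu'')
    · simp [hu'']
  · refine (hS.dec.union d5 ?_).mono le_rfl ?_ ?_
    · rintro p ⟨-, -, h1⟩ ⟨-, -, h2, -⟩
      exact h1.not_gt h2
    · rintro p ⟨h1, h2, h3 | h3⟩ hpN
      · obtain ⟨h3, i, hi, h4, h5, h6⟩ := h3
        by_cases hp : s k < p.1 ∧ p.1 < e k
        · simp only [hf₂, if_pos hp] at h3
          by_cases hpf : p.2 < f p.1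
          · left
            refine ⟨h1, h2, ?_⟩
            rcases Finset.mem_insert.1 hi with rfl | hi
            · obtain ⟨v, w, -, -, hvw, hv, hw⟩ := hS.exists_edge h.conv h1.le h2 hpN
              rcases hvw.lab (hv.trans hw) with ⟨i1, i2, -⟩ | ⟨a, ha, i1, i2, i3, i4, -⟩
              · right
                obtain ⟨α, β, j1, j2, j3⟩ := hvw.lin (hv.trans hw)
                refine ⟨lt_of_lt_of_le hpf ?_, i, h4, h5, h6⟩
                rw [j3 _ hv hw]
                have := affine_le (a := α) (b := β) (c := L) (d := 0) (by linarith) (by linarith)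
                  hv.le hw.le
                linarith
              · left
                obtain ⟨α, β, j1, j2, j3⟩ := hvw.lin (hv.trans hw)
                have hfa := mem_seg (h.conv a) (α := α) (β := β) (by rw [j1]; exact i3)
                  (by rw [j2]; exact i4) hv.le hw.le
                rw [← j3 _ hv hw] at hfa
                have hb := (hk a ha p.1 (by linarith) (by linarith) h4 h5).wBelow (h.conv a)
                  (h.conv i)
                have := (hb _ _ hfa h6).2
                rw [min_eq_right hpf.le] at this
                exact ⟨hpf, a, ha, by linarith, by linarith, this⟩
            · exact Or.inl ⟨hpf, i, hi, h4, h5, h6⟩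
          · right
            refine ⟨hp.1, hp.2, not_lt.1 hpf, h3, ?_⟩
            rcases Finset.mem_insert.1 hi with rfl | hi
            exacts [Or.inl h6, Or.inr ⟨i, hi, h4, h5, h6⟩]
        · simp only [hf₂, if_neg hp] at h3
          rcases Finset.mem_insert.1 hi with rfl | hi
          · exact (hp ⟨h4, h5⟩).elim
          · exact Or.inl ⟨h1, h2, Or.inl ⟨h3, i, hi, h4, h5, h6⟩⟩
      · exact Or.inl ⟨h1, h2, Or.inr h3⟩
    · rintro p (⟨h1, h2, h3⟩ | ⟨h1, h2, h3, h4⟩) hpN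
      · refine ⟨h1, h2, h3.trans ?_⟩
        simp only [hf₂]
        split_ifs with hp
        · exact d4 _ hpN hp.1 hp.2
        · exact le_rfl
      · refine ⟨hA.trans_lt h1, h2.trans_le hB, ?_⟩
        simp only [hf₂]
        rw [if_pos ⟨h1, h2⟩]
        exact h4.le
  · simp only [List.length_cons, List.length_append, List.length_nil] at d3 ⊢
    omega

end State

section MiddleSlab
variable {ι : Type*} {N : Finset ℝ} {𝒟 : Set (Set (ℝ × ℝ))} {D : ι → Set (ℝ × ℝ)} {s e : ι → ℝ}
  {L A B : ℝ} {I : Finset ι} {f : ℝ → ℝ} {m : ℕ}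

lemma SlabFamily.initial [Fintype ι] (h : SlabFamily N D s e L) (hmem : ∀ i, D i ∈ 𝒟)
    (hAN : A ∈ N) (hBN : B ∈ N) (hAB : A < B) (hA : ∀ k, A ≤ s k) (hB : ∀ k, e k ≤ B) :
    FloorState N 𝒟 D s e L A B ∅ (1 * Fintype.card ι) [(A, L), (B, L)] fun _ => L := by
  refine ⟨?_, by simp [hAN, hBN, hAB.le], by simp [VertexOK], by simp, by simp, ?_⟩
  · rw [List.isChain_pair]
    exact ⟨hAB.le, fun _ => ⟨L, 0, by simp, by simp, fun _ _ _ => by simp⟩,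
      fun _ => Or.inl ⟨rfl, rfl, by simp⟩⟩
  let P : ι → Prop := fun i => ∀ t y y', (t, y) ∈ D i → y' ≤ y → (t, y') ∈ D i
  have hd := Dec.biUnion (N := N) (𝒟 := 𝒟) (n := 1) (Finset.univ : Finset ι)
    (fun i => {x | s i < x.1 ∧ x.1 < e i ∧ x.2 < L ∧ x ∈ D i})
    (fun i => {x | s i < x.1 ∧ x.1 < e i ∧ x.2 < L ∧ P i}) ?_ ?_
  · refine hd.mono (by rw [Finset.card_univ]) ?_ ?_
    · rintro x ⟨-, -, ⟨-, i, hi, -⟩ | ⟨h1, i, h2, h3, h4⟩⟩ _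
      · simp at hi
      · simp only [Finset.mem_univ, Set.iUnion_true, Set.mem_iUnion]
        exact ⟨i, h2, h3, h1, h4⟩
    · intro x hx _
      simp only [Finset.mem_univ, Set.iUnion_true, Set.mem_iUnion] at hx
      obtain ⟨i, h1, h2, h3, -⟩ := hx
      exact ⟨(hA i).trans_lt h1, h2.trans_le (hB i), h3.le⟩
  · intro i _
    rcases h.low i with ⟨k1, k2, hdown⟩ | hlow
    · refine (Dec.tri (N := N) (hmem i) (a₁ := -1) (b₁ := 0) (c₁ := -s i) (a₂ := 0) (b₂ := 1)
        (c₂ := L) (a₃ := 1) (b₃ := 0) (c₃ := e i) (by simp) (by simp) (by simp) ?_).mono le_rfl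
        ?_ ?_
      · rintro ⟨t, y⟩ e1 e2 e3
        simp only at e1 e2 e3
        have := mem_seg (h.conv i) (α := L) (β := 0) (by simpa using k1) (by simpa using k2)
          (t := t) (by linarith) (by linarith)
        exact hdown t _ y this (by linarith)
      · rintro ⟨t, y⟩ ⟨e1, e2, e3, -⟩ _
        simp only [Set.mem_ofPred_eq] at *
        exact ⟨by linarith, by linarith, by linarith⟩
      · rintro ⟨t, y⟩ ⟨e1, e2, e3⟩ _
        simp only [Set.mem_ofPred_eq] at *
        exact ⟨by linarith, by linarith, by linarith, hdown⟩
    · refine Dec.empty ?_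
      rintro x ⟨h1, h2, h3, h4⟩ _
      exact h3.not_gt (hlow x.1 x.2 h4 h1.le h2.le)
  · rintro i - j - hij x ⟨i1, i2, -, i3⟩ ⟨j1, j2, -, j3⟩
    obtain ⟨z, hz⟩ := h.slice i i1.le i2.le
    obtain ⟨z', hz'⟩ := h.slice j j1.le j2.le
    rcases h.or i j hij x.1 i1 i2 j1 j2 with ⟨-, y, -, hy⟩ | ⟨-, y, -, hy⟩
    · have := hy _ (j3 _ _ (min z' y) hz' (min_le_left _ _))
      exact (min_le_right z' y).not_gt this
    · have := hy _ (i3 _ _ (min z y) hz (min_le_left _ _))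
      exact (min_le_right z y).not_gt this

lemma SlabFamily.exists_state [Fintype ι] (h : SlabFamily N D s e L) (hmem : ∀ i, D i ∈ 𝒟)
    (hAN : A ∈ N) (hBN : B ∈ N) (hAB : A < B) (hA : ∀ k, A ≤ s k) (hB : ∀ k, e k ≤ B)
    (Q : Finset ι) : ∃ m c f, FloorState N 𝒟 D s e L A B Q m c f ∧
      m + 32 * c.length ≤ Fintype.card ι + 64 + 160 * Q.card := by
  induction Q using Finset.strongInduction with
  | H Q ih =>
  rcases Q.eq_empty_or_nonempty with rfl | hne
  · exact ⟨_, _, _, h.initial hmem hAN hBN hAB hA hB, by simp⟩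
  obtain ⟨k, hk, htop⟩ := exists_top s e D Q hne (fun i _ => h.lt i) (by
    intro i _ j _ t ht ht' u hu hu' hb
    by_cases hij : i = j
    · subst hij
      exact (hb.asymm hb).elim
    exact Below.constant (J := Set.Ioo (s i) (e i) ∩ Set.Ioo (s j) (e j)) (h.conv i) (h.conv j)
      (h.closed i) (h.closed j) (Set.ordConnected_Ioo.inter Set.ordConnected_Ioo)
      (fun t ht => h.slice i ht.1.1.le ht.1.2.le) (fun t ht => h.slice j ht.2.1.le ht.2.2.le)
      (fun t ht => h.or i j hij t ht.1.1 ht.1.2 ht.2.1 ht.2.2) ⟨ht, ht'⟩ ⟨hu, hu'⟩ hb)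
  obtain ⟨m, c, f, hS, hm⟩ := ih (Q.erase k) (Finset.erase_ssubset hk)
  have hk' : IsHighest D s e (Q.erase k) k := by
    intro j hj t h1 h2 h3 h4
    obtain ⟨hjk, hj⟩ := Finset.mem_erase.1 hj
    exact (h.or j k hjk t h1 h2 h3 h4).resolve_right (htop j hj t ⟨h3, h4⟩ ⟨h1, h2⟩)
  obtain ⟨m', c', f', hS', hm'⟩ := h.step hmem hk' (hA k) (hB k) hS
  rw [Finset.insert_erase hk] at hS'
  refine ⟨m', c', f', hS', ?_⟩
  have := Finset.card_erase_add_one hk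
  omega

lemma FloorEdge.dec_above (hD : ∀ i, Convex ℝ (D i)) (hcl : ∀ i, IsClosed (D i))
    (hmem : ∀ i, D i ∈ 𝒟) {v w : ℝ × ℝ} (hE : FloorEdge D s e L I f v w) :
    Dec N 𝒟 3 {x | v.1 < x.1 ∧ x.1 < w.1 ∧ f x.1 ≤ x.2 ∧ ∃ i ∈ I, s i < x.1 ∧ x.1 < e i ∧ x ∈ D i}
      {x | v.1 < x.1 ∧ x.1 < w.1 ∧ f x.1 < x.2} := by
  rcases eq_or_lt_of_le hE.mono with heq | hlt
  · refine Dec.empty fun x hx _ => ?_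
    have := hx.1; have := hx.2.1
    linarith
  obtain ⟨α, β, hv, hw, hf⟩ := hE.lin hlt
  rcases hE.lab hlt with ⟨-, -, hno⟩ | ⟨a, ha, -, -, hva, hwa, htop⟩
  · refine Dec.empty ?_
    rintro x ⟨h1, h2, -, i, hi, h3, h4, -⟩ _
    exact hno i hi _ h1 h2 h3 h4
  have hva' : (v.1, α + β * v.1) ∈ D a := by rwa [hv]
  have hwa' : (w.1, α + β * w.1) ∈ D a := by rwa [hw]
  refine (Dec.above (N := N) (hmem a) (hD a) (hcl a) hlt hva' hwa').mono le_rfl ?_ ?_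
  · rintro x ⟨h1, h2, h3, i, hi, h4, h5, h6⟩ _
    rw [hf _ h1 h2] at h3
    refine ⟨?_, h1.le, h2.le, h3⟩
    by_cases hia : i = a
    · rwa [← hia]
    · have := (htop i hi hia x.1 h1 h2 h4 h5 x.2 _ h6 (mem_seg (hD a) hva' hwa' h1.le h2.le)).1
      rwa [max_eq_left h3] at this
  · rintro x ⟨-, h1, h2, h3⟩ _
    refine ⟨h1, h2, ?_⟩
    rwa [hf _ h1 h2]

lemma dec_above_of_isChain (N : Finset ℝ) (hD : ∀ i, Convex ℝ (D i)) (hcl : ∀ i, IsClosed (D i))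
    (hmem : ∀ i, D i ∈ 𝒟) (c : List (ℝ × ℝ)) (hE : List.IsChain (FloorEdge D s e L I f) c)
    (hN : ∀ u ∈ c, u.1 ∈ N) :
    Dec N 𝒟 (3 * c.length) {x | (∃ v ∈ c, v.1 < x.1) ∧ (∃ w ∈ c, x.1 < w.1) ∧ f x.1 ≤ x.2 ∧
        ∃ i ∈ I, s i < x.1 ∧ x.1 < e i ∧ x ∈ D i}
      {x | (∃ v ∈ c, v.1 < x.1) ∧ (∃ w ∈ c, x.1 < w.1) ∧ f x.1 < x.2} := by
  match c with
  | [] => exact Dec.empty (by simp)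
  | [v] =>
    refine Dec.empty ?_
    rintro x ⟨⟨v, hv, h1⟩, ⟨w, hw, h2⟩, -⟩ _
    rw [List.mem_singleton.1 hv] at h1
    rw [List.mem_singleton.1 hw] at h2
    exact lt_asymm h1 h2
  | v :: w :: c =>
    have hle := fst_le_of_isChain hE
    rw [List.isChain_cons_cons] at hE
    have ih := dec_above_of_isChain N hD hcl hmem (w :: c) hE.2
      (fun u hu => hN u (List.mem_cons_of_mem _ hu))
    refine ((hE.1.dec_above hD hcl hmem).union ih ?_).mono ?_ ?_ ?_
    · rintro x ⟨-, h1, -⟩ ⟨⟨v', hv', h2⟩, -⟩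
      have : w.1 ≤ v'.1 := by
        rcases List.mem_cons.1 hv' with rfl | hv'
        exacts [le_rfl, fst_le_of_isChain hE.2 v' hv']
      linarith
    · simp only [List.length_cons]; omega
    · rintro x ⟨⟨v', hv', h1⟩, ⟨w', hw', h2⟩, h4⟩ hxN
      rcases lt_trichotomy x.1 w.1 with hlt | heq | hlt
      · left
        refine ⟨lt_of_le_of_lt ?_ h1, hlt, h4⟩
        rcases List.mem_cons.1 hv' with rfl | hv'
        exacts [le_rfl, hle v' hv']
      · exact (hxN (heq ▸ hN w (by simp))).elim
      · right
        refine ⟨⟨w, by simp, hlt⟩, ⟨w', ?_, h2⟩, h4⟩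
        rcases List.mem_cons.1 hw' with rfl | hw'
        · exact absurd (hle w (by simp)) (by linarith)
        · exact hw'
    · rintro x (⟨h1, h2, h3⟩ | ⟨⟨v', hv', h1⟩, ⟨w', hw', h2⟩, h3⟩) _
      · exact ⟨⟨v, by simp, h1⟩, ⟨w, by simp, h2⟩, h3⟩
      · exact ⟨⟨v', List.mem_cons_of_mem _ hv', h1⟩, ⟨w', List.mem_cons_of_mem _ hw', h2⟩, h3⟩

/-- Decomposition of the part of the family between two vertical lines. -/
lemma SlabFamily.dec [Fintype ι] (h : SlabFamily N D s e L) (hmem : ∀ i, D i ∈ 𝒟)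
    (hAN : A ∈ N) (hBN : B ∈ N) (hAB : A < B) (hA : ∀ k, A ≤ s k) (hB : ∀ k, e k ≤ B) :
    Dec N 𝒟 (225 * Fintype.card ι) {x | ∃ i, s i < x.1 ∧ x.1 < e i ∧ x ∈ D i}
      {x | A < x.1 ∧ x.1 < B} := by
  rcases isEmpty_or_nonempty ι with hι | hι
  · exact Dec.empty fun x hx _ => hι.elim hx.choose
  have hpos : 0 < Fintype.card ι := Fintype.card_pos
  obtain ⟨m, c, f, hS, hm⟩ := h.exists_state hmem hAN hBN hAB hA hB Finset.univ
  rw [Finset.card_univ] at hm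
  obtain ⟨u, hu, hu1⟩ := hS.first
  obtain ⟨u', hu', hu'1⟩ := hS.last
  have hAc : ∀ v ∈ c, A ≤ v.1 ∧ v.1 ≤ B := fun v hv => (hS.memN v hv).2
  refine (hS.dec.union (dec_above_of_isChain N h.conv h.closed hmem c hS.chain
    fun u hu => (hS.memN u hu).1) ?_).mono
    (by omega) ?_ ?_
  · rintro x ⟨-, -, h1⟩ ⟨-, -, h2⟩
    exact h2.not_ge h1
  · rintro x ⟨i, h1, h2, h3⟩ _
    have h4 := (hA i).trans_lt h1
    have h5 := h2.trans_le (hB i)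
    by_cases hf : x.2 < f x.1
    · exact Or.inl ⟨h4, h5, Or.inl ⟨hf, i, Finset.mem_univ _, h1, h2, h3⟩⟩
    · exact Or.inr ⟨⟨u, hu, by linarith⟩, ⟨u', hu', by linarith⟩, not_lt.1 hf, i,
        Finset.mem_univ _, h1, h2, h3⟩
  · rintro x (⟨h1, h2, -⟩ | ⟨⟨v, hv, h1⟩, ⟨w, hw, h2⟩, -⟩) _
    · exact ⟨h1, h2⟩
    · exact ⟨(hAc v hv).1.trans_lt h1, h2.trans_le (hAc w hw).2⟩

end MiddleSlab

section Assembly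
variable {ι : Type*} {N : Finset ℝ} {𝒟 : Set (Set (ℝ × ℝ))} {D : ι → Set (ℝ × ℝ)}

lemma eventually_constant_of_ordConnected {S : Set ℝ} (hS : S.OrdConnected) :
    ∀ᶠ R in Filter.atTop, ∀ t, R ≤ t → (t ∈ S ↔ R ∈ S) := by
  by_cases hb : BddAbove S
  · obtain ⟨M, hM⟩ := hb
    filter_upwards [Filter.eventually_gt_atTop M] with R hR t ht
    exact ⟨fun h => absurd (hM h) (by linarith), fun h => absurd (hM h) (by linarith)⟩
  · rw [not_bddAbove_iff] at hb
    obtain ⟨x, hx, -⟩ := hb 0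
    have key : ∀ t, x ≤ t → t ∈ S := by
      intro t ht
      obtain ⟨y, hy, hty⟩ := hb t
      exact hS.out hx hy ⟨ht, hty.le⟩
    filter_upwards [Filter.eventually_ge_atTop x] with R hR t ht
    exact ⟨fun _ => key R hR, fun _ => key t (hR.trans ht)⟩

lemma Dec.weaken {n : ℕ} {X Y : Set (ℝ × ℝ)} (h : Dec ∅ 𝒟 n X Y) : Dec N 𝒟 n X Y := by
  obtain ⟨F, h1, h2, h3, h4, h5⟩ := h
  exact ⟨F, h1, h2, h3, fun p hp _ => h4 p hp (by simp), fun R hR p hp _ => h5 R hR p hp (by simp)⟩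

lemma Dec.eventually_right [Fintype ι] {T : ι → Set ℝ} (hc : ∀ i, Convex ℝ (D i))
    (hcl : ∀ i, IsClosed (D i)) (hmem : ∀ i, D i ∈ 𝒟) (hTo : ∀ i, (T i).OrdConnected)
    (hT : ∀ i, ∀ t ∈ T i, ∃ y, (t, y) ∈ D i)
    (hanti : ∀ i j t, i ≠ j → t ∈ T i → t ∈ T j → ¬ {y | (t, y) ∈ D i} ⊆ {y | (t, y) ∈ D j}) :
    ∀ᶠ R in Filter.atTop, Dec N 𝒟 (4 * Fintype.card ι)
      {x | R ≤ x.1 ∧ ∃ i, x.1 ∈ T i ∧ x ∈ D i} {x | R < x.1} := by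
  have h1 : ∀ᶠ R in Filter.atTop, ∀ i, ∀ t, R ≤ t → (t ∈ T i ↔ R ∈ T i) :=
    Filter.eventually_all.2 fun i => eventually_constant_of_ordConnected (hTo i)
  have h2 : ∀ᶠ R in Filter.atTop, ∀ i j, ∀ t, R ≤ t →
      (t ∈ Prod.fst '' (D i ∩ D j) ↔ R ∈ Prod.fst '' (D i ∩ D j)) :=
    Filter.eventually_all.2 fun i => Filter.eventually_all.2 fun j =>
      eventually_constant_of_ordConnected
        ((((hc i).inter (hc j)).linear_image (LinearMap.fst ℝ ℝ ℝ)).ordConnected)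
  filter_upwards [h1, h2] with R h1 h2
  refine (Dec.right_slab (N := N) (Finset.univ.filter fun i => R ∈ T i) hc hcl hmem (R := R) ?_ ?_
    ?_).mono ?_ ?_ (fun _ hp _ => hp)
  · intro i hi t ht
    exact hT i t ((h1 i t ht).2 (Finset.mem_filter.1 hi).2)
  · intro i hi j hj hij t ht
    have hti := (h1 i t ht).2 (Finset.mem_filter.1 hi).2
    have htj := (h1 j t ht).2 (Finset.mem_filter.1 hj).2
    exact below_or_below (hc i) (hc j) (hanti i j t hij hti htj) (hanti j i t hij.symm htj hti)
  · rintro i - j - ⟨t, y, ht, hi, hj⟩ u hu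
    have h3 := (h2 i j u hu).2 ((h2 i j t ht).1 ⟨(t, y), ⟨hi, hj⟩, rfl⟩)
    obtain ⟨⟨u', y'⟩, h4, rfl⟩ := h3
    exact ⟨y', h4⟩
  · exact Nat.mul_le_mul_left _ (Finset.card_le_univ _)
  · rintro x ⟨hx, i, hi, hxi⟩ _
    exact ⟨hx, i, Finset.mem_filter.2 ⟨Finset.mem_univ _, (h1 i _ hx).1 hi⟩, hxi⟩

lemma Dec.eventually_left [Fintype ι] {T : ι → Set ℝ} (hc : ∀ i, Convex ℝ (D i))
    (hcl : ∀ i, IsClosed (D i)) (hmem : ∀ i, D i ∈ 𝒟) (hTo : ∀ i, (T i).OrdConnected)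
    (hT : ∀ i, ∀ t ∈ T i, ∃ y, (t, y) ∈ D i)
    (hanti : ∀ i j t, i ≠ j → t ∈ T i → t ∈ T j → ¬ {y | (t, y) ∈ D i} ⊆ {y | (t, y) ∈ D j}) :
    ∀ᶠ R in Filter.atBot, Dec N 𝒟 (4 * Fintype.card ι)
      {x | x.1 ≤ R ∧ ∃ i, x.1 ∈ T i ∧ x ∈ D i} {x | x.1 < R} := by
  have h := Dec.eventually_right (N := ∅) (𝒟 := (fun D => flipX ⁻¹' D) '' 𝒟)
    (D := fun i => flipX ⁻¹' D i) (T := fun i => (fun t => -t) ⁻¹' T i)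
    (fun i => (hc i).linear_preimage (flipX : (ℝ × ℝ) →ₗ[ℝ] (ℝ × ℝ)))
    (fun i => (hcl i).preimage flipX.continuous) (fun i => ⟨D i, hmem i, rfl⟩)
    (fun i => ⟨fun x hx y hy z hz => (hTo i).out hy hx
      ⟨neg_le_neg hz.2, neg_le_neg hz.1⟩⟩)
    (fun i t ht => hT i (-t) ht) (fun i j t hij h1 h2 => hanti i j (-t) hij h1 h2)
  filter_upwards [Filter.tendsto_neg_atBot_atTop.eventually h] with R hR
  refine Dec.weaken (Dec.of_flipX (hR.mono le_rfl ?_ ?_))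
  · rintro x ⟨h1, i, h2, h3⟩ _
    simp only [flipX_apply] at h1
    exact ⟨by linarith, i, h2, h3⟩
  · intro x hx _
    simp only [Set.mem_ofPred_eq, Set.mem_preimage, flipX_apply] at hx ⊢
    linarith

lemma exists_low {D : Set (ℝ × ℝ)} (hc : Convex ℝ D) (hcl : IsClosed D) {s e : ℝ}
    (hs : ∃ y, (s, y) ∈ D) (he : ∃ y, (e, y) ∈ D) : ∃ L₀, ∀ L ≤ L₀,
    ((s, L) ∈ D ∧ (e, L) ∈ D ∧ ∀ t y y', (t, y) ∈ D → y' ≤ y → (t, y') ∈ D) ∨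
      ∀ t y, (t, y) ∈ D → s ≤ t → t ≤ e → L < y := by
  by_cases hb : ∃ K, ∀ t y, (t, y) ∈ D → s ≤ t → t ≤ e → K < y
  · obtain ⟨K, hK⟩ := hb
    exact ⟨K, fun L hL => Or.inr fun t y h1 h2 h3 => hL.trans_lt (hK t y h1 h2 h3)⟩
  push Not at hb
  have hdown : ∀ t y y', (t, y) ∈ D → y' ≤ y → (t, y') ∈ D := by
    intro t y y' h1 h2
    have := up_closed_of_unbounded (D := flipY ⁻¹' D) (A := s) (B := e) (t := t) (y := -y)
      (y' := -y') (hc.linear_preimage (flipY : (ℝ × ℝ) →ₗ[ℝ] (ℝ × ℝ)))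
      (hcl.preimage flipY.continuous) ?_ (by simpa using h1) (by linarith)
    · simpa using this
    · intro K
      obtain ⟨t, y, h1, h2, h3, h4⟩ := hb (-K)
      exact ⟨t, -y, h2, h3, by linarith, by simpa using h1⟩
  obtain ⟨y, hy⟩ := hs
  obtain ⟨z, hz⟩ := he
  exact ⟨min y z, fun L hL => Or.inl ⟨hdown _ _ _ hy (hL.trans (min_le_left _ _)),
    hdown _ _ _ hz (hL.trans (min_le_right _ _)), hdown⟩⟩

lemma Dec.exists_middle [Fintype ι] {T : ι → Set ℝ} {A B : ℝ} (hAB : A < B)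
    (hc : ∀ i, Convex ℝ (D i)) (hcl : ∀ i, IsClosed (D i)) (hmem : ∀ i, D i ∈ 𝒟)
    (hproj : ∀ i, IsClosed (Prod.fst '' D i)) (hTo : ∀ i, (T i).OrdConnected)
    (hT : ∀ i, ∀ t ∈ T i, ∃ y, (t, y) ∈ D i)
    (hanti : ∀ i j t, i ≠ j → t ∈ T i → t ∈ T j → ¬ {y | (t, y) ∈ D i} ⊆ {y | (t, y) ∈ D j}) :
    ∃ N : Finset ℝ, A ∈ N ∧ B ∈ N ∧ Dec N 𝒟 (225 * Fintype.card ι)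
      {x | A < x.1 ∧ x.1 < B ∧ ∃ i, x.1 ∈ T i ∧ x ∈ D i} {x | A < x.1 ∧ x.1 < B} := by
  set S : ι → Set ℝ := fun i => T i ∩ Set.Ioo A B with hS
  have hSb : ∀ i, BddBelow (S i) := fun i => bddBelow_Ioo.mono Set.inter_subset_right
  have hSa : ∀ i, BddAbove (S i) := fun i => bddAbove_Ioo.mono Set.inter_subset_right
  set s : ι → ℝ := fun i => sInf (S i) with hs
  set e : ι → ℝ := fun i => sSup (S i) with he
  have hne : ∀ i, s i < e i → (S i).Nonempty := by
    intro i h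
    rw [Set.nonempty_iff_ne_empty]
    intro h0
    simp [hs, he, h0] at h
  have hin : ∀ i t, s i < t → t < e i → t ∈ T i := by
    intro i t h1 h2
    obtain ⟨a, ha, hat⟩ := exists_lt_of_csInf_lt (hne i (h1.trans h2)) h1
    obtain ⟨b, hb, htb⟩ := exists_lt_of_lt_csSup (hne i (h1.trans h2)) h2
    exact (hTo i).out ha.1 hb.1 ⟨hat.le, htb.le⟩
  have hslice : ∀ i t, t ∈ closure (S i) → ∃ y, (t, y) ∈ D i := by
    intro i t ht
    have hsub : S i ⊆ Prod.fst '' D i := by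
      rintro u ⟨hu, -⟩
      obtain ⟨y, hy⟩ := hT i u hu
      exact ⟨(u, y), hy, rfl⟩
    obtain ⟨⟨u, y⟩, hy, rfl⟩ := closure_minimal hsub (hproj i) ht
    exact ⟨y, hy⟩
  have hsl : ∀ i : {i // s i < e i}, ∃ y, (s i, y) ∈ D i := fun i =>
    hslice i _ (csInf_mem_closure (hne i i.2) (hSb i))
  have hel : ∀ i : {i // s i < e i}, ∃ y, (e i, y) ∈ D i := fun i =>
    hslice i _ (csSup_mem_closure (hne i i.2) (hSa i))
  choose L₀ hL₀ using fun i : {i // s i < e i} => exists_low (hc i) (hcl i) (hsl i) (hel i)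
  obtain ⟨L, hL⟩ := (Set.finite_range L₀).bddBelow
  refine ⟨{A, B} ∪ (Finset.univ.image s ∪ Finset.univ.image e), by simp, by simp, ?_⟩
  set N : Finset ℝ := {A, B} ∪ (Finset.univ.image s ∪ Finset.univ.image e) with hN
  have hfam : SlabFamily N (fun i : {i // s i < e i} => D i) (fun i => s i) (fun i => e i) L := by
    refine ⟨fun i => hc i, fun i => hcl i, fun i => i.2, fun i => by simp [hN], hsl, hel, ?_,
      fun i => hL₀ i L (hL ⟨i, rfl⟩)⟩
    intro i j hij t h1 h2 h3 h4
    have hij' : (i : ι) ≠ j := fun h => hij (Subtype.ext h)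
    exact below_or_below (hc i) (hc j) (hanti i j t hij' (hin i t h1 h2) (hin j t h3 h4))
      (hanti j i t hij'.symm (hin j t h3 h4) (hin i t h1 h2))
  refine (hfam.dec (fun i => hmem i) (A := A) (B := B) (by simp [hN]) (by simp [hN]) hAB
    (fun i => le_csInf (hne i i.2) fun t ht => ht.2.1.le)
    (fun i => csSup_le (hne i i.2) fun t ht => ht.2.2.le)).mono
    (Nat.mul_le_mul_left _ (Fintype.card_subtype_le _)) ?_ (fun _ hp _ => hp)
  rintro x ⟨h1, h2, i, hi, hxi⟩ hxN
  have hxS : x.1 ∈ S i := ⟨hi, h1, h2⟩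
  have h3 : s i < x.1 := lt_of_le_of_ne (csInf_le (hSb i) hxS) (by
    intro h; exact hxN (by simp [hN, ← h]))
  have h4 : x.1 < e i := lt_of_le_of_ne (le_csSup (hSa i) hxS) (by
    intro h; exact hxN (by simp [hN, h]))
  exact ⟨⟨i, h3.trans h4⟩, h3, h4, hxi⟩

lemma exists_dec [Fintype ι] (hc : ∀ i, Convex ℝ (D i)) (hcl : ∀ i, IsClosed (D i))
    (hmem : ∀ i, D i ∈ 𝒟) (hproj : ∀ i, IsClosed (Prod.fst '' D i))
    (hP : ∀ i j, IsPreconnected (D i \ D j)) :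
    ∃ N : Finset ℝ, Dec N 𝒟 (233 * Fintype.card ι) (⋃ i, D i) Set.univ := by
  have hfst : ∀ S : Set (ℝ × ℝ), IsPreconnected S → (Prod.fst '' S).OrdConnected :=
    fun S hS => (hS.image _ continuous_fst.continuousOn).ordConnected
  obtain ⟨T, T1, T2, -, T4, T5⟩ := exists_times (fun i t => {y | (t, y) ∈ D i})
    (by
      intro i
      convert hfst _ (hc i).isPreconnected using 1
      ext t
      simp [Set.Nonempty])
    (by
      intro i j
      convert hfst _ (hP i j) using 1
      ext t
      simp [Set.subset_def])
    Finset.univ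
  obtain ⟨B, hB⟩ := (Dec.eventually_right (N := ∅) hc hcl hmem T1 T2 T5).exists
  obtain ⟨A, hA, hAB⟩ := ((Dec.eventually_left (N := ∅) hc hcl hmem T1 T2 T5).and
    (Filter.eventually_lt_atBot B)).exists
  obtain ⟨N, hAN, hBN, hM⟩ := Dec.exists_middle hAB hc hcl hmem hproj T1 T2 T5
  refine ⟨N, ((hM.union hA.weaken ?_).union hB.weaken ?_).mono (by omega) ?_ (by simp)⟩
  · rintro x ⟨h1, -⟩ h2
    exact lt_asymm h1 h2
  · rintro x (⟨-, h1⟩ | h1) h2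
    · exact lt_asymm h1 h2
    · exact (h1.trans hAB).asymm h2
  · rintro ⟨t, y⟩ hx hxN
    obtain ⟨i, hi⟩ := Set.mem_iUnion.1 hx
    obtain ⟨j, hj, hsub⟩ := T4 i (Finset.mem_univ _) t ⟨y, hi⟩
    have hex : ∃ i, t ∈ T i ∧ (t, y) ∈ D i := ⟨j, hj, hsub hi⟩
    rcases lt_trichotomy t A with h | h | h
    · exact Or.inl (Or.inr ⟨h.le, hex⟩)
    · exact (hxN (by rwa [← h] at hAN)).elim
    rcases lt_trichotomy t B with h' | h' | h'
    · exact Or.inl (Or.inl ⟨h, h', hex⟩)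
    · exact (hxN (by rwa [← h'] at hBN)).elim
    · exact Or.inr ⟨h'.le, hex⟩

end Assembly

lemma HalfPl.isClosed {h : Set (ℝ × ℝ)} (hh : HalfPl h) : IsClosed h := by
  obtain ⟨a, b, c, -, rfl⟩ := hh
  exact isClosed_le (by fun_prop) continuous_const

lemma IsPiece.isClosed {D R : Set (ℝ × ℝ)} (hD : IsClosed D) (h : IsPiece D R) : IsClosed R := by
  obtain ⟨-, ⟨h₁, h₂, h₃, e₁, e₂, e₃, rfl⟩ | ⟨k, hk, rfl⟩⟩ := h
  · exact (e₁.isClosed.inter e₂.isClosed).inter e₃.isClosed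
  · exact hD.inter hk.isClosed

lemma exists_exact_cover {ι : Type*} [Fintype ι] {D : ι → Set (ℝ × ℝ)}
    (hc : ∀ i, Convex ℝ (D i)) (hcl : ∀ i, IsClosed (D i))
    (hproj : ∀ i, IsClosed (Prod.fst '' D i)) (hP : ∀ i j, IsPreconnected (D i \ D j)) :
    ∃ F : Finset (Set (ℝ × ℝ)), F.card ≤ 235 * Fintype.card ι ∧
      (∀ R ∈ F, ∃ i, IsPiece (D i) R) ∧
      (∀ R ∈ F, ∀ R' ∈ F, R ≠ R' → interior R ∩ interior R' = ∅) ∧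
      ∀ i, ∀ p ∈ D i, ∃ R ∈ F, p ∈ R := by
  obtain ⟨N, F, h1, h2, h3, h4, -⟩ := exists_dec (𝒟 := Set.range D) hc hcl
    (fun i => ⟨i, rfl⟩) hproj hP
  have hFcl : IsClosed (⋃ R ∈ F, R) := by
    refine isClosed_biUnion_finset fun R hR => ?_
    obtain ⟨_, ⟨i, rfl⟩, hi⟩ := h2 R hR
    exact hi.isClosed (hcl i)
  have h_interior : ∀ i, interior (D i) ⊆ ⋃ R ∈ F, R := by
    intro i p hp
    by_contra hpF
    obtain ⟨q, hq, hqN⟩ := exists_fst_notMem (isOpen_interior.sdiff hFcl) ⟨p, hp, hpF⟩ N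
    obtain ⟨R, hR, hqR⟩ := h4 q (Set.mem_iUnion.2 ⟨i, interior_subset hq.1⟩) hqN
    exact hq.2 (Set.mem_biUnion hR hqR)
  set flat : Finset ι := Finset.univ.filter fun i => interior (D i) = ∅
  set G₁ : Finset (Set (ℝ × ℝ)) :=
    flat.image fun i => D i ∩ {p | 1 * p.1 + 0 * p.2 ≤ (0 : ℝ)} with hG₁
  set G₂ : Finset (Set (ℝ × ℝ)) :=
    flat.image fun i => D i ∩ {p | -1 * p.1 + 0 * p.2 ≤ (0 : ℝ)} with hG₂
  have hG : ∀ R ∈ G₁ ∪ G₂, ∃ i, interior (D i) = ∅ ∧ IsPiece (D i) R := by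
    intro R hR
    rcases Finset.mem_union.1 hR with hR | hR <;> obtain ⟨i, hi, rfl⟩ := Finset.mem_image.1 hR
    · exact ⟨i, (Finset.mem_filter.1 hi).2, Set.inter_subset_left,
        Or.inr ⟨_, ⟨1, 0, 0, by simp, rfl⟩, rfl⟩⟩
    · exact ⟨i, (Finset.mem_filter.1 hi).2, Set.inter_subset_left,
        Or.inr ⟨_, ⟨-1, 0, 0, by simp, rfl⟩, rfl⟩⟩
  have hG0 : ∀ R ∈ G₁ ∪ G₂, interior R = ∅ := by
    intro R hR
    obtain ⟨i, hi, hsub, -⟩ := hG R hR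
    exact Set.subset_eq_empty (interior_mono hsub) hi
  refine ⟨F ∪ (G₁ ∪ G₂), ?_, ?_, ?_, ?_⟩
  · have e1 := Finset.card_union_le F (G₁ ∪ G₂)
    have e2 := Finset.card_union_le G₁ G₂
    have e3 : G₁.card ≤ flat.card := Finset.card_image_le
    have e4 : G₂.card ≤ flat.card := Finset.card_image_le
    have e5 : flat.card ≤ Fintype.card ι := Finset.card_le_univ _
    omega
  · intro R hR
    rcases Finset.mem_union.1 hR with hR | hR
    · obtain ⟨_, ⟨i, rfl⟩, hi⟩ := h2 R hR
      exact ⟨i, hi⟩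
    · obtain ⟨i, -, hi⟩ := hG R hR
      exact ⟨i, hi⟩
  · intro R hR R' hR' hne
    rcases Finset.mem_union.1 hR with hR | hR
    · rcases Finset.mem_union.1 hR' with hR' | hR'
      · exact h3 R hR R' hR' hne
      · rw [hG0 R' hR', Set.inter_empty]
    · rw [hG0 R hR, Set.empty_inter]
  · intro i p hp
    by_cases hi : interior (D i) = ∅
    · have hif : i ∈ flat := by simp [flat, hi]
      rcases le_total p.1 0 with h | h
      · exact ⟨_, Finset.mem_union_right _ (Finset.mem_union_left _
          (Finset.mem_image_of_mem _ hif)), hp, by simpa using h⟩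
      · exact ⟨_, Finset.mem_union_right _ (Finset.mem_union_right _
          (Finset.mem_image_of_mem _ hif)), hp, by simpa using h⟩
    · have hp' : p ∈ closure (interior (D i)) := by
        rw [(hc i).closure_interior_eq_closure_of_nonempty_interior
          (Set.nonempty_iff_ne_empty.2 hi)]
        exact subset_closure hp
      obtain ⟨R, hR, hpR⟩ := Set.mem_iUnion₂.1 (closure_minimal (h_interior i) hFcl hp')
      exact ⟨R, Finset.mem_union_left _ hR, hpR⟩

/-- The horizontal shear of `ℝ × ℝ` with slope `c`. -/
def shear (c : ℝ) : (ℝ × ℝ) ≃L[ℝ] (ℝ × ℝ) :=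
  ContinuousLinearEquiv.equivOfInverse
    ((ContinuousLinearMap.fst ℝ ℝ ℝ + c • ContinuousLinearMap.snd ℝ ℝ ℝ).prod
      (ContinuousLinearMap.snd ℝ ℝ ℝ))
    ((ContinuousLinearMap.fst ℝ ℝ ℝ - c • ContinuousLinearMap.snd ℝ ℝ ℝ).prod
      (ContinuousLinearMap.snd ℝ ℝ ℝ))
    (fun p => by ext <;> simp) (fun p => by ext <;> simp)

@[simp] lemma shear_apply (c : ℝ) (p : ℝ × ℝ) : shear c p = (p.1 + c * p.2, p.2) := by
  simp [shear]

lemma isClosed_fst_image_or {D : Set (ℝ × ℝ)} (hc : Convex ℝ D) (hcl : IsClosed D) :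
    IsClosed (Prod.fst '' D) ∨ (∀ t y y', (t, y) ∈ D → y ≤ y' → (t, y') ∈ D) ∨
      ∀ t y y', (t, y) ∈ D → y' ≤ y → (t, y') ∈ D := by
  by_contra hcon
  push Not at hcon
  obtain ⟨h0, ⟨t₁, y₁, y₁', h1, h1', h1''⟩, ⟨t₂, y₂, y₂', h2, h2', h2''⟩⟩ := hcon
  refine h0 (isClosed_of_closure_subset fun t ht => ?_)
  have hub : ∃ K, ∀ u y, t - 1 ≤ u → u ≤ t + 1 → (u, y) ∈ D → y ≤ K := by
    by_contra hK
    push Not at hK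
    refine h1'' (up_closed_of_unbounded hc hcl (A := t - 1) (B := t + 1) (fun K => ?_) h1 h1')
    obtain ⟨u, y, e1, e2, e3, e4⟩ := hK K
    exact ⟨u, y, e1, e2, e4.le, e3⟩
  have hlb : ∃ K, ∀ u y, t - 1 ≤ u → u ≤ t + 1 → (u, y) ∈ D → K ≤ y := by
    by_contra hK
    push Not at hK
    have := up_closed_of_unbounded (D := flipY ⁻¹' D)
      (hc.is_linear_preimage flipY.toLinearMap.isLinear) (hcl.preimage flipY.continuous)
      (A := t - 1) (B := t + 1) (t := t₂) (y := -y₂) (y' := -y₂')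
      (fun K => by
        obtain ⟨u, y, e1, e2, e3, e4⟩ := hK (-K)
        exact ⟨u, -y, e1, e2, by linarith, by simpa using e3⟩) (by simpa using h2) (by linarith)
    exact h2'' (by simpa using this)
  obtain ⟨K, hK⟩ := hub
  obtain ⟨L, hL⟩ := hlb
  have hcomp : IsCompact (Prod.fst '' (D ∩ Set.Icc (t - 1) (t + 1) ×ˢ Set.Icc L K)) :=
    ((isCompact_Icc.prod isCompact_Icc).inter_left hcl).image continuous_fst
  have hmem : t ∈ closure (Prod.fst '' (D ∩ Set.Icc (t - 1) (t + 1) ×ˢ Set.Icc L K)) := by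
    rw [mem_closure_iff_nhds] at ht ⊢
    intro s hs
    obtain ⟨_, ⟨hus, hu⟩, ⟨⟨u, y⟩, hD, rfl⟩⟩ :=
      ht _ (Filter.inter_mem hs (Icc_mem_nhds (a := t - 1) (b := t + 1) (by linarith) (by linarith)))
    exact ⟨u, hus, (u, y), ⟨hD, hu, hL u y hu.1 hu.2 hD, hK u y hu.1 hu.2 hD⟩, rfl⟩
  rw [hcomp.isClosed.closure_eq] at hmem
  exact Set.image_mono Set.inter_subset_left hmem

lemma finite_of_no_three {S : Set ℝ}
    (h : ∀ a ∈ S, ∀ b ∈ S, ∀ c ∈ S, a < b → b < c → False) : S.Finite := by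
  by_contra hS
  obtain ⟨T, hTS, hT⟩ := Set.Infinite.exists_subset_card_eq hS 3
  have hmem : ∀ i, T.orderEmbOfFin hT i ∈ S := fun i => hTS (T.orderEmbOfFin_mem hT i)
  exact h _ (hmem 0) _ (hmem 1) _ (hmem 2) ((T.orderEmbOfFin hT).strictMono (by decide))
    ((T.orderEmbOfFin hT).strictMono (by decide))

lemma fst_image_shear_eq_univ {D : Set (ℝ × ℝ)} (hc : Convex ℝ D) (hne : D.Nonempty)
    {v w : ℝ × ℝ} {b : ℝ} (hv : ∀ p ∈ D, ∀ s : ℝ, 0 ≤ s → p + s • v ∈ D)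
    (hw : ∀ p ∈ D, ∀ s : ℝ, 0 ≤ s → p + s • w ∈ D) (hbv : 0 < v.1 + b * v.2)
    (hbw : w.1 + b * w.2 < 0) : Prod.fst '' (shear b '' D) = Set.univ := by
  have hord : (Prod.fst '' (shear b '' D)).OrdConnected :=
    ((hc.isPreconnected.image _ (shear b).continuous.continuousOn).image _
      continuous_fst.continuousOn).ordConnected
  obtain ⟨q, hq⟩ := hne
  have hmem : ∀ p ∈ D, p.1 + b * p.2 ∈ Prod.fst '' (shear b '' D) := fun p hp =>
    ⟨_, ⟨p, hp, rfl⟩, by simp⟩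
  refine Set.eq_univ_of_forall fun z => ?_
  have e1 := hmem _ (hv q hq (|z - (q.1 + b * q.2)| / (v.1 + b * v.2)) (by positivity))
  have e2 := hmem _ (hw q hq (|z - (q.1 + b * q.2)| / -(w.1 + b * w.2))
    (div_nonneg (abs_nonneg _) (by linarith)))
  refine hord.out e2 e1 ⟨?_, ?_⟩
  · have : |z - (q.1 + b * q.2)| / -(w.1 + b * w.2) * -(w.1 + b * w.2) = |z - (q.1 + b * q.2)| :=
      div_mul_cancel₀ _ (by linarith)
    have h3 := neg_abs_le (z - (q.1 + b * q.2))
    simp only [Prod.fst_add, Prod.snd_add, Prod.smul_fst, Prod.smul_snd, smul_eq_mul]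
    linarith
  · have : |z - (q.1 + b * q.2)| / (v.1 + b * v.2) * (v.1 + b * v.2) = |z - (q.1 + b * q.2)| :=
      div_mul_cancel₀ _ hbv.ne'
    have h3 := le_abs_self (z - (q.1 + b * q.2))
    simp only [Prod.fst_add, Prod.snd_add, Prod.smul_fst, Prod.smul_snd, smul_eq_mul]
    linarith

lemma finite_shear_not_isClosed {D : Set (ℝ × ℝ)} (hc : Convex ℝ D) (hcl : IsClosed D) :
    {c | ¬ IsClosed (Prod.fst '' (shear c '' D))}.Finite := by
  rcases D.eq_empty_or_nonempty with rfl | hne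
  · simp
  have hdir : ∀ σ : ℝ, σ ≠ 0 → {c | ¬ IsClosed (Prod.fst '' (shear c '' D)) ∧
      ∀ p ∈ D, ∀ s : ℝ, 0 ≤ s → p + s • ((-σ * c, σ) : ℝ × ℝ) ∈ D}.Finite := by
    intro σ hσ
    refine finite_of_no_three fun a ha b hb c hc' hab hbc => hb.1 ?_
    rcases lt_or_gt_of_ne hσ with h | h
    · rw [fst_image_shear_eq_univ hc hne hc'.2 ha.2 (by simp only; nlinarith)
        (by simp only; nlinarith)]
      exact isClosed_univ
    · rw [fst_image_shear_eq_univ hc hne ha.2 hc'.2 (by simp only; nlinarith)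
        (by simp only; nlinarith)]
      exact isClosed_univ
  refine ((hdir 1 one_ne_zero).union (hdir (-1) (by norm_num))).subset fun c hcD => ?_
  have hmem : ∀ t y, (t, y) ∈ shear c '' D ↔ (t - c * y, y) ∈ D := by
    intro t y
    constructor
    · rintro ⟨⟨x, z⟩, hx, he⟩
      simp only [shear_apply, Prod.mk.injEq] at he
      obtain ⟨rfl, rfl⟩ := he
      simpa using hx
    · intro h
      exact ⟨_, h, by simp⟩
  rcases isClosed_fst_image_or (hc.is_linear_image (shear c).toLinearMap.isLinear)
    ((shear c).toHomeomorph.isClosedMap _ hcl) with h | h | h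
  · exact absurd h hcD
  · refine Or.inl ⟨hcD, ?_⟩
    rintro ⟨x, y⟩ hp s hs
    have := h (x + c * y) y (y + s) ((hmem _ _).2 (by simpa using hp)) (by linarith)
    replace this := (hmem _ _).1 this
    convert this using 1
    ext <;> simp
    ring
  · refine Or.inr ⟨hcD, ?_⟩
    rintro ⟨x, y⟩ hp s hs
    have := h (x + c * y) y (y - s) ((hmem _ _).2 (by simpa using hp)) (by linarith)
    replace this := (hmem _ _).1 this
    convert this using 1
    ext <;> simp <;> ring

lemma exists_shear_isClosed {ι : Type*} [Finite ι] {D : ι → Set (ℝ × ℝ)}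
    (hc : ∀ i, Convex ℝ (D i)) (hcl : ∀ i, IsClosed (D i)) :
    ∃ c, ∀ i, IsClosed (Prod.fst '' (shear c '' D i)) := by
  obtain ⟨c, hcm⟩ := (Set.finite_iUnion fun i =>
    finite_shear_not_isClosed (hc i) (hcl i)).infinite_compl.nonempty
  refine ⟨c, fun i => ?_⟩
  by_contra h
  exact hcm (Set.mem_iUnion.2 ⟨i, h⟩)

lemma HalfPl.preimage {e : (Fin 2 → ℝ) ≃L[ℝ] (ℝ × ℝ)} {h : Set (ℝ × ℝ)} (hh : HalfPl h) :
    IsClosedHalfplane (e ⁻¹' h) := by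
  obtain ⟨a, b, c, hab, rfl⟩ := hh
  have hlin : ∀ x : Fin 2 → ℝ, a * (e x).1 + b * (e x).2 =
      (a * (e ![1, 0]).1 + b * (e ![1, 0]).2) * x 0 +
        (a * (e ![0, 1]).1 + b * (e ![0, 1]).2) * x 1 := by
    intro x
    have : x = x 0 • ![1, 0] + x 1 • ![0, 1] := by ext i; fin_cases i <;> simp
    conv_lhs => rw [this]
    rw [map_add, map_smul, map_smul]
    simp
    ring
  refine ⟨![a * (e ![1, 0]).1 + b * (e ![1, 0]).2, a * (e ![0, 1]).1 + b * (e ![0, 1]).2],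
    fun h0 => ?_, c, by
      ext x; simp only [Set.mem_preimage, Set.mem_ofPred_eq]; rw [hlin x]; simp⟩
  have h1 := congrFun h0 0
  have h2 := congrFun h0 1
  simp only [Matrix.cons_val_zero, Matrix.cons_val_one, Pi.zero_apply] at h1 h2
  have h3 := hlin (e.symm (a, b))
  rw [h1, h2] at h3
  simp only [ContinuousLinearEquiv.apply_symm_apply, zero_mul, add_zero] at h3
  rcases hab with h | h
  · have := mul_self_pos.2 h; nlinarith [mul_self_nonneg b]
  · have := mul_self_pos.2 h; nlinarith [mul_self_nonneg a]

/-- The union of `m` convex pseudo-disks can be partitioned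
into `O(m)` pairwise openly disjoint triangles and caps, each fully contained
in a single pseudo-disk. -/
theorem confined_triangulation_of_union :
    ∃ C : ℝ, 0 < C ∧
      ∀ 𝒟 : Finset (Set (Fin 2 → ℝ)), IsPseudoDiskFamily 𝒟 →
        ∃ F : Finset (Set (Fin 2 → ℝ)),
          (F.card : ℝ) ≤ C * 𝒟.card ∧
          (∀ R₁ ∈ F, ∀ R₂ ∈ F, R₁ ≠ R₂ →
            interior R₁ ∩ interior R₂ = ∅) ∧
          ⋃₀ (F : Set (Set (Fin 2 → ℝ))) = ⋃₀ (𝒟 : Set (Set (Fin 2 → ℝ))) ∧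
          (∀ R ∈ F, ∃ D ∈ 𝒟, R ⊆ D ∧ (IsTriangleLike R ∨ IsCapOf D R)) := by
  refine ⟨235, by norm_num, fun 𝒟 h𝒟 => ?_⟩
  let e₀ := ContinuousLinearEquiv.finTwoArrow ℝ ℝ
  have him : ∀ (e : (Fin 2 → ℝ) ≃L[ℝ] (ℝ × ℝ)) (i : 𝒟), Convex ℝ (e '' (i : Set (Fin 2 → ℝ))) ∧
      IsClosed (e '' (i : Set (Fin 2 → ℝ))) := fun e i =>
    ⟨(h𝒟.1 i i.2).1.is_linear_image e.toLinearMap.isLinear,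
      e.toHomeomorph.isClosedMap _ (h𝒟.1 i i.2).2⟩
  obtain ⟨c, hc⟩ := exists_shear_isClosed (fun i => (him e₀ i).1) (fun i => (him e₀ i).2)
  set e := e₀.trans (shear c)
  have hcomp : ∀ S : Set (Fin 2 → ℝ), shear c '' (e₀ '' S) = e '' S := fun S =>
    Set.image_image _ _ _
  simp only [hcomp] at hc
  obtain ⟨F, h1, h2, h3, h4⟩ := exists_exact_cover (fun i => (him e i).1) (fun i => (him e i).2) hc
    (fun i j => by
      rw [← Set.image_sdiff e.injective]
      exact (h𝒟.2 i i.2 j j.2).image _ e.continuous.continuousOn)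
  have h_interior : ∀ R : Set (ℝ × ℝ), interior (e ⁻¹' R) = e ⁻¹' interior R := fun R =>
    (e.toHomeomorph.preimage_interior R).symm
  have hpiece : ∀ R ∈ F.image (fun R => e ⁻¹' R),
      ∃ D ∈ 𝒟, R ⊆ D ∧ (IsTriangleLike R ∨ IsCapOf D R) := by
    intro R hR
    obtain ⟨R₀, hR₀, rfl⟩ := Finset.mem_image.1 hR
    obtain ⟨i, hsub, hcase⟩ := h2 R₀ hR₀
    have hpre : e ⁻¹' (e '' (i : Set (Fin 2 → ℝ))) = i := e.injective.preimage_image _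
    refine ⟨i, i.2, hpre ▸ Set.preimage_mono hsub, ?_⟩
    rcases hcase with ⟨k₁, k₂, k₃, e₁, e₂, e₃, rfl⟩ | ⟨k, hk, rfl⟩
    · exact Or.inl ⟨_, _, _, e₁.preimage, e₂.preimage, e₃.preimage, rfl⟩
    · exact Or.inr ⟨_, hk.preimage, by rw [Set.preimage_inter, hpre]⟩
  refine ⟨F.image (fun R => e ⁻¹' R), ?_, ?_, ?_, hpiece⟩
  · have h5 : (F.image (fun R => e ⁻¹' R)).card ≤ 235 * 𝒟.card := by
      simpa using Finset.card_image_le.trans h1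
    exact_mod_cast h5
  · intro R hR R' hR' hne
    obtain ⟨R₀, hR₀, rfl⟩ := Finset.mem_image.1 hR
    obtain ⟨R₁, hR₁, rfl⟩ := Finset.mem_image.1 hR'
    rw [h_interior, h_interior, ← Set.preimage_inter, h3 R₀ hR₀ R₁ hR₁ (by rintro rfl; exact hne rfl),
      Set.preimage_empty]
  · ext x
    constructor
    · rintro ⟨R, hR, hx⟩
      obtain ⟨D, hD, hsub, -⟩ := hpiece R hR
      exact ⟨D, hD, hsub hx⟩
    · rintro ⟨D, hD, hx⟩
      obtain ⟨R, hR, hxR⟩ := h4 ⟨D, hD⟩ (e x) ⟨x, hx, rfl⟩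
      exact ⟨_, Finset.mem_coe.2 (Finset.mem_image_of_mem _ hR), hxR⟩
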